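/- Let T be a near-triangulation with boundary cycle C = (u_1, ..., u_h, u_1) that has no diagonals and contains at least one interior vertex, and let u_i be a boundary vertex. If the boundary edge (u_{i−1}, u_i) is not contractible in T, then there exists an interior vertex v_i adjacent to u_i such that T − {u_i, v_i} is a near-triangulation. -/

import Mathlib

/-!
Common definitions.

A *plane graph* is a finite graph whose vertices are points of the plane `ℝ × ℝ` and whose
edges are drawn as straight-line segments between their endpoints (by Fáry's theorem every
planar graph admits such a drawing).  A *near-triangulation* is a plane graph that is properly
embedded, biconnected, and all of whose bounded faces are triangles (the faces are the
connected components of the complement of the drawing).  The boundary cycle lists, cyclically,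
the vertices on the outer (unbounded) face.
-/

open scoped Classical

noncomputable section

/-- A finite graph drawn in the plane: the vertices are points of `ℝ × ℝ` and each edge is
drawn as the straight-line segment between its endpoints. -/
structure PlaneGraph where
  verts : Finset (ℝ × ℝ)
  Adj : ℝ × ℝ → ℝ × ℝ → Prop
  symm : ∀ p q, Adj p q → Adj q p
  loopless : ∀ p, ¬ Adj p p
  mem_of_adj : ∀ p q, Adj p q → p ∈ verts ∧ q ∈ verts

namespace PlaneGraph

variable (G : PlaneGraph)

/-- The union of the (closed) segments realizing the edges of the graph. -/
def drawing : Set (ℝ × ℝ) := {x | ∃ p q, G.Adj p q ∧ x ∈ segment ℝ p q}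

/-- The straight-line drawing is a proper plane embedding: two edges meet only in common
endpoints and no vertex lies on an edge of which it is not an endpoint. -/
def IsEmbedded : Prop :=
  (∀ p q r s, G.Adj p q → G.Adj r s → ∀ x, x ∈ segment ℝ p q → x ∈ segment ℝ r s →
      ({p, q} : Set (ℝ × ℝ)) = {r, s} ∨
        (x ∈ ({p, q} : Set (ℝ × ℝ)) ∧ x ∈ ({r, s} : Set (ℝ × ℝ)))) ∧
  (∀ p q v, G.Adj p q → v ∈ G.verts → v ∈ segment ℝ p q → v = p ∨ v = q)

/-- Reachability by walks in the graph. -/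
def Reachable (p q : ℝ × ℝ) : Prop := Relation.ReflTransGen G.Adj p q

/-- The graph is connected. -/
def Connected : Prop := G.verts.Nonempty ∧ ∀ p ∈ G.verts, ∀ q ∈ G.verts, G.Reachable p q

/-- Deletion of a set of vertices together with all incident edges. -/
def deleteVerts (S : Finset (ℝ × ℝ)) : PlaneGraph where
  verts := G.verts \ S
  Adj := fun p q => G.Adj p q ∧ p ∉ S ∧ q ∉ S
  symm := fun p q h => ⟨G.symm p q h.1, h.2.2, h.2.1⟩
  loopless := fun p h => G.loopless p h.1
  mem_of_adj := fun p q h => by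
    obtain ⟨h1, h2⟩ := G.mem_of_adj p q h.1
    exact ⟨Finset.mem_sdiff.mpr ⟨h1, h.2.1⟩, Finset.mem_sdiff.mpr ⟨h2, h.2.2⟩⟩

/-- Deletion of a single edge (keeping all vertices). -/
def deleteEdge (p q : ℝ × ℝ) : PlaneGraph where
  verts := G.verts
  Adj := fun a b => G.Adj a b ∧ ¬ ((a = p ∧ b = q) ∨ (a = q ∧ b = p))
  symm := fun a b h => ⟨G.symm a b h.1, by tauto⟩
  loopless := fun a h => G.loopless a h.1
  mem_of_adj := fun a b h => G.mem_of_adj a b h.1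

/-- The (abstract, simple) graph obtained by contracting the edge `(p, q)`:
the vertex `q` is merged into `p`, which becomes the new contracted vertex. -/
def contractEdge (p q : ℝ × ℝ) : PlaneGraph where
  verts := G.verts.erase q
  Adj := fun a b =>
    a ≠ b ∧ a ∈ G.verts.erase q ∧ b ∈ G.verts.erase q ∧
      (G.Adj a b ∨ (a = p ∧ G.Adj q b) ∨ (b = p ∧ G.Adj q a))
  symm := fun a b h => by
    obtain ⟨h1, h2, h3, h4⟩ := h
    refine ⟨h1.symm, h3, h2, ?_⟩
    rcases h4 with h4 | h4 | h4
    · exact Or.inl (G.symm _ _ h4)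
    · exact Or.inr (Or.inr h4)
    · exact Or.inr (Or.inl h4)
  loopless := fun a h => h.1 rfl
  mem_of_adj := fun a b h => ⟨h.2.1, h.2.2.1⟩

/-- Biconnectivity: at least three vertices, connected, and deleting any single vertex leaves
a connected graph. -/
def Biconnected : Prop :=
  3 ≤ G.verts.card ∧ G.Connected ∧ ∀ v ∈ G.verts, (G.deleteVerts {v}).Connected

/-- A face of the plane graph: a connected component of the complement of the drawing. -/
def IsFace (F : Set (ℝ × ℝ)) : Prop :=
  ∃ x, x ∉ G.drawing ∧ F = connectedComponentIn G.drawingᶜ x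

/-- The open triangle with the three given corners. -/
def openTriangle (a b c : ℝ × ℝ) : Set (ℝ × ℝ) :=
  interior (convexHull ℝ ({a, b, c} : Set (ℝ × ℝ)))

/-- Every bounded (inner) face of the drawing is a triangular face of the graph. -/
def InnerFacesTriangles : Prop :=
  ∀ F, G.IsFace F → Bornology.IsBounded F →
    ∃ a ∈ G.verts, ∃ b ∈ G.verts, ∃ c ∈ G.verts,
      G.Adj a b ∧ G.Adj b c ∧ G.Adj a c ∧ F = openTriangle a b c

/-- A near-triangulation: a properly embedded biconnected plane graph all of whose faces are
triangles, except possibly the outer (unbounded) face. -/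
def IsNearTriangulation : Prop :=
  G.IsEmbedded ∧ G.Biconnected ∧ G.InnerFacesTriangles

/-- The outer region: the union of the unbounded components of the complement of the
drawing (for a near-triangulation this is the outer face). -/
def outerRegion : Set (ℝ × ℝ) :=
  {x | x ∉ G.drawing ∧ ¬ Bornology.IsBounded (connectedComponentIn G.drawingᶜ x)}

/-- `u : ZMod h → ℝ × ℝ` is the boundary cycle of `G`: an injective cyclic sequence
`u 0, u 1, …, u (h-1)` of vertices, consecutive ones adjacent, whose edges bound the outer
face and which contains every vertex lying on the boundary of the outer face. -/
def IsBoundaryCycle {h : ℕ} (u : ZMod h → ℝ × ℝ) : Prop :=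
  3 ≤ h ∧ Function.Injective u ∧
  (∀ i, u i ∈ G.verts) ∧
  (∀ i, G.Adj (u i) (u (i + 1))) ∧
  (∀ i, segment ℝ (u i) (u (i + 1)) ⊆ frontier G.outerRegion) ∧
  (∀ v ∈ G.verts, (v : ℝ × ℝ) ∈ frontier G.outerRegion → v ∈ Set.range u)

/-- An interior vertex: a vertex not on the boundary cycle. -/
def IsInteriorVtx {h : ℕ} (u : ZMod h → ℝ × ℝ) (v : ℝ × ℝ) : Prop :=
  v ∈ G.verts ∧ v ∉ Set.range u

/-- The edge `(p, q)` is a diagonal: it joins two non-consecutive boundary vertices. -/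
def IsDiagonalEdge {h : ℕ} (u : ZMod h → ℝ × ℝ) (p q : ℝ × ℝ) : Prop :=
  G.Adj p q ∧ ∃ i j : ZMod h, p = u i ∧ q = u j ∧ j ≠ i + 1 ∧ i ≠ j + 1

/-- The graph has no diagonals: any edge between boundary vertices joins consecutive ones. -/
def HasNoDiagonals {h : ℕ} (u : ZMod h → ℝ × ℝ) : Prop :=
  ∀ i j : ZMod h, G.Adj (u i) (u j) → j = i + 1 ∨ i = j + 1

/-- The degree of a vertex. -/
def degree (v : ℝ × ℝ) : ℕ := (G.verts.filter (fun w => G.Adj v w)).card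

/-- The degree of a vertex in the subgraph induced on the set `S` of vertices. -/
def degreeOn (S : Set (ℝ × ℝ)) (v : ℝ × ℝ) : ℕ :=
  (G.verts.filter (fun w => G.Adj v w ∧ w ∈ S)).card

/-- A total dominating set: every vertex of the graph is adjacent to a member of `D`. -/
def IsTDS (D : Finset (ℝ × ℝ)) : Prop :=
  D ⊆ G.verts ∧ ∀ v ∈ G.verts, ∃ d ∈ D, G.Adj v d

/-- The total domination number `γₜ`. -/
def totalDominationNumber : ℕ :=
  sInf {k | ∃ D : Finset (ℝ × ℝ), G.IsTDS D ∧ D.card = k}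

/-- Isomorphism of plane graphs as abstract graphs. -/
def IsIsoTo (H : PlaneGraph) : Prop :=
  ∃ f : ℝ × ℝ → ℝ × ℝ,
    Set.BijOn f (↑G.verts) (↑H.verts) ∧
    ∀ p ∈ G.verts, ∀ q ∈ G.verts, (G.Adj p q ↔ H.Adj (f p) (f q))

/-- The edge `(p, q)` is contractible: the contracted graph `G/e` is (abstractly isomorphic
to) a near-triangulation. -/
def IsContractible (p q : ℝ × ℝ) : Prop :=
  G.Adj p q ∧ ∃ H : PlaneGraph, H.IsNearTriangulation ∧ (G.contractEdge p q).IsIsoTo H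

/-- A separating triangle: a triangle of the graph with some vertex strictly inside it and
some vertex outside it. -/
def IsSeparatingTriangle (a b c : ℝ × ℝ) : Prop :=
  a ∈ G.verts ∧ b ∈ G.verts ∧ c ∈ G.verts ∧
  G.Adj a b ∧ G.Adj b c ∧ G.Adj a c ∧
  (∃ v ∈ G.verts, v ∈ openTriangle a b c) ∧
  (∃ v ∈ G.verts, v ∉ convexHull ℝ ({a, b, c} : Set (ℝ × ℝ)))

/-- Edge list of the first exceptional 12-vertex maximal outerplanar graph `H₁`
(boundary 12-cycle, central triangle `{0,4,8}`, ear triangles `{1,2,3}`, `{5,6,7}`,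
`{9,10,11}`, and the three remaining quadrilateral diagonals, all with the same
orientation). -/
def exc1Edges : List (Fin 12 × Fin 12) :=
  [(0,1),(1,2),(2,3),(3,4),(4,5),(5,6),(6,7),(7,8),(8,9),(9,10),(10,11),(11,0),
   (0,4),(4,8),(0,8),(1,3),(5,7),(9,11),(0,3),(4,7),(8,11)]

/-- Edge list of the second exceptional 12-vertex maximal outerplanar graph `H₂`
(same as `H₁` except that one quadrilateral diagonal has the opposite orientation). -/
def exc2Edges : List (Fin 12 × Fin 12) :=
  [(0,1),(1,2),(2,3),(3,4),(4,5),(5,6),(6,7),(7,8),(8,9),(9,10),(10,11),(11,0),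
   (0,4),(4,8),(0,8),(1,3),(5,7),(9,11),(0,3),(4,7),(0,9)]

/-- The exceptional graph `H₁`. -/
def H1graph : SimpleGraph (Fin 12) := SimpleGraph.fromRel (fun a b => (a, b) ∈ exc1Edges)

/-- The exceptional graph `H₂`. -/
def H2graph : SimpleGraph (Fin 12) := SimpleGraph.fromRel (fun a b => (a, b) ∈ exc2Edges)

/-- Isomorphism between a plane graph and a simple graph on `Fin 12`. -/
def IsIsoToSG (H : SimpleGraph (Fin 12)) : Prop :=
  ∃ f : ℝ × ℝ → Fin 12,
    Set.BijOn f (↑G.verts) Set.univ ∧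
    ∀ p ∈ G.verts, ∀ q ∈ G.verts, (G.Adj p q ↔ H.Adj (f p) (f q))

/-- `G` is isomorphic to `H₁` or to `H₂`. -/
def IsExceptional : Prop := G.IsIsoToSG H1graph ∨ G.IsIsoToSG H2graph

/-- A maximal outerplanar graph (MOP): a near-triangulation all of whose vertices lie on the
boundary cycle. -/
def IsMOP : Prop :=
  G.IsNearTriangulation ∧
    ∃ (h : ℕ) (u : ZMod h → ℝ × ℝ), G.IsBoundaryCycle u ∧ ∀ v ∈ G.verts, v ∈ Set.range u

/-- The graph is Hamiltonian: it has a cycle through all of its vertices. -/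
def IsHamiltonian : Prop :=
  ∃ (m : ℕ) (c : ZMod m → ℝ × ℝ), 3 ≤ m ∧ Function.Injective c ∧
    (∀ i, G.Adj (c i) (c (i + 1))) ∧ ∀ v ∈ G.verts, v ∈ Set.range c

/-- An outerplane graph: a properly embedded plane graph all of whose vertices lie on the
boundary of the outer region. -/
def IsOuterplane : Prop :=
  G.IsEmbedded ∧ ∀ v ∈ G.verts, (v : ℝ × ℝ) ∈ closure G.outerRegion

/-- The union of the boundary-cycle segments. -/
def boundaryDrawing {h : ℕ} (u : ZMod h → ℝ × ℝ) : Set (ℝ × ℝ) :=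
  ⋃ i : ZMod h, segment ℝ (u i) (u (i + 1))

/-- The open interior of the boundary cycle, viewed as a simple closed polygon. -/
def polygonInterior {h : ℕ} (u : ZMod h → ℝ × ℝ) : Set (ℝ × ℝ) :=
  {x | x ∉ boundaryDrawing u ∧
    Bornology.IsBounded (connectedComponentIn (boundaryDrawing u)ᶜ x)}

/-- The union of the segments realizing the diagonals of `G[C]`. -/
def diagonalDrawing {h : ℕ} (u : ZMod h → ℝ × ℝ) : Set (ℝ × ℝ) :=
  {x | ∃ i j : ZMod h, G.Adj (u i) (u j) ∧ j ≠ i + 1 ∧ i ≠ j + 1 ∧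
    x ∈ segment ℝ (u i) (u j)}

/-- A region of the subdivision of the interior of the boundary cycle by the diagonals of
`G[C]`: a connected component of the interior of the cycle minus the diagonals. -/
def IsSubdivisionRegion {h : ℕ} (u : ZMod h → ℝ × ℝ) (R : Set (ℝ × ℝ)) : Prop :=
  ∃ x ∈ polygonInterior u \ G.diagonalDrawing u,
    R = connectedComponentIn (polygonInterior u \ G.diagonalDrawing u) x

/-- The diagonal `(u i, u j)` is a side of the region `R`. -/
def IsSideOf {h : ℕ} (u : ZMod h → ℝ × ℝ) (R : Set (ℝ × ℝ)) (i j : ZMod h) : Prop :=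
  G.Adj (u i) (u j) ∧ j ≠ i + 1 ∧ i ≠ j + 1 ∧
    segment ℝ (u i) (u j) \ {u i, u j} ⊆ frontier R

/-- `v` lies on the opposite side of the diagonal `(u i, u j)` from the region `R`:
inside the boundary polygon, `v` cannot be joined to `R` without crossing the diagonal. -/
def OppositeSideOf {h : ℕ} (u : ZMod h → ℝ × ℝ) (R : Set (ℝ × ℝ)) (i j : ZMod h)
    (v : ℝ × ℝ) : Prop :=
  ∀ x ∈ R, v ∉ connectedComponentIn (polygonInterior u \ segment ℝ (u i) (u j)) x

/-- A terminal polygon: a region of the subdivision containing some interior vertex such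
that at most one of its sides has interior vertices of `G` on its opposite side
(i.e. at most one of the outer parts `T_out(P,d)` contains interior vertices). -/
def IsTerminalPolygon {h : ℕ} (u : ZMod h → ℝ × ℝ) (R : Set (ℝ × ℝ)) : Prop :=
  G.IsSubdivisionRegion u R ∧
  (∃ v, G.IsInteriorVtx u v ∧ v ∈ R) ∧
  ∀ i j k l : ZMod h,
    G.IsSideOf u R i j → G.IsSideOf u R k l →
    (∃ w, G.IsInteriorVtx u w ∧ OppositeSideOf u R i j w) →
    (∃ w, G.IsInteriorVtx u w ∧ OppositeSideOf u R k l w) →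
    ({u i, u j} : Set (ℝ × ℝ)) = {u k, u l}

/-- An irreducible near-triangulation: it has interior vertices, and for every boundary edge
`(u i, u (i+1))` the third vertex of the inner triangular face containing this edge also lies
on the boundary cycle. -/
def Irreducible {h : ℕ} (u : ZMod h → ℝ × ℝ) : Prop :=
  (∃ v, G.IsInteriorVtx u v) ∧
  ∀ i : ZMod h, ∀ v ∈ G.verts,
    G.Adj (u i) v → G.Adj (u (i + 1)) v →
    G.IsFace (openTriangle (u i) (u (i + 1)) v) → v ∈ Set.range u

end PlaneGraph

namespace PlaneGraph

/-- The cross product `(b - a) × (c - a)`, scaled by `σ`; with `σ = 1` it is positive exactly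
when `a`, `b`, `c` are in counterclockwise order, with `σ = -1` when they are in clockwise
order. -/
def cr (σ : ℝ) (a b c : ℝ × ℝ) : ℝ :=
  σ * ((b.1 - a.1) * (c.2 - a.2) - (b.2 - a.2) * (c.1 - a.1))

lemma cr_rot (σ : ℝ) (a b c : ℝ × ℝ) : cr σ b c a = cr σ a b c := by
  unfold cr; ring

lemma cr_swap (σ : ℝ) (a b c : ℝ × ℝ) : cr σ b a c = -cr σ a b c := by
  unfold cr; ring

lemma cr_swap' (σ : ℝ) (a b c : ℝ × ℝ) : cr σ a c b = -cr σ a b c := by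
  unfold cr; ring

lemma cr_neg (σ : ℝ) (a b c : ℝ × ℝ) : cr (-σ) a b c = cr σ b a c := by
  unfold cr; ring

@[simp] lemma cr_self_left (σ : ℝ) (a c : ℝ × ℝ) : cr σ a a c = 0 := by
  unfold cr; ring

@[simp] lemma cr_self_right (σ : ℝ) (a c : ℝ × ℝ) : cr σ a c c = 0 := by
  unfold cr; ring

@[simp] lemma cr_self_outer (σ : ℝ) (a c : ℝ × ℝ) : cr σ a c a = 0 := by
  unfold cr; ring

lemma cr_add_add (σ : ℝ) (a b c z : ℝ × ℝ) :
    cr σ a b z + cr σ b c z + cr σ c a z = cr σ a b c := by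
  unfold cr; ring

lemma cr_comb (σ : ℝ) (a b x y : ℝ × ℝ) (s t : ℝ) (h : s + t = 1) :
    cr σ a b (s • x + t • y) = s * cr σ a b x + t * cr σ a b y := by
  obtain rfl : s = 1 - t := by linarith
  simp only [cr, Prod.fst_add, Prod.snd_add, Prod.smul_fst, Prod.smul_snd, smul_eq_mul]
  ring

lemma cr_lineMap (σ : ℝ) (a b x y : ℝ × ℝ) (t : ℝ) :
    cr σ a b (x + t • (y - x)) = (1 - t) * cr σ a b x + t * cr σ a b y := by
  simp only [cr, Prod.fst_add, Prod.snd_add, Prod.smul_fst, Prod.smul_snd, smul_eq_mul,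
    Prod.fst_sub, Prod.snd_sub]
  ring

lemma continuous_cr (σ : ℝ) (a b : ℝ × ℝ) : Continuous (cr σ a b) := by
  unfold cr; fun_prop

lemma isOpen_cr_pos (σ : ℝ) (a b : ℝ × ℝ) : IsOpen {z | 0 < cr σ a b z} :=
  isOpen_lt continuous_const (continuous_cr σ a b)

lemma isClosed_cr_nonneg (σ : ℝ) (a b : ℝ × ℝ) : IsClosed {z | 0 ≤ cr σ a b z} :=
  isClosed_le continuous_const (continuous_cr σ a b)

lemma convex_cr_pos (σ : ℝ) (a b : ℝ × ℝ) : Convex ℝ {z | 0 < cr σ a b z} := by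
  intro x hx y hy s t hs ht h
  simp only [Set.mem_ofPred_eq] at *
  rw [cr_comb _ _ _ _ _ _ _ h]
  rcases hs.eq_or_lt with rfl | hs'
  · have : t = 1 := by linarith
    subst this; simpa using hy
  · nlinarith [mul_pos hs' hx, mul_nonneg ht hy.le]

lemma convex_cr_nonneg (σ : ℝ) (a b : ℝ × ℝ) : Convex ℝ {z | 0 ≤ cr σ a b z} := by
  intro x hx y hy s t hs ht h
  simp only [Set.mem_ofPred_eq] at *
  rw [cr_comb _ _ _ _ _ _ _ h]
  positivity

lemma cr_eq_zero_of_mem_segment {σ : ℝ} {a b z : ℝ × ℝ} (h : z ∈ segment ℝ a b) :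
    cr σ a b z = 0 := by
  obtain ⟨s, t, hs, ht, h1, rfl⟩ := h
  rw [cr_comb _ _ _ _ _ _ _ h1]; simp

/-- Three times barycentric coordinates. -/
lemma cr_barycentric (σ : ℝ) (a b c z : ℝ × ℝ) :
    cr σ a b c • z = cr σ b c z • a + cr σ c a z • b + cr σ a b z • c := by
  ext <;> simp only [cr, Prod.fst_add, Prod.snd_add, Prod.smul_fst, Prod.smul_snd,
    smul_eq_mul] <;> ring

lemma mem_segment_of_cr {σ : ℝ} {a b c z : ℝ × ℝ} (h : 0 < cr σ a b c) (h0 : cr σ a b z = 0)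
    (h1 : 0 ≤ cr σ b c z) (h2 : 0 ≤ cr σ c a z) : z ∈ segment ℝ a b := by
  have hs := cr_add_add σ a b c z
  have hb := cr_barycentric σ a b c z
  refine ⟨cr σ b c z / cr σ a b c, cr σ c a z / cr σ a b c, by positivity, by positivity,
    by field_simp; linarith, ?_⟩
  rw [h0, zero_smul, add_zero] at hb
  have : z = (cr σ a b c)⁻¹ • (cr σ a b c • z) := by
    rw [smul_smul, inv_mul_cancel₀ h.ne', one_smul]
  conv_rhs => rw [this, hb]
  simp only [smul_add, smul_smul, div_eq_inv_mul]

lemma mem_convexHull_of_cr {σ : ℝ} {a b c z : ℝ × ℝ} (h : 0 < cr σ a b c)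
    (h0 : 0 ≤ cr σ a b z) (h1 : 0 ≤ cr σ b c z) (h2 : 0 ≤ cr σ c a z) :
    z ∈ convexHull ℝ ({a, b, c} : Set (ℝ × ℝ)) := by
  have hs := cr_add_add σ a b c z
  have hb := cr_barycentric σ a b c z
  have : z = (cr σ b c z / cr σ a b c) • a + (cr σ c a z / cr σ a b c) • b +
      (cr σ a b z / cr σ a b c) • c := by
    have : z = (cr σ a b c)⁻¹ • (cr σ a b c • z) := by
      rw [smul_smul, inv_mul_cancel₀ h.ne', one_smul]
    conv_lhs => rw [this, hb]
    simp only [smul_add, smul_smul, div_eq_inv_mul]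
  have hc := convex_convexHull ℝ ({a, b, c} : Set (ℝ × ℝ))
  have ha : a ∈ convexHull ℝ ({a, b, c} : Set (ℝ × ℝ)) := subset_convexHull _ _ (by simp)
  have hb' : b ∈ convexHull ℝ ({a, b, c} : Set (ℝ × ℝ)) := subset_convexHull _ _ (by simp)
  have hc' : c ∈ convexHull ℝ ({a, b, c} : Set (ℝ × ℝ)) := subset_convexHull _ _ (by simp)
  rw [this]
  exact hc.sum_mem (t := Finset.univ) (w := ![cr σ b c z / cr σ a b c, cr σ c a z / cr σ a b c,
    cr σ a b z / cr σ a b c]) (z := ![a, b, c])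
    (by intro i _; fin_cases i <;> simp <;> positivity)
    (by simp [Fin.sum_univ_three]; field_simp; linarith)
    (by intro i _; fin_cases i <;> simp [ha, hb', hc']) |> (by simpa [Fin.sum_univ_three] using ·)

/-- The open triangle, described by strict inequalities. -/
def tri (σ : ℝ) (a b c : ℝ × ℝ) : Set (ℝ × ℝ) :=
  {z | 0 < cr σ a b z ∧ 0 < cr σ b c z ∧ 0 < cr σ c a z}

lemma isOpen_tri (σ : ℝ) (a b c : ℝ × ℝ) : IsOpen (tri σ a b c) :=
  (isOpen_cr_pos σ a b).inter ((isOpen_cr_pos σ b c).inter (isOpen_cr_pos σ c a))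

lemma convex_tri (σ : ℝ) (a b c : ℝ × ℝ) : Convex ℝ (tri σ a b c) :=
  (convex_cr_pos σ a b).inter ((convex_cr_pos σ b c).inter (convex_cr_pos σ c a))

lemma tri_rot (σ : ℝ) (a b c : ℝ × ℝ) : tri σ b c a = tri σ a b c := by
  ext z; simp only [tri, Set.mem_ofPred_eq]; tauto

lemma convexHull_eq_cr {σ : ℝ} {a b c : ℝ × ℝ} (h : 0 < cr σ a b c) :
    convexHull ℝ ({a, b, c} : Set (ℝ × ℝ)) =
      {z | 0 ≤ cr σ a b z ∧ 0 ≤ cr σ b c z ∧ 0 ≤ cr σ c a z} := by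
  apply Set.Subset.antisymm
  · have hcv : Convex ℝ {z | 0 ≤ cr σ a b z ∧ 0 ≤ cr σ b c z ∧ 0 ≤ cr σ c a z} :=
      (convex_cr_nonneg σ a b).inter ((convex_cr_nonneg σ b c).inter (convex_cr_nonneg σ c a))
    refine convexHull_min ?_ hcv
    have h1 : 0 < cr σ b c a := by rwa [cr_rot]
    have h2 : 0 < cr σ c a b := by rwa [cr_rot]
    rintro z (rfl | rfl | rfl) <;> simp [h.le, h1.le, h2.le]
  · rintro z ⟨h0, h1, h2⟩
    exact mem_convexHull_of_cr h h0 h1 h2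

/-- A small step from `x` in the direction of any vector stays in a neighbourhood. -/
lemma exists_step {s : Set (ℝ × ℝ)} {x : ℝ × ℝ} (hs : s ∈ nhds x) (v : ℝ × ℝ) :
    ∃ ε : ℝ, 0 < ε ∧ ε < 1 ∧ x + ε • v ∈ s := by
  have hc : Filter.Tendsto (fun ε : ℝ => x + ε • v) (nhds 0) (nhds x) := by
    have : Continuous (fun ε : ℝ => x + ε • v) := by fun_prop
    simpa using this.tendsto 0
  have := (hc.eventually hs)
  obtain ⟨δ, hδ, h⟩ := Metric.eventually_nhds_iff.mp this
  have hm : 0 < min (δ / 2) (1 / 2) := by positivity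
  refine ⟨min (δ / 2) (1 / 2), hm, by linarith [min_le_right (δ / 2) (1 / 2)], h ?_⟩
  rw [Real.dist_0_eq_abs, abs_of_pos hm]
  linarith [min_le_left (δ / 2) (1 / 2)]

lemma cr_step (σ : ℝ) (a b x : ℝ × ℝ) (ε : ℝ) :
    cr σ a b (x + ε • (-(b.2 - a.2), b.1 - a.1)) =
      cr σ a b x + ε * (σ * ((b.1 - a.1) ^ 2 + (b.2 - a.2) ^ 2)) := by
  simp only [cr, Prod.fst_add, Prod.snd_add, Prod.smul_fst, Prod.smul_snd, smul_eq_mul]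
  ring

lemma sq_dist_pos {a b : ℝ × ℝ} (hab : a ≠ b) : 0 < (b.1 - a.1) ^ 2 + (b.2 - a.2) ^ 2 := by
  by_contra hcon
  apply hab
  have h1 : (b.1 - a.1) ^ 2 = 0 := by nlinarith [sq_nonneg (b.1 - a.1), sq_nonneg (b.2 - a.2)]
  have h2 : (b.2 - a.2) ^ 2 = 0 := by nlinarith [sq_nonneg (b.1 - a.1), sq_nonneg (b.2 - a.2)]
  have h1' := pow_eq_zero_iff (two_ne_zero) |>.mp h1
  have h2' := pow_eq_zero_iff (two_ne_zero) |>.mp h2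
  ext <;> linarith

lemma cr_pos_of_mem_interior {σ : ℝ} (hσ : σ ≠ 0) {a b z : ℝ × ℝ} (hab : a ≠ b)
    {s : Set (ℝ × ℝ)} (hs : ∀ x ∈ s, 0 ≤ cr σ a b x) (hz : z ∈ interior s) :
    0 < cr σ a b z := by
  obtain ⟨ε, hε, -, hm⟩ := exists_step (mem_interior_iff_mem_nhds.mp hz)
    ((-σ) • (-(b.2 - a.2), b.1 - a.1))
  have h1 := hs _ hm
  rw [smul_smul, cr_step] at h1
  have := sq_dist_pos hab
  have h2 : 0 < ε * (σ ^ 2 * ((b.1 - a.1) ^ 2 + (b.2 - a.2) ^ 2)) := by positivity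
  nlinarith

lemma cr_ne {σ : ℝ} {a b c : ℝ × ℝ} (h : 0 < cr σ a b c) : a ≠ b ∧ b ≠ c ∧ c ≠ a := by
  refine ⟨?_, ?_, ?_⟩ <;> rintro rfl <;> simp at h

lemma openTriangle_eq_tri {σ : ℝ} (hσ : σ ≠ 0) {a b c : ℝ × ℝ} (h : 0 < cr σ a b c) :
    openTriangle a b c = tri σ a b c := by
  unfold openTriangle
  have hh := convexHull_eq_cr h
  obtain ⟨h1, h2, h3⟩ := cr_ne h
  apply Set.Subset.antisymm
  · intro z hz
    rw [hh] at hz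
    exact ⟨cr_pos_of_mem_interior hσ h1 (fun x hx => hx.1) hz,
      cr_pos_of_mem_interior hσ h2 (fun x hx => hx.2.1) hz,
      cr_pos_of_mem_interior hσ h3 (fun x hx => hx.2.2) hz⟩
  · apply interior_maximal _ (isOpen_tri σ a b c)
    rw [hh]
    rintro z ⟨h0, h1, h2⟩
    exact ⟨h0.le, h1.le, h2.le⟩

lemma cr_ne_zero_of_openTriangle_nonempty {σ : ℝ} (hσ : σ ≠ 0) {a b c : ℝ × ℝ} (hab : a ≠ b)
    (h : (openTriangle a b c).Nonempty) : cr σ a b c ≠ 0 := by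
  intro h0
  obtain ⟨z, hz⟩ := h
  have key : convexHull ℝ ({a, b, c} : Set (ℝ × ℝ)) ⊆
      {z | 0 ≤ cr σ a b z ∧ 0 ≤ cr σ b a z} := by
    have hcv : Convex ℝ {z | 0 ≤ cr σ a b z ∧ 0 ≤ cr σ b a z} :=
      (convex_cr_nonneg σ a b).inter (convex_cr_nonneg σ b a)
    refine convexHull_min ?_ hcv
    rintro z (rfl | rfl | rfl)
    · simp
    · simp
    · simp only [Set.mem_ofPred_eq]
      rw [cr_swap σ a b, h0]; simp
  have h1 := cr_pos_of_mem_interior hσ hab (fun x hx => (key hx).1) hz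
  have h2 := cr_pos_of_mem_interior hσ hab.symm (fun x hx => (key hx).2) hz
  rw [cr_swap] at h2
  linarith

lemma openTriangle_swap (a b c : ℝ × ℝ) : openTriangle b a c = openTriangle a b c := by
  unfold openTriangle; rw [Set.insert_comm]

lemma openTriangle_bounded (a b c : ℝ × ℝ) : Bornology.IsBounded (openTriangle a b c) := by
  unfold openTriangle
  refine Bornology.IsBounded.subset ?_ interior_subset
  rw [isBounded_convexHull]
  exact (Set.toFinite _).isBounded

lemma segment_subset_drawing {G : PlaneGraph} {a b : ℝ × ℝ} (h : G.Adj a b) :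
    segment ℝ a b ⊆ G.drawing := fun _ hx => ⟨a, b, h, hx⟩

lemma Adj_ne {G : PlaneGraph} {a b : ℝ × ℝ} (h : G.Adj a b) : a ≠ b := by
  rintro rfl; exact G.loopless _ h

lemma isClosed_drawing (G : PlaneGraph) : IsClosed G.drawing := by
  have : G.drawing = ⋃ e ∈ ((G.verts ×ˢ G.verts).filter fun e => G.Adj e.1 e.2),
      segment ℝ e.1 e.2 := by
    ext x
    simp only [drawing, Set.mem_ofPred_eq, Set.mem_iUnion, Finset.mem_filter, Finset.mem_product]
    constructor
    · rintro ⟨p, q, h, hx⟩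
      exact ⟨(p, q), ⟨G.mem_of_adj _ _ h, h⟩, hx⟩
    · rintro ⟨e, ⟨-, h⟩, hx⟩
      exact ⟨e.1, e.2, h, hx⟩
  rw [this]
  refine Set.Finite.isClosed_biUnion (Finset.finite_toSet _) fun e _ => ?_
  rw [← convexHull_pair]
  exact (Set.toFinite {e.1, e.2}).isClosed_convexHull ℝ

lemma isOpen_compl_drawing (G : PlaneGraph) : IsOpen G.drawingᶜ := (isClosed_drawing G).isOpen_compl

lemma isOpen_outerRegion (G : PlaneGraph) : IsOpen G.outerRegion := by
  rw [isOpen_iff_mem_nhds]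
  rintro x ⟨hx, hb⟩
  have ho : IsOpen (connectedComponentIn G.drawingᶜ x) :=
    (isOpen_compl_drawing G).connectedComponentIn
  refine Filter.mem_of_superset (ho.mem_nhds (mem_connectedComponentIn hx)) fun y hy => ?_
  refine ⟨connectedComponentIn_subset _ _ hy, ?_⟩
  rwa [← connectedComponentIn_eq hy]

lemma ne_of_mem_openSegment {a b m : ℝ × ℝ} (hab : a ≠ b) (hm : m ∈ openSegment ℝ a b) :
    m ≠ a ∧ m ≠ b := by
  constructor
  · rintro rfl; exact hab (left_mem_openSegment_iff.mp hm)
  · rintro rfl; exact hab (right_mem_openSegment_iff.mp hm)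

/-- The points near `m` on the positive side of the line `a b`. -/
def halfBall (σ : ℝ) (a b m : ℝ × ℝ) (δ : ℝ) : Set (ℝ × ℝ) :=
  {z | z ∈ Metric.ball m δ ∧ 0 < cr σ a b z}

lemma convex_halfBall (σ : ℝ) (a b m : ℝ × ℝ) (δ : ℝ) : Convex ℝ (halfBall σ a b m δ) :=
  (convex_ball m δ).inter (convex_cr_pos σ a b)

lemma mem_closure_halfBall {σ : ℝ} (hσ : σ ≠ 0) {a b m : ℝ × ℝ} (hab : a ≠ b)
    (hm : cr σ a b m = 0) {δ : ℝ} (hδ : 0 < δ) : m ∈ closure (halfBall σ a b m δ) := by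
  rw [mem_closure_iff_nhds]
  intro t ht
  obtain ⟨ε, hε, -, h⟩ := exists_step (Filter.inter_mem ht (Metric.ball_mem_nhds m hδ))
    (σ • (-(b.2 - a.2), b.1 - a.1))
  refine ⟨_, h.1, h.2, ?_⟩
  rw [smul_smul, cr_step, hm]
  have := sq_dist_pos hab
  have : 0 < ε * (σ ^ 2 * ((b.1 - a.1) ^ 2 + (b.2 - a.2) ^ 2)) := by positivity
  linarith

lemma pair_eq_cases {p q a b : ℝ × ℝ} (h : ({p, q} : Set (ℝ × ℝ)) = {a, b}) :
    (p = a ∧ q = b) ∨ (p = b ∧ q = a) := by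
  exact Set.pair_eq_pair_iff.mp h

/-- Near an inner point of an edge, the drawing consists only of that edge. -/
lemma exists_ball_drawing_subset {G : PlaneGraph} (hG : G.IsEmbedded) {a b m : ℝ × ℝ}
    (h : G.Adj a b) (hm : m ∈ openSegment ℝ a b) :
    ∃ δ > 0, ∀ z ∈ Metric.ball m δ, z ∈ G.drawing → z ∈ segment ℝ a b := by
  obtain ⟨h1, h2⟩ := ne_of_mem_openSegment (Adj_ne h) hm
  have hmem : m ∉ (G.deleteEdge a b).drawing := by
    rintro ⟨p, q, ⟨hpq, hne⟩, hx⟩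
    rcases hG.1 p q a b hpq h m hx (openSegment_subset_segment _ _ _ hm) with h' | ⟨-, h'⟩
    · rcases pair_eq_cases h' with h' | h' <;> tauto
    · rcases h' with h' | h'
      · exact h1 h'
      · exact h2 h'
  obtain ⟨δ, hδ, hs⟩ := Metric.isOpen_iff.mp (isOpen_compl_drawing (G.deleteEdge a b)) m hmem
  refine ⟨δ, hδ, fun z hz hd => ?_⟩
  obtain ⟨p, q, hpq, hx⟩ := hd
  by_cases hne : (p = a ∧ q = b) ∨ (p = b ∧ q = a)
  · rcases hne with ⟨rfl, rfl⟩ | ⟨rfl, rfl⟩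
    · exact hx
    · rwa [segment_symm]
  · exact absurd ⟨p, q, ⟨hpq, hne⟩, hx⟩ (hs hz)

/-- The triangle `a b c` is positively oriented and is an inner face of the drawing. -/
def Face (G : PlaneGraph) (σ : ℝ) (a b c : ℝ × ℝ) : Prop :=
  G.Adj a b ∧ G.Adj b c ∧ G.Adj c a ∧ 0 < cr σ a b c ∧ ∀ z ∈ tri σ a b c, z ∉ G.drawing

lemma Face.rot {G : PlaneGraph} {σ : ℝ} {a b c : ℝ × ℝ} (h : Face G σ a b c) :
    Face G σ b c a := by
  obtain ⟨h1, h2, h3, h4, h5⟩ := h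
  refine ⟨h2, h3, h1, by rwa [cr_rot], ?_⟩
  rwa [tri_rot]

lemma face_neg {G : PlaneGraph} {σ : ℝ} {a b c : ℝ × ℝ} :
    Face G (-σ) a b c ↔ Face G σ b a c := by
  have key : tri (-σ) a b c = tri σ b a c := by
    ext z; simp only [tri, Set.mem_ofPred_eq, cr_neg]; tauto
  unfold Face
  rw [key, cr_neg]
  constructor <;> rintro ⟨h1, h2, h3, h4, h5⟩ <;>
    exact ⟨G.symm _ _ h1, G.symm _ _ h3, G.symm _ _ h2, h4, h5⟩

lemma mem_sides_of_not_mem_tri {σ : ℝ} {a b c z : ℝ × ℝ} (hc : 0 < cr σ a b c)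
    (h : 0 ≤ cr σ a b z ∧ 0 ≤ cr σ b c z ∧ 0 ≤ cr σ c a z) (hz : z ∉ tri σ a b c) :
    (cr σ a b z = 0 ∧ z ∈ segment ℝ a b) ∨ (cr σ b c z = 0 ∧ z ∈ segment ℝ b c) ∨
      (cr σ c a z = 0 ∧ z ∈ segment ℝ c a) := by
  by_contra hcon
  apply hz
  refine ⟨lt_of_le_of_ne h.1 ?_, lt_of_le_of_ne h.2.1 ?_, lt_of_le_of_ne h.2.2 ?_⟩
  · intro h0
    exact hcon (Or.inl ⟨h0.symm, mem_segment_of_cr hc h0.symm h.2.1 h.2.2⟩)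
  · intro h0
    exact hcon (Or.inr (Or.inl ⟨h0.symm, mem_segment_of_cr (by rwa [cr_rot]) h0.symm h.2.2 h.1⟩))
  · intro h0
    exact hcon (Or.inr (Or.inr ⟨h0.symm,
      mem_segment_of_cr (by rwa [cr_rot, cr_rot]) h0.symm h.1 h.2.1⟩))

lemma isClosed_closedTri (σ : ℝ) (a b c : ℝ × ℝ) :
    IsClosed {z | 0 ≤ cr σ a b z ∧ 0 ≤ cr σ b c z ∧ 0 ≤ cr σ c a z} :=
  (isClosed_cr_nonneg σ a b).inter ((isClosed_cr_nonneg σ b c).inter (isClosed_cr_nonneg σ c a))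

lemma tri_subset_closedTri (σ : ℝ) (a b c : ℝ × ℝ) :
    tri σ a b c ⊆ {z | 0 ≤ cr σ a b z ∧ 0 ≤ cr σ b c z ∧ 0 ≤ cr σ c a z} :=
  fun _ h => ⟨h.1.le, h.2.1.le, h.2.2.le⟩

lemma Face.component_eq {G : PlaneGraph} {σ : ℝ} {a b c z : ℝ × ℝ} (h : Face G σ a b c)
    (hz : z ∈ tri σ a b c) : connectedComponentIn G.drawingᶜ z = tri σ a b c := by
  obtain ⟨h1, h2, h3, h4, h5⟩ := h
  apply Set.Subset.antisymm
  · refine IsPreconnected.subset_left_of_subset_union (isOpen_tri σ a b c)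
      (isClosed_closedTri σ a b c).isOpen_compl ?_ ?_ ⟨z, mem_connectedComponentIn (h5 z hz), hz⟩
      isPreconnected_connectedComponentIn
    · rw [Set.disjoint_compl_right_iff_subset]
      exact tri_subset_closedTri σ a b c
    · intro y hy
      by_contra hcon
      rw [Set.mem_union, not_or] at hcon
      have hy' := connectedComponentIn_subset _ _ hy
      rcases mem_sides_of_not_mem_tri h4 (not_not.mp hcon.2) hcon.1 with h | h | h
      · exact hy' (segment_subset_drawing h1 h.2)
      · exact hy' (segment_subset_drawing h2 h.2)
      · exact hy' (segment_subset_drawing h3 h.2)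
  · exact (convex_tri σ a b c).isPreconnected.subset_connectedComponentIn hz h5

lemma tri_bounded {σ : ℝ} (hσ : σ ≠ 0) {a b c : ℝ × ℝ} (h : 0 < cr σ a b c) :
    Bornology.IsBounded (tri σ a b c) := by
  rw [← openTriangle_eq_tri hσ h]; exact openTriangle_bounded a b c

lemma Face.not_mem_outerRegion {G : PlaneGraph} {σ : ℝ} (hσ : σ ≠ 0) {a b c z : ℝ × ℝ}
    (h : Face G σ a b c) (hz : z ∈ tri σ a b c) : z ∉ G.outerRegion := by
  rintro ⟨-, hb⟩
  rw [h.component_eq hz] at hb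
  exact hb (tri_bounded hσ h.2.2.2.1)

lemma exists_corners {G : PlaneGraph} (hI : G.InnerFacesTriangles) {σ : ℝ} (hσ : σ ≠ 0)
    {z : ℝ × ℝ} (hz : z ∉ G.drawing)
    (hb : Bornology.IsBounded (connectedComponentIn G.drawingᶜ z)) :
    ∃ a b c, Face G σ a b c ∧ connectedComponentIn G.drawingᶜ z = tri σ a b c := by
  obtain ⟨a, -, b, -, c, -, h1, h2, h3, hF⟩ := hI _ ⟨z, hz, rfl⟩ hb
  have hzm : z ∈ openTriangle a b c := by rw [← hF]; exact mem_connectedComponentIn hz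
  have hne := cr_ne_zero_of_openTriangle_nonempty hσ (Adj_ne h1) ⟨z, hzm⟩
  have hsub := connectedComponentIn_subset G.drawingᶜ z
  rcases hne.lt_or_gt with hlt | hgt
  · have hpos : 0 < cr σ b a c := by rw [cr_swap]; linarith
    rw [← openTriangle_swap, openTriangle_eq_tri hσ hpos] at hF
    exact ⟨b, a, c, ⟨G.symm _ _ h1, h3, G.symm _ _ h2, hpos, fun x hx => hsub (hF ▸ hx)⟩, hF⟩
  · rw [openTriangle_eq_tri hσ hgt] at hF
    exact ⟨a, b, c, ⟨h1, h2, G.symm _ _ h3, hgt, fun x hx => hsub (hF ▸ hx)⟩, hF⟩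

/-- On a given side of an edge there is either a triangular face or the outer region. -/
lemma face_or_halfBall_outer {G : PlaneGraph} (hG : G.IsEmbedded) (hI : G.InnerFacesTriangles)
    {σ : ℝ} (hσ : σ ≠ 0) {a b m : ℝ × ℝ} (h : G.Adj a b) (hm : m ∈ openSegment ℝ a b) :
    (∃ c, Face G σ a b c) ∨ ∃ δ > 0, halfBall σ a b m δ ⊆ G.outerRegion := by
  obtain ⟨δ, hδ, hs⟩ := exists_ball_drawing_subset hG h hm
  have hab := Adj_ne h
  have hms := openSegment_subset_segment _ _ _ hm
  have hoff : halfBall σ a b m δ ⊆ G.drawingᶜ := fun z hz hd => by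
    have := cr_eq_zero_of_mem_segment (σ := σ) (hs z hz.1 hd)
    linarith [hz.2]
  have hcl := mem_closure_halfBall hσ hab (cr_eq_zero_of_mem_segment (σ := σ) hms) hδ
  obtain ⟨z0, hz0⟩ : (halfBall σ a b m δ).Nonempty := closure_nonempty_iff.mp ⟨m, hcl⟩
  have hsub := (convex_halfBall σ a b m δ).isPreconnected.subset_connectedComponentIn hz0 hoff
  by_cases hb : Bornology.IsBounded (connectedComponentIn G.drawingᶜ z0)
  · left
    obtain ⟨a', b', c', hF, hC⟩ := exists_corners hI hσ (hoff hz0) hb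
    have hmcl := closure_minimal (tri_subset_closedTri σ a' b' c') (isClosed_closedTri σ a' b' c')
      (closure_mono (hC ▸ hsub) hcl)
    have hmt : m ∉ tri σ a' b' c' := fun hmt => hF.2.2.2.2 m hmt (segment_subset_drawing h hms)
    have hz0t : z0 ∈ tri σ a' b' c' := hC ▸ hsub hz0
    have key : ∀ p q r, Face G σ p q r → z0 ∈ tri σ p q r → m ∈ segment ℝ p q →
        ∃ c, Face G σ a b c := by
      intro p q r hpqr hz hmpq
      rcases hG.1 p q a b hpqr.1 h m hmpq hms with h' | ⟨-, h'⟩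
      · rcases pair_eq_cases h' with ⟨rfl, rfl⟩ | ⟨rfl, rfl⟩
        · exact ⟨r, hpqr⟩
        · have h1 := hz.1
          have h2 := hz0.2
          rw [cr_swap] at h2
          linarith
      · obtain ⟨h1, h2⟩ := ne_of_mem_openSegment hab hm
        rcases h' with h' | h'
        · exact absurd h' h1
        · exact absurd h' h2
    rcases mem_sides_of_not_mem_tri hF.2.2.2.1 hmcl hmt with h' | h' | h'
    · exact key _ _ _ hF hz0t h'.2
    · exact key _ _ _ hF.rot (by rwa [tri_rot]) h'.2
    · exact key _ _ _ hF.rot.rot (by rwa [tri_rot, tri_rot]) h'.2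
  · right
    refine ⟨δ, hδ, fun z hz => ⟨hoff hz, ?_⟩⟩
    rwa [← connectedComponentIn_eq (hsub hz)]

lemma cr_pos_of_mem_openSegment {σ : ℝ} {a b c m : ℝ × ℝ} (hc : 0 < cr σ a b c)
    (hm : m ∈ openSegment ℝ a b) : 0 < cr σ b c m ∧ 0 < cr σ c a m := by
  obtain ⟨s, t, hs, ht, h1, rfl⟩ := hm
  have e1 : cr σ b c a = cr σ a b c := cr_rot _ _ _ _
  have e2 : cr σ c a b = cr σ a b c := by rw [cr_rot, cr_rot]
  constructor
  · rw [cr_comb _ _ _ _ _ _ _ h1, e1]; simp; positivity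
  · rw [cr_comb _ _ _ _ _ _ _ h1, e2]; simp; positivity

lemma halfBall_subset_tri {σ : ℝ} {a b c m : ℝ × ℝ} (hc : 0 < cr σ a b c)
    (hm : m ∈ openSegment ℝ a b) : ∃ δ > 0, halfBall σ a b m δ ⊆ tri σ a b c := by
  obtain ⟨δ, hδ, hs⟩ := Metric.isOpen_iff.mp
    ((isOpen_cr_pos σ b c).inter (isOpen_cr_pos σ c a)) m (cr_pos_of_mem_openSegment hc hm)
  exact ⟨δ, hδ, fun z hz => ⟨hz.2, hs hz.1⟩⟩

lemma segment_subset_closure_outerRegion {G : PlaneGraph} (hG : G.IsEmbedded)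
    (hI : G.InnerFacesTriangles) {σ : ℝ} (hσ : σ ≠ 0) {a b : ℝ × ℝ} (h : G.Adj a b)
    (ho : ¬ ∃ c, Face G σ a b c) : segment ℝ a b ⊆ closure G.outerRegion := by
  rw [← closure_openSegment]
  refine closure_minimal (fun m hm => ?_) isClosed_closure
  rcases face_or_halfBall_outer hG hI hσ h hm with h' | ⟨δ, hδ, hs⟩
  · exact absurd h' ho
  · exact closure_mono hs (mem_closure_halfBall hσ (Adj_ne h) (cr_eq_zero_of_mem_segment
      (openSegment_subset_segment _ _ _ hm)) hδ)

lemma not_mem_closure_outerRegion {G : PlaneGraph} {σ : ℝ} (hσ : σ ≠ 0)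
    {a b c d m : ℝ × ℝ} (h1 : Face G σ a b c) (h2 : Face G σ b a d)
    (hm : m ∈ openSegment ℝ a b) (hG : G.IsEmbedded) : m ∉ closure G.outerRegion := by
  obtain ⟨δ, hδ, hs⟩ := exists_ball_drawing_subset hG h1.1 hm
  obtain ⟨δ1, hδ1, hs1⟩ := halfBall_subset_tri h1.2.2.2.1 hm
  obtain ⟨δ2, hδ2, hs2⟩ := halfBall_subset_tri h2.2.2.2.1 (by rwa [openSegment_symm])
  obtain ⟨δ3, hδ3, hs3⟩ := Metric.isOpen_iff.mp
    ((isOpen_cr_pos σ b c).inter (isOpen_cr_pos σ c a)) m (cr_pos_of_mem_openSegment h1.2.2.2.1 hm)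
  intro hcl
  rw [Metric.mem_closure_iff] at hcl
  obtain ⟨z, hz, hd⟩ := hcl (min (min δ1 δ2) δ3) (by positivity)
  rw [dist_comm] at hd
  rcases lt_trichotomy (cr σ a b z) 0 with hlt | heq | hgt
  · exact h2.not_mem_outerRegion hσ (hs2 ⟨lt_of_lt_of_le hd
      ((min_le_left _ _).trans (min_le_right _ _)), by rw [cr_swap]; linarith⟩) hz
  · have h3 := hs3 (lt_of_lt_of_le hd (min_le_right _ _))
    exact hz.1 (segment_subset_drawing h1.1
      (mem_segment_of_cr h1.2.2.2.1 heq (le_of_lt h3.1) (le_of_lt h3.2)))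
  · exact h1.not_mem_outerRegion hσ (hs1 ⟨lt_of_lt_of_le hd
      ((min_le_left _ _).trans (min_le_left _ _)), hgt⟩) hz

/-- An edge at a corner of a face does not enter the face. -/
lemma Face.no_adj_between {G : PlaneGraph} {σ : ℝ} {v a b c : ℝ × ℝ} (h : Face G σ v a b)
    (hc : G.Adj v c) (h1 : 0 < cr σ v a c) (h2 : 0 < cr σ v c b) : False := by
  have h0 : v ∈ {z | 0 < cr σ a b z} := by
    show 0 < cr σ a b v
    rw [cr_rot]; exact h.2.2.2.1
  obtain ⟨ε, hε, hε1, hm⟩ := exists_step ((isOpen_cr_pos σ a b).mem_nhds h0) (c - v)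
  have hm' : 0 < cr σ a b (v + ε • (c - v)) := hm
  refine h.2.2.2.2 (v + ε • (c - v)) ⟨?_, hm', ?_⟩ ⟨v, c, hc, 1 - ε, ε, by linarith, hε.le,
    by ring, by module⟩
  · rw [cr_lineMap]; simp; positivity
  · rw [cr_lineMap, cr_self_right, ← cr_rot σ b v c]; nlinarith [mul_pos hε h2]

lemma eq_of_collinear {G : PlaneGraph} (hG : G.IsEmbedded) {σ : ℝ} {v b b' w : ℝ × ℝ}
    (hb : G.Adj v b) (hb' : G.Adj v b') (h0 : cr σ v b b' = 0) (h1 : 0 < cr σ v w b)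
    (h2 : 0 < cr σ v w b') : b = b' := by
  wlog hle : cr σ v w b' ≤ cr σ v w b generalizing b b'
  · exact (this hb' hb (by rw [cr_swap', h0, neg_zero]) h2 h1 (le_of_not_ge hle)).symm
  have hs := cr_add_add σ v w b b'
  have e : cr σ b v b' = 0 := by rw [cr_swap, h0, neg_zero]
  have hseg : b' ∈ segment ℝ b v :=
    mem_segment_of_cr (c := w) (by rwa [← cr_rot]) e h2.le (by linarith [cr_rot σ v w b])
  rcases hG.2 b v b' (G.symm _ _ hb) (G.mem_of_adj _ _ hb').2 hseg with h | h
  · exact h.symm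
  · exact absurd h (Adj_ne hb').symm

lemma eq_of_collinear' {G : PlaneGraph} (hG : G.IsEmbedded) {σ : ℝ} {v b b' w : ℝ × ℝ}
    (hb : G.Adj v b) (hb' : G.Adj v b') (h0 : cr σ v b b' = 0) (h1 : 0 < cr σ v b w)
    (h2 : 0 < cr σ v b' w) : b = b' := by
  refine eq_of_collinear hG (σ := -σ) (w := w) hb hb' ?_ ?_ ?_
  · rw [cr_neg, cr_swap, h0, neg_zero]
  · rwa [cr_neg, ← cr_rot]
  · rwa [cr_neg, ← cr_rot]

lemma Face.unique {G : PlaneGraph} (hG : G.IsEmbedded) {σ : ℝ} {v a b b' : ℝ × ℝ}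
    (h : Face G σ v a b) (h' : Face G σ v a b') : b = b' := by
  rcases lt_trichotomy (cr σ v b b') 0 with hlt | heq | hgt
  · exact (h.no_adj_between (G.symm _ _ h'.2.2.1) h'.2.2.2.1 (by rw [cr_swap']; linarith)).elim
  · exact eq_of_collinear hG (G.symm _ _ h.2.2.1) (G.symm _ _ h'.2.2.1) heq h.2.2.2.1 h'.2.2.2.1
  · exact (h'.no_adj_between (G.symm _ _ h.2.2.1) h.2.2.2.1 hgt).elim

lemma Face.unique' {G : PlaneGraph} (hG : G.IsEmbedded) {σ : ℝ} {v a a' b : ℝ × ℝ}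
    (h : Face G σ v a b) (h' : Face G σ v a' b) : a = a' :=
  Face.unique hG h.rot.rot h'.rot.rot

lemma cr_plucker (σ : ℝ) (v a b c z : ℝ × ℝ) :
    cr σ v c z * cr σ v a b = cr σ v z b * cr σ v c a + cr σ v a z * cr σ v c b := by
  unfold cr; ring

lemma eq_of_cr_eq_zero {σ : ℝ} {v a b z : ℝ × ℝ} (h : 0 < cr σ v a b) (h1 : cr σ v a z = 0)
    (h2 : cr σ v z b = 0) : z = v := by
  have hb := cr_barycentric σ v a b z
  have hs := cr_add_add σ v a b z
  have e : cr σ b v z = 0 := by rw [← cr_rot, h2]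
  rw [h1, e, zero_smul, zero_smul, add_zero, add_zero] at hb
  have : cr σ a b z = cr σ v a b := by linarith
  rw [this] at hb
  exact smul_right_injective _ h.ne' hb

/-- The closed cone at `v` spanned by `a` and `b`. -/
def cone (σ : ℝ) (v a b : ℝ × ℝ) : Set (ℝ × ℝ) := {z | 0 ≤ cr σ v a z ∧ 0 ≤ cr σ b v z}

lemma isClosed_cone (σ : ℝ) (v a b : ℝ × ℝ) : IsClosed (cone σ v a b) :=
  (isClosed_cr_nonneg σ v a).inter (isClosed_cr_nonneg σ b v)

lemma cone_union_mem_nhds {σ : ℝ} {v a b c z : ℝ × ℝ} (hab : 0 < cr σ v a b)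
    (hca : 0 < cr σ v c a) (h0 : cr σ v a z = 0) (h1 : 0 < cr σ b v z) :
    cone σ v a b ∪ cone σ v c a ∈ nhds z := by
  have hz : 0 < cr σ v c z := by
    have := cr_plucker σ v a b c z
    rw [h0, zero_mul, add_zero] at this
    have e : cr σ v z b = cr σ b v z := cr_rot _ _ _ _
    rw [e] at this
    exact pos_of_mul_pos_left (by rw [this]; positivity) hab.le
  refine Filter.mem_of_superset (((isOpen_cr_pos σ b v).inter (isOpen_cr_pos σ v c)).mem_nhds
    ⟨h1, hz⟩) ?_
  rintro y ⟨hy1, hy2⟩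
  rcases le_total 0 (cr σ v a y) with h | h
  · exact Or.inl ⟨h, le_of_lt hy1⟩
  · exact Or.inr ⟨le_of_lt hy2, by rw [cr_swap]; linarith⟩

/-- If the faces around `v` close up on a set `K` of neighbours, then `K` contains all
neighbours of `v`. -/
lemma mem_of_closed_link {G : PlaneGraph} (hG : G.IsEmbedded) {σ : ℝ} {v : ℝ × ℝ}
    {K : Set (ℝ × ℝ)} (hK : K.Nonempty) (h1 : ∀ a ∈ K, ∃ b ∈ K, Face G σ v a b)
    (h2 : ∀ a ∈ K, ∃ b ∈ K, Face G σ v b a) {c : ℝ × ℝ} (hc : G.Adj v c) : c ∈ K := by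
  set I := ((G.verts ×ˢ G.verts).filter fun e => e.1 ∈ K ∧ e.2 ∈ K ∧ Face G σ v e.1 e.2) with hI
  have hmem : ∀ a ∈ K, ∀ b ∈ K, Face G σ v a b → (a, b) ∈ I := by
    intro a ha b hb h
    rw [hI, Finset.mem_filter, Finset.mem_product]
    exact ⟨⟨(G.mem_of_adj _ _ h.1).2, (G.mem_of_adj _ _ h.2.2.1).1⟩, ha, hb, h⟩
  set V : Set (ℝ × ℝ) := ⋃ e ∈ I, cone σ v e.1 e.2 with hV
  have hVc : IsClosed V := Set.Finite.isClosed_biUnion (Finset.finite_toSet _) fun e _ =>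
    isClosed_cone _ _ _ _
  have hsub : ∀ e ∈ I, cone σ v e.1 e.2 ⊆ V := fun e he =>
    Set.subset_biUnion_of_mem (u := fun e : (ℝ × ℝ) × (ℝ × ℝ) => cone σ v e.1 e.2) he
  have hopen : ∀ z ∈ V, z ≠ v → V ∈ nhds z := by
    intro z hz hzv
    obtain ⟨e, he, hze⟩ := Set.mem_iUnion₂.mp hz
    obtain ⟨-, ha, hb, hF⟩ := Finset.mem_filter.mp he
    obtain ⟨a, b⟩ := e
    simp only at ha hb hF hze
    have hpos := hF.2.2.2.1
    rcases hze.1.eq_or_lt with h0 | hlt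
    · have hz2 : 0 < cr σ b v z := lt_of_le_of_ne hze.2 fun h =>
        hzv (eq_of_cr_eq_zero hpos h0.symm (by rw [cr_rot σ b v z]; exact h.symm))
      obtain ⟨c, hc, hF'⟩ := h2 a ha
      refine Filter.mem_of_superset (cone_union_mem_nhds hpos hF'.2.2.2.1 h0.symm hz2) ?_
      exact Set.union_subset (hsub _ he) (hsub _ (hmem _ hc _ ha hF'))
    · rcases hze.2.eq_or_lt with h0 | hlt'
      · obtain ⟨c, hc, hF'⟩ := h1 b hb
        refine Filter.mem_of_superset ?_
          (Set.union_subset (hsub _ he) (hsub _ (hmem _ hb _ hc hF')))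
        have := cone_union_mem_nhds (σ := -σ) (v := v) (a := b) (b := a) (c := c) (z := z)
          (by rw [cr_neg, ← cr_rot]; exact hpos) (by rw [cr_neg, ← cr_rot]; exact hF'.2.2.2.1)
          (by rw [cr_neg]; exact h0.symm) (by rw [cr_neg]; exact hlt)
        refine Filter.mem_of_superset this ?_
        rintro y (⟨hy1, hy2⟩ | ⟨hy1, hy2⟩)
        · rw [cr_neg] at hy1 hy2; exact Or.inl ⟨hy2, hy1⟩
        · rw [cr_neg] at hy1 hy2; exact Or.inr ⟨hy2, hy1⟩
      · refine Filter.mem_of_superset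
          (((isOpen_cr_pos σ v a).inter (isOpen_cr_pos σ b v)).mem_nhds ⟨hlt, hlt'⟩) ?_
        exact fun y hy => hsub _ he ⟨le_of_lt hy.1, le_of_lt hy.2⟩
  have hall : ({v}ᶜ : Set (ℝ × ℝ)) ⊆ V \ {v} := by
    refine (isConnected_compl_singleton_of_one_lt_rank (by simp; norm_num) v
      ).isPreconnected.subset_of_closure_inter_subset ?_ ?_ ?_
    · rw [isOpen_iff_mem_nhds]
      rintro z ⟨hz, hzv⟩
      exact Filter.inter_mem (hopen z hz hzv) (isOpen_compl_singleton.mem_nhds hzv)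
    · obtain ⟨a, ha⟩ := hK
      obtain ⟨b, hb, hF⟩ := h1 a ha
      have hav : a ≠ v := (Adj_ne hF.1).symm
      refine ⟨a, hav, hsub _ (hmem _ ha _ hb hF) ⟨by simp, ?_⟩, hav⟩
      show 0 ≤ cr σ b v a
      rw [← cr_rot]
      exact hF.2.2.2.1.le
    · rintro z ⟨hz, hzv⟩
      exact ⟨closure_minimal Set.sdiff_subset hVc hz, hzv⟩
  have hcV := (hall (show c ∈ ({v}ᶜ : Set _) from (Adj_ne hc).symm)).1
  obtain ⟨e, he, hze⟩ := Set.mem_iUnion₂.mp hcV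
  obtain ⟨-, ha, hb, hF⟩ := Finset.mem_filter.mp he
  obtain ⟨a, b⟩ := e
  simp only at ha hb hF hze
  have hpos := hF.2.2.2.1
  have e2 : cr σ v c b = cr σ b v c := cr_rot _ _ _ _
  rcases hze.1.eq_or_lt with h0 | hlt
  · have hz2 : 0 < cr σ b v c := lt_of_le_of_ne hze.2 fun h =>
        (Adj_ne hc).symm (eq_of_cr_eq_zero hpos h0.symm (by rw [e2]; exact h.symm))
    have := eq_of_collinear' hG hF.1 hc h0.symm hpos (by rwa [e2])
    exact this ▸ ha
  · rcases hze.2.eq_or_lt with h0 | hlt'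
    · have := eq_of_collinear hG (G.symm _ _ hF.2.2.1) hc
        (by rw [cr_swap, ← h0, neg_zero]) hpos hlt
      exact this ▸ hb
    · exact (hF.no_adj_between hc hlt (by rwa [e2])).elim

/-! ### Deleting a vertex on the boundary of the outer region -/

lemma drawing_deleteVerts_subset (G : PlaneGraph) (S : Finset (ℝ × ℝ)) :
    (G.deleteVerts S).drawing ⊆ G.drawing := by
  rintro x ⟨p, q, h, hx⟩
  exact ⟨p, q, h.1, hx⟩

lemma IsEmbedded.deleteVerts {G : PlaneGraph} (hG : G.IsEmbedded) (S : Finset (ℝ × ℝ)) :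
    (G.deleteVerts S).IsEmbedded :=
  ⟨fun p q r s h1 h2 => hG.1 p q r s h1.1 h2.1,
    fun p q v h1 h2 => hG.2 p q v h1.1 (Finset.mem_sdiff.mp h2).1⟩

/-- Points of an edge at `v` survive in the complement after deleting `v`, except possibly
the other endpoint. -/
lemma eq_of_mem_drawing_deleteVerts {G : PlaneGraph} (hG : G.IsEmbedded) {v w y : ℝ × ℝ}
    (h : G.Adj v w) (hy : y ∈ segment ℝ v w) (hd : y ∈ (G.deleteVerts {v}).drawing) : y = w := by
  obtain ⟨p, q, ⟨hpq, hp, hq⟩, hx⟩ := hd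
  rw [Finset.mem_singleton] at hp hq
  rcases hG.1 v w p q h hpq y hy hx with h' | ⟨h1, h2⟩
  · rcases pair_eq_cases h' with ⟨rfl, rfl⟩ | ⟨rfl, rfl⟩ <;> tauto
  · rcases h1 with rfl | h1
    · rcases h2 with h2 | h2
      · exact absurd h2.symm hp
      · exact absurd h2.symm hq
    · exact h1

lemma eq_of_mem_segment_of_mem_segment {v w z : ℝ × ℝ} (h1 : w ∈ segment ℝ v z)
    (h2 : z ∈ segment ℝ v w) : z = w := by
  rw [segment_eq_image'] at h1 h2
  obtain ⟨s, ⟨hs0, hs1⟩, rfl⟩ := h1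
  obtain ⟨t, ⟨ht0, ht1⟩, ht⟩ := h2
  simp only [add_sub_cancel_left, smul_smul] at ht
  by_cases hz : z - v = 0
  · simp [sub_eq_zero.mp hz]
  · have h3 : (t * s) • (z - v) = (1 : ℝ) • (z - v) := by
      rw [one_smul, eq_sub_iff_add_eq, add_comm]; exact ht
    have h4 := smul_left_injective ℝ hz h3
    have : s = 1 := by nlinarith
    simp [this]

lemma mem_component_of_mem_edge {G : PlaneGraph} (hG : G.IsEmbedded) {v w z : ℝ × ℝ}
    (h : G.Adj v w) (hz : z ∈ segment ℝ v w) (hd : z ∉ (G.deleteVerts {v}).drawing) :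
    z ∈ connectedComponentIn (G.deleteVerts {v}).drawingᶜ v := by
  have hsub : segment ℝ v z ⊆ (G.deleteVerts {v}).drawingᶜ := by
    intro y hy hyd
    have hyw : y ∈ segment ℝ v w :=
      (convex_segment v w).segment_subset (left_mem_segment _ _ _) hz hy
    have := eq_of_mem_drawing_deleteVerts hG h hyw hyd
    subst this
    exact hd (eq_of_mem_segment_of_mem_segment hy hz ▸ hyd)
  exact (convex_segment v z).isPreconnected.subset_connectedComponentIn (left_mem_segment _ _ _)
    hsub (right_mem_segment _ _ _)

lemma mem_outerRegion_deleteVerts {G : PlaneGraph} (hG : G.IsEmbedded) {v w m : ℝ × ℝ}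
    (h : G.Adj v w) (hm : m ∈ openSegment ℝ v w) (hcl : m ∈ closure G.outerRegion) :
    v ∈ (G.deleteVerts {v}).outerRegion := by
  have hms := openSegment_subset_segment _ _ _ hm
  have hmd : m ∉ (G.deleteVerts {v}).drawing := fun hd =>
    (ne_of_mem_openSegment (Adj_ne h) hm).2 (eq_of_mem_drawing_deleteVerts hG h hms hd)
  have hmv := mem_component_of_mem_edge hG h hms hmd
  have hvd : v ∉ (G.deleteVerts {v}).drawing := fun hd =>
    Adj_ne h (eq_of_mem_drawing_deleteVerts hG h (left_mem_segment _ _ _) hd)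
  refine ⟨hvd, fun hb => ?_⟩
  have ho : IsOpen (connectedComponentIn (G.deleteVerts {v}).drawingᶜ v) :=
    (isOpen_compl_drawing _).connectedComponentIn
  obtain ⟨z, hz1, hz2⟩ := mem_closure_iff.mp hcl _ ho hmv
  apply hz2.2
  rw [connectedComponentIn_eq hz1] at hb
  exact hb.subset (connectedComponentIn_mono z (Set.compl_subset_compl.mpr
    (drawing_deleteVerts_subset G {v})))

lemma component_deleteVerts_subset {G : PlaneGraph} (hG : G.IsEmbedded) {v : ℝ × ℝ}
    (ho : v ∈ (G.deleteVerts {v}).outerRegion) {x : ℝ × ℝ}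
    (hb : Bornology.IsBounded (connectedComponentIn (G.deleteVerts {v}).drawingᶜ x)) :
    connectedComponentIn (G.deleteVerts {v}).drawingᶜ x ⊆ G.drawingᶜ := by
  rintro z hz ⟨p, q, hpq, hzs⟩
  have hzd := connectedComponentIn_subset _ _ hz
  have key : ∀ w, G.Adj v w → z ∈ segment ℝ v w → False := by
    intro w hw hzw
    have := mem_component_of_mem_edge hG hw hzw hzd
    apply ho.2
    rwa [connectedComponentIn_eq this, ← connectedComponentIn_eq hz]
  by_cases hp : p = v
  · subst hp; exact key q hpq hzs
  by_cases hq : q = v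
  · subst hq; exact key p (G.symm _ _ hpq) (by rwa [segment_symm])
  · exact hzd ⟨p, q, ⟨hpq, by simpa using hp, by simpa using hq⟩, hzs⟩

lemma left_mem_closure_openTriangle {a b c : ℝ × ℝ} (h : (openTriangle a b c).Nonempty) :
    {a, b, c} ⊆ closure (openTriangle a b c) := by
  unfold openTriangle at *
  rw [(convex_convexHull ℝ _).closure_interior_eq_closure_of_nonempty_interior h]
  exact (subset_convexHull _ _).trans subset_closure

lemma InnerFacesTriangles.deleteVerts {G : PlaneGraph} (hG : G.IsEmbedded)
    (hI : G.InnerFacesTriangles) {v : ℝ × ℝ} (ho : v ∈ (G.deleteVerts {v}).outerRegion) :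
    (G.deleteVerts {v}).InnerFacesTriangles := by
  rintro F ⟨x, hx, rfl⟩ hb
  have hsub := component_deleteVerts_subset hG ho hb
  have hxm := mem_connectedComponentIn (Set.mem_compl hx)
  have heq : connectedComponentIn (G.deleteVerts {v}).drawingᶜ x =
      connectedComponentIn G.drawingᶜ x := by
    apply Set.Subset.antisymm
    · exact isPreconnected_connectedComponentIn.subset_connectedComponentIn hxm hsub
    · exact connectedComponentIn_mono x (Set.compl_subset_compl.mpr
        (drawing_deleteVerts_subset G {v}))
  obtain ⟨a, ha, b, hb', c, hc, h1, h2, h3, hF⟩ := hI _ ⟨x, hsub hxm, rfl⟩ (heq ▸ hb)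
  rw [← heq] at hF
  have hcl := left_mem_closure_openTriangle (a := a) (b := b) (c := c) ⟨x, hF ▸ hxm⟩
  rw [← hF] at hcl
  have hv : v ∉ ({a, b, c} : Set (ℝ × ℝ)) := by
    intro hv
    have hopen : IsOpen (connectedComponentIn (G.deleteVerts {v}).drawingᶜ v) :=
      (isOpen_compl_drawing _).connectedComponentIn
    obtain ⟨z, hz1, hz2⟩ := mem_closure_iff.mp (hcl hv) _ hopen (mem_connectedComponentIn ho.1)
    apply ho.2
    rwa [connectedComponentIn_eq hz1, ← connectedComponentIn_eq hz2]
  simp only [Set.mem_insert_iff, Set.mem_singleton_iff, not_or] at hv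
  obtain ⟨hva, hvb, hvc⟩ := hv
  refine ⟨a, ?_, b, ?_, c, ?_, ⟨h1, ?_, ?_⟩, ⟨h2, ?_, ?_⟩, ⟨h3, ?_, ?_⟩, hF⟩ <;>
    simp [PlaneGraph.deleteVerts, *, Ne.symm hva, Ne.symm hvb, Ne.symm hvc]

lemma face_deleteVerts {G : PlaneGraph} (hG : G.IsEmbedded) {σ : ℝ} (hσ : σ ≠ 0) {v : ℝ × ℝ}
    (ho : v ∈ (G.deleteVerts {v}).outerRegion) {a b c : ℝ × ℝ} :
    Face (G.deleteVerts {v}) σ a b c ↔ Face G σ a b c ∧ a ≠ v ∧ b ≠ v ∧ c ≠ v := by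
  constructor
  · intro h
    obtain ⟨h1, h2, h3, h4, h5⟩ := id h
    have key : ∀ x, x ∉ ({v} : Finset (ℝ × ℝ)) → x ≠ v := fun x hx => by simpa using hx
    refine ⟨⟨h1.1, h2.1, h3.1, h4, fun z hz => ?_⟩, key _ h1.2.1, key _ h2.2.1, key _ h3.2.1⟩
    have hb := tri_bounded hσ h4
    rw [← h.component_eq hz] at hb hz
    exact component_deleteVerts_subset hG ho hb hz
  · rintro ⟨⟨h1, h2, h3, h4, h5⟩, ha, hb, hc⟩
    refine ⟨⟨h1, ?_, ?_⟩, ⟨h2, ?_, ?_⟩, ⟨h3, ?_, ?_⟩, h4, fun z hz hd =>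
      h5 z hz (drawing_deleteVerts_subset G {v} hd)⟩ <;> simpa

/-! ### Consecutive elements of lists and cyclic lists -/

/-- `x` is immediately followed by `y` in the list. -/
def Adjc {α : Type*} : List α → α → α → Prop
  | a :: b :: l, x, y => (x = a ∧ y = b) ∨ Adjc (b :: l) x y
  | _, _, _ => False

/-- `x` is immediately followed by `y` in the list, read cyclically. -/
def Nx {α : Type*} : List α → α → α → Prop
  | [], _, _ => False
  | c :: l, x, y => Adjc (c :: l ++ [c]) x y

section Lists

variable {α : Type*}

@[simp] lemma adjc_nil (x y : α) : Adjc [] x y ↔ False := Iff.rfl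

@[simp] lemma adjc_singleton (a x y : α) : Adjc [a] x y ↔ False := Iff.rfl

@[simp] lemma adjc_cons_cons (a b x y : α) (l : List α) :
    Adjc (a :: b :: l) x y ↔ (x = a ∧ y = b) ∨ Adjc (b :: l) x y := Iff.rfl

lemma nx_cons (c : α) (l : List α) (x y : α) : Nx (c :: l) x y ↔ Adjc (c :: (l ++ [c])) x y :=
  Iff.rfl

lemma adjc_append_cons (A B : List α) (c x y : α) :
    Adjc (A ++ c :: B) x y ↔ Adjc (A ++ [c]) x y ∨ Adjc (c :: B) x y := by
  induction A with
  | nil => simp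
  | cons a A ih =>
    cases A with
    | nil => simp
    | cons b A => simp only [List.cons_append, adjc_cons_cons] at ih ⊢; rw [ih, or_assoc]

lemma nx_append_comm (A B : List α) (x y : α) : Nx (A ++ B) x y ↔ Nx (B ++ A) x y := by
  cases A with
  | nil => simp
  | cons a A =>
    cases B with
    | nil => simp
    | cons b B =>
      have e1 := adjc_append_cons (a :: A) (B ++ [a]) b x y
      have e2 := adjc_append_cons (b :: B) (A ++ [b]) a x y
      simp only [List.cons_append, nx_cons, List.append_assoc] at e1 e2 ⊢
      rw [e1, e2, or_comm]

lemma Adjc.mem {l : List α} {x y : α} (h : Adjc l x y) : x ∈ l ∧ y ∈ l.tail := by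
  induction l with
  | nil => exact h.elim
  | cons a l ih =>
    cases l with
    | nil => exact h.elim
    | cons b l =>
      rcases h with ⟨rfl, rfl⟩ | h
      · simp
      · have := ih h
        exact ⟨List.mem_cons_of_mem _ this.1, List.mem_cons_of_mem _ this.2⟩

lemma Adjc.mem_right {l : List α} {x y : α} (h : Adjc l x y) : y ∈ l :=
  List.mem_of_mem_tail h.mem.2

lemma exists_adjc_right {l : List α} {x : α} (hx : x ∈ l) (h : l.getLast? ≠ some x) :
    ∃ y, Adjc l x y := by
  induction l with
  | nil => simp at hx
  | cons a l ih =>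
    cases l with
    | nil => simp at hx h; exact absurd hx.symm h
    | cons b l =>
      rcases List.mem_cons.mp hx with rfl | hx
      · exact ⟨b, Or.inl ⟨rfl, rfl⟩⟩
      · obtain ⟨y, hy⟩ := ih hx (by simpa using h)
        exact ⟨y, Or.inr hy⟩

lemma exists_adjc_left {l : List α} {x : α} (hx : x ∈ l) (h : l.head? ≠ some x) :
    ∃ y, Adjc l y x := by
  induction l with
  | nil => simp at hx
  | cons a l ih =>
    have hx : x ∈ l := by
      rcases List.mem_cons.mp hx with rfl | hx
      · simp at h
      · exact hx
    cases l with
    | nil => simp at hx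
    | cons b l =>
      by_cases hb : b = x
      · subst hb; exact ⟨a, Or.inl ⟨rfl, rfl⟩⟩
      · obtain ⟨y, hy⟩ := ih hx (by simpa using hb)
        exact ⟨y, Or.inr hy⟩

lemma reflTransGen_of_adjc {r : α → α → Prop} (hr : ∀ x y, r x y → r y x) {l : List α}
    (h : ∀ x y, Adjc l x y → r x y) {x y : α} (hx : x ∈ l) (hy : y ∈ l) :
    Relation.ReflTransGen r x y := by
  have key : ∀ (l : List α) (a : α), (∀ x y, Adjc (a :: l) x y → r x y) →
      ∀ x ∈ a :: l, Relation.ReflTransGen r a x := by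
    intro l
    induction l with
    | nil => intro a _ x hx; simp at hx; subst hx; exact .refl
    | cons b l ih =>
      intro a h x hx
      rcases List.mem_cons.mp hx with rfl | hx
      · exact .refl
      · exact .head (h a b (Or.inl ⟨rfl, rfl⟩)) (ih b (fun x y hxy => h x y (Or.inr hxy)) x hx)
  cases l with
  | nil => simp at hx
  | cons a l =>
    have h1 := key l a h x hx
    have h2 := key l a h y hy
    have hs : Std.Symm r := ⟨hr⟩
    exact (Relation.ReflTransGen.stdSymm.symm _ _ h1).trans h2

lemma eq_of_adjc_concat {A : List α} {a p v : α} (hv : v ∉ A ++ [p])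
    (h : Adjc (A ++ [p, v]) a v) : a = p := by
  rw [adjc_append_cons] at h
  rcases h with h | h
  · exact absurd h.mem_right hv
  · simpa using h

lemma eq_of_nx_head {A : List α} {a p v : α} (hv : v ∉ A ++ [p])
    (h : Nx (v :: (A ++ [p])) a v) : a = p := by
  rw [nx_cons, List.append_assoc] at h
  cases A with
  | nil =>
    rcases h with h | h
    · exact absurd (by simp [h.2]) hv
    · simpa using h
  | cons b A =>
    rcases h with h | h
    · exact absurd (by simp [h.2]) hv
    · exact eq_of_adjc_concat hv h

lemma Nx.mem {l : List α} {x y : α} (h : Nx l x y) : x ∈ l ∧ y ∈ l := by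
  cases l with
  | nil => exact h.elim
  | cons c l =>
    have := Adjc.mem h
    simp at this ⊢
    tauto

lemma eq_of_nx_head' {A : List α} {b q v : α} (hv : v ∉ q :: A)
    (h : Nx (v :: q :: A) v b) : b = q := by
  rcases h with h | h
  · exact h.2
  · exfalso
    have : ∀ (A : List α) (q : α), v ∉ q :: A → ¬ Adjc (q :: (A ++ [v])) v b := by
      intro A
      induction A with
      | nil => intro q hq h; simp at h hq; exact hq h.1
      | cons c A ih =>
        intro q hq h
        rcases h with h | h
        · exact hq (by simp [h.1])
        · exact ih c (fun hc => hq (List.mem_cons_of_mem _ hc)) h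
    exact this A q hv h

end Lists

/-! ### Disks -/

/-- `G` is a plane graph all of whose inner faces are triangles and whose outer face is bounded
by the cyclic list `L` (or is a single edge if `L` has length two): a dart `(a, b)` has no
face next to it exactly when its reverse is on the list. -/
structure Disk (G : PlaneGraph) (σ : ℝ) (L : List (ℝ × ℝ)) : Prop where
  emb : G.IsEmbedded
  inner : G.InnerFacesTriangles
  conn : G.Connected
  nodup : L.Nodup
  two_le : 2 ≤ L.length
  adj : ∀ a b, Nx L a b → G.Adj a b
  face_iff : ∀ a b, G.Adj a b → ((∃ c, Face G σ a b c) ↔ ¬ Nx L b a)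

lemma Disk.rotate {G : PlaneGraph} {σ : ℝ} {A B : List (ℝ × ℝ)} (D : Disk G σ (A ++ B)) :
    Disk G σ (B ++ A) where
  emb := D.emb
  inner := D.inner
  conn := D.conn
  nodup := List.nodup_append_comm.mp D.nodup
  two_le := by have := D.two_le; simp at this ⊢; omega
  adj a b h := D.adj a b ((nx_append_comm _ _ _ _).mp h)
  face_iff a b h := by rw [D.face_iff a b h, nx_append_comm]

lemma exists_nx_left {α : Type*} {L : List α} {v : α} (hv : v ∈ L) : ∃ p, Nx L p v := by
  cases L with
  | nil => simp at hv
  | cons a L =>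
    rcases List.mem_cons.mp hv with rfl | hv
    · rcases List.eq_nil_or_concat L with rfl | ⟨A, p, rfl⟩
      · exact ⟨v, by simp [nx_cons]⟩
      · refine ⟨p, ?_⟩
        rw [nx_cons, List.concat_eq_append, List.append_assoc, ← List.cons_append]
        exact (adjc_append_cons _ _ _ _ _).mpr (Or.inr (Or.inl ⟨rfl, rfl⟩))
    · obtain ⟨A, B, rfl⟩ := List.append_of_mem hv
      have : ∃ C p, a :: A = C ++ [p] := by
        rcases List.eq_nil_or_concat (a :: A) with h | ⟨C, p, h⟩
        · simp at h
        · exact ⟨C, p, by simpa using h⟩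
      obtain ⟨C, p, hC⟩ := this
      refine ⟨p, ?_⟩
      rw [nx_cons, ← List.cons_append, ← List.cons_append, hC]
      simp only [List.append_assoc, List.cons_append, List.nil_append]
      exact (adjc_append_cons _ _ _ _ _).mpr (Or.inr (Or.inl ⟨rfl, rfl⟩))

lemma Disk.mem_verts {G : PlaneGraph} {σ : ℝ} {L : List (ℝ × ℝ)} (D : Disk G σ L) {v : ℝ × ℝ}
    (hv : v ∈ L) : v ∈ G.verts := by
  obtain ⟨p, hp⟩ := exists_nx_left hv
  exact (G.mem_of_adj _ _ (D.adj _ _ hp)).2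

/-- The neighbours of a boundary vertex form a path, in rotational order. -/
lemma Disk.exists_fan {G : PlaneGraph} {σ : ℝ} {v p q : ℝ × ℝ} {L : List (ℝ × ℝ)}
    (D : Disk G σ L) (hp : Nx L p v) (hq : Nx L v q) (hpu : ∀ x, Nx L x v → x = p)
    (hqu : ∀ x, Nx L v x → x = q) :
    ∃ F : List (ℝ × ℝ), F.Nodup ∧ F.head? = some p ∧ F.getLast? = some q ∧
      (∀ x y, Adjc F x y ↔ Face G σ v y x) ∧ ∀ x, x ∈ F ↔ G.Adj v x := by
  set P : List (ℝ × ℝ) → Prop := fun l => l.Nodup ∧ l.getLast? = some q ∧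
    (∀ x y, Adjc l x y → Face G σ v y x) ∧ ∀ x ∈ l, G.Adj v x with hP
  have hvq := D.adj _ _ hq
  have hvp := G.symm _ _ (D.adj _ _ hp)
  have hlen : ∀ l, P l → l.length ≤ G.verts.card := by
    rintro l ⟨h1, -, -, h4⟩
    rw [← List.toFinset_card_of_nodup h1]
    exact Finset.card_le_card fun x hx => (G.mem_of_adj _ _ (h4 x (List.mem_toFinset.mp hx))).2
  have hne : ∃ n, ∃ l, P l ∧ l.length = n :=
    ⟨1, [q], ⟨by simp, by simp, by simp, by simpa using hvq⟩, rfl⟩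
  have hmax : ∃ l, P l ∧ ∀ l', P l' → l'.length ≤ l.length := by
    by_contra hcon
    push Not at hcon
    have : ∀ n, ∃ l, P l ∧ n ≤ l.length := by
      intro n
      induction n with
      | zero => obtain ⟨n, l, hl, -⟩ := hne; exact ⟨l, hl, Nat.zero_le _⟩
      | succ n ih =>
        obtain ⟨l, hl, hn⟩ := ih
        obtain ⟨l', hl', h⟩ := hcon l hl
        exact ⟨l', hl', by omega⟩
    obtain ⟨l, hl, h⟩ := this (G.verts.card + 1)
    have := hlen l hl
    omega
  obtain ⟨l, ⟨h1, h2, h3, h4⟩, hm⟩ := hmax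
  have hql : q ∈ l := List.mem_of_getLast? h2
  have hnoq : ∀ x, ¬ Face G σ v x q := fun x hx =>
    (D.face_iff q v (G.symm _ _ hvq)).mp ⟨x, hx.rot.rot⟩ hq
  have hnop : ∀ x, ¬ Face G σ v p x := fun x hx => (D.face_iff v p hvp).mp ⟨x, hx⟩ hp
  have hback : ∀ x b, b ∈ l → Face G σ v x b → ∃ z, Adjc l b z ∧ z = x := by
    intro x b hb hF
    have hbq : l.getLast? ≠ some b := by
      rw [h2]; intro h; cases h; exact hnoq x hF
    obtain ⟨z, hz⟩ := exists_adjc_right hb hbq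
    exact ⟨z, hz, Face.unique' D.emb (h3 _ _ hz) hF⟩
  obtain ⟨x, l', rfl⟩ : ∃ x l', l = x :: l' := by
    cases l with
    | nil => simp at hql
    | cons x l' => exact ⟨x, l', rfl⟩
  have hxv : G.Adj v x := h4 x (by simp)
  have hxp : x = p := by
    apply hpu
    by_contra hcon
    obtain ⟨c, hc⟩ := (D.face_iff v x hxv).mpr hcon
    have hcl : c ∉ x :: l' := by
      intro hcl
      obtain ⟨z, hz, rfl⟩ := hback x c hcl hc
      exact (List.nodup_cons.mp h1).1 hz.mem.2
    have := hm (c :: x :: l') ⟨List.nodup_cons.mpr ⟨hcl, h1⟩, by simpa using h2, ?_, ?_⟩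
    · simp at this
    · rintro y z (⟨rfl, rfl⟩ | h)
      · exact hc
      · exact h3 _ _ h
    · intro y hy
      rcases List.mem_cons.mp hy with rfl | hy
      · exact G.symm _ _ hc.2.2.1
      · exact h4 y hy
  subst hxp
  have hall : ∀ y, G.Adj v y → y ∈ x :: l' := by
    intro y hy
    by_contra hyl
    have := mem_of_closed_link (σ := σ) D.emb (v := v) (K := {z | G.Adj v z ∧ z ∉ x :: l'})
      ⟨y, hy, hyl⟩
      ?_ ?_ hvq
    · exact this.2 hql
    · rintro a ⟨ha, hal⟩
      obtain ⟨b, hb⟩ := (D.face_iff v a ha).mpr fun h => hal (by rw [hpu a h]; simp)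
      refine ⟨b, ⟨G.symm _ _ hb.2.2.1, fun hbl => ?_⟩, hb⟩
      obtain ⟨z, hz, rfl⟩ := hback a b hbl hb
      exact hal hz.mem_right
    · rintro a ⟨ha, hal⟩
      obtain ⟨b, hb⟩ := (D.face_iff a v (G.symm _ _ ha)).mpr fun h =>
        hal (by rw [hqu a h]; exact hql)
      refine ⟨b, ⟨hb.2.1, fun hbl => ?_⟩, hb.rot⟩
      have hbx : (x :: l').head? ≠ some b := by
        intro h
        simp at h
        subst h
        exact hnop _ hb.rot
      obtain ⟨z, hz⟩ := exists_adjc_left hbl hbx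
      have := Face.unique D.emb hb.rot (h3 _ _ hz)
      subst this
      exact hal hz.mem.1
  refine ⟨x :: l', h1, rfl, h2, fun a b => ⟨h3 a b, fun hF => ?_⟩, fun y => ⟨h4 y, hall y⟩⟩
  obtain ⟨z, hz, rfl⟩ := hback b a (hall a (G.symm _ _ hF.2.2.1)) hF
  exact hz

lemma reachable_symm {G : PlaneGraph} {x y : ℝ × ℝ} (h : G.Reachable x y) : G.Reachable y x := by
  induction h with
  | refl => exact .refl
  | tail _ h ih => exact .head (G.symm _ _ h) ih

lemma connected_deleteVerts {G : PlaneGraph} (hG : G.Connected) {v : ℝ × ℝ}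
    (hne : ∃ x ∈ G.verts, x ≠ v)
    (h : ∀ a b, G.Adj v a → G.Adj v b → (G.deleteVerts {v}).Reachable a b) :
    (G.deleteVerts {v}).Connected := by
  have hmem : ∀ x, x ∈ (G.deleteVerts {v}).verts ↔ x ∈ G.verts ∧ x ≠ v := by
    intro x; simp [deleteVerts]
  obtain ⟨x, hx, hxv⟩ := hne
  refine ⟨⟨x, (hmem x).mpr ⟨hx, hxv⟩⟩, fun p hp q hq => ?_⟩
  rw [hmem] at hp hq
  have key : ∀ y, G.Reachable p y → (y ≠ v → (G.deleteVerts {v}).Reachable p y) ∧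
      (y = v → ∃ w, G.Adj v w ∧ (G.deleteVerts {v}).Reachable p w) := by
    intro y hy
    induction hy with
    | refl => exact ⟨fun _ => .refl, fun h => absurd h hp.2⟩
    | @tail y z _ hyz ih =>
      by_cases hyv : y = v
      · subst hyv
        obtain ⟨w, hw, hr⟩ := ih.2 rfl
        exact ⟨fun _ => hr.trans (h w z hw hyz), fun hz => absurd hz (Adj_ne hyz).symm⟩
      · refine ⟨fun hz => (ih.1 hyv).tail ⟨hyz, by simpa, by simpa⟩, ?_⟩
        rintro rfl
        exact ⟨y, G.symm _ _ hyz, ih.1 hyv⟩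
  exact (key q (hG.2 p hp.1 q hq.1)).1 hq.2

/-- A boundary vertex `v`, listed first, with its neighbours in order. -/
structure Fan (G : PlaneGraph) (σ : ℝ) (v : ℝ × ℝ) (F : List (ℝ × ℝ)) : Prop where
  nodup : F.Nodup
  adjc_iff : ∀ x y, Adjc F x y ↔ Face G σ v y x
  mem_iff : ∀ x, x ∈ F ↔ G.Adj v x

lemma Disk.exists_fan' {G : PlaneGraph} {σ : ℝ} {v p q : ℝ × ℝ} {R : List (ℝ × ℝ)}
    (D : Disk G σ (v :: q :: (R ++ [p]))) : ∃ M, Fan G σ v (p :: (M ++ [q])) := by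
  have hnd := D.nodup
  have hv := (List.nodup_cons.mp hnd).1
  have hpq : p ≠ q := by
    have := (List.nodup_cons.mp (List.nodup_cons.mp hnd).2).1
    rintro rfl; simp at this
  have hp : Nx (v :: q :: (R ++ [p])) p v := by
    rw [nx_cons]
    have := (adjc_append_cons (v :: q :: R) [v] p p v).mpr (Or.inr (by simp))
    simpa using this
  obtain ⟨F, h1, h2, h3, h4, h5⟩ := D.exists_fan (v := v) (p := p) (q := q) hp
    (Or.inl ⟨rfl, rfl⟩)
    (fun x hx => eq_of_nx_head (A := q :: R) hv hx) (fun x hx => eq_of_nx_head' hv hx)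
  cases F with
  | nil => simp at h2
  | cons a F =>
    simp at h2
    subst h2
    rcases List.eq_nil_or_concat F with rfl | ⟨M, b, rfl⟩
    · simp at h3; exact absurd h3 hpq
    · have : b = q := by
        have h3' : (a :: M ++ [b]).getLast? = some q := by simpa using h3
        rw [List.getLast?_append] at h3'
        simpa using h3'
      subst this
      exact ⟨M, by simpa using h1, by simpa using h4, by simpa using h5⟩

lemma Disk.mem_outer {G : PlaneGraph} {σ : ℝ} (hσ : σ ≠ 0) {v : ℝ × ℝ} {L : List (ℝ × ℝ)}
    (D : Disk G σ L) (hv : v ∈ L) : v ∈ (G.deleteVerts {v}).outerRegion := by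
  obtain ⟨p, hp⟩ := exists_nx_left hv
  have ha := D.adj _ _ hp
  have hcl := segment_subset_closure_outerRegion D.emb D.inner hσ (G.symm _ _ ha)
    (by rw [D.face_iff _ _ (G.symm _ _ ha)]; simpa)
  obtain ⟨m, hm⟩ : (openSegment ℝ v p).Nonempty := ⟨_, 1 / 2, 1 / 2, by norm_num, by norm_num,
    by norm_num, rfl⟩
  exact mem_outerRegion_deleteVerts D.emb (G.symm _ _ ha) hm
    (hcl (openSegment_subset_segment _ _ _ hm))

/-- Removing a boundary vertex all of whose inner neighbours are interior vertices. -/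
lemma Disk.remove {G : PlaneGraph} {σ : ℝ} (hσ : σ ≠ 0) {v p q : ℝ × ℝ} {R M : List (ℝ × ℝ)}
    (D : Disk G σ (v :: q :: (R ++ [p]))) (hF : Fan G σ v (p :: (M ++ [q])))
    (hM : ∀ x ∈ M, x ∉ q :: (R ++ [p])) :
    Disk (G.deleteVerts {v}) σ (q :: (R ++ [p]) ++ M) := by
  have ho := D.mem_outer hσ (v := v) (by simp)
  have hnd := List.nodup_cons.mp D.nodup
  have hold : ∀ a b, Nx (v :: q :: (R ++ [p])) a b ↔ (a = v ∧ b = q) ∨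
      Adjc (q :: (R ++ [p])) a b ∨ (a = p ∧ b = v) := by
    intro a b
    have := adjc_append_cons (q :: R) [v] p a b
    simp only [nx_cons, List.cons_append, List.append_assoc, adjc_cons_cons, List.nil_append,
      adjc_singleton, or_false] at this ⊢
    rw [this]
  have hnew : ∀ a b, Nx (q :: (R ++ [p]) ++ M) a b ↔
      Adjc (q :: (R ++ [p])) a b ∨ Adjc (p :: (M ++ [q])) a b := by
    intro a b
    have := adjc_append_cons (q :: R) (M ++ [q]) p a b
    simp only [nx_cons, List.cons_append, List.append_assoc, List.nil_append] at this ⊢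
    rw [this]
  have hne : ∀ a b, Adjc (q :: (R ++ [p])) a b → a ≠ v ∧ b ≠ v := fun a b h =>
    ⟨fun h' => hnd.1 (h' ▸ h.mem.1), fun h' => hnd.1 (h' ▸ h.mem_right)⟩
  have hadj : ∀ a b, Nx (q :: (R ++ [p]) ++ M) a b → (G.deleteVerts {v}).Adj a b := by
    intro a b h
    rcases (hnew a b).mp h with h | h
    · obtain ⟨h1, h2⟩ := hne _ _ h
      exact ⟨D.adj _ _ ((hold _ _).mpr (Or.inr (Or.inl h))), by simpa, by simpa⟩
    · have hf := (hF.adjc_iff _ _).mp h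
      exact ⟨G.symm _ _ hf.2.1, by simpa using Adj_ne hf.2.2.1, by simpa using (Adj_ne hf.1).symm⟩
  refine ⟨D.emb.deleteVerts _, D.inner.deleteVerts D.emb ho, ?_, ?_, by simp; omega, hadj, ?_⟩
  · refine connected_deleteVerts D.conn ⟨q, D.mem_verts (by simp), fun h => hnd.1 (by simp [h])⟩
      fun a b ha hb => ?_
    refine reflTransGen_of_adjc (G.deleteVerts {v}).symm (l := p :: (M ++ [q]))
      (fun x y h => hadj x y ((hnew x y).mpr (Or.inr h))) ((hF.mem_iff a).mpr ha)
      ((hF.mem_iff b).mpr hb)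
  · have h1 := hF.nodup
    refine List.nodup_append.mpr ⟨hnd.2, ?_, ?_⟩
    · exact (List.nodup_append.mp (List.nodup_cons.mp h1).2).1
    · rintro a ha b hb rfl
      exact hM a hb ha
  · rintro a b ⟨h1, ha, hb⟩
    rw [Finset.mem_singleton] at ha hb
    have hfi := D.face_iff a b h1
    rw [hold] at hfi
    rw [hnew]
    simp only [face_deleteVerts D.emb hσ ho]
    constructor
    · rintro ⟨c, hc, -, -, hcv⟩ (h | h)
      · exact hfi.mp ⟨c, hc⟩ (Or.inr (Or.inl h))
      · exact hcv (Face.unique D.emb hc ((hF.adjc_iff _ _).mp h).rot)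
    · intro h
      rw [not_or] at h
      obtain ⟨c, hc⟩ := hfi.mpr (by tauto)
      refine ⟨c, hc, ha, hb, ?_⟩
      rintro rfl
      exact h.2 ((hF.adjc_iff _ _).mpr hc.rot.rot)

lemma Disk.verts_of_two {G : PlaneGraph} {σ : ℝ} {a b : ℝ × ℝ} (D : Disk G σ [a, b]) {x : ℝ × ℝ}
    (hx : x ∈ G.verts) : x = a ∨ x = b := by
  have hab : a ≠ b := by have := D.nodup; simpa using this
  have key : ∀ a b : ℝ × ℝ, a ≠ b → Disk G σ [a, b] → ∀ x, G.Adj a x → x = b := by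
    intro a b hab D x hx
    have h1 : ∀ x, Nx [a, b] x a → x = b := by
      intro x hx
      simp [nx_cons, hab] at hx
      exact hx
    have h2 : ∀ x, Nx [a, b] a x → x = b := by
      intro x hx
      simp [nx_cons, hab] at hx
      exact hx
    obtain ⟨F, hF1, hF2, hF3, -, hF5⟩ := D.exists_fan (v := a) (p := b) (q := b)
      (by simp [nx_cons]) (by simp [nx_cons]) h1 h2
    cases F with
    | nil => simp at hF2
    | cons c F =>
      simp at hF2
      subst hF2
      rcases List.eq_nil_or_concat F with rfl | ⟨M, d, rfl⟩
      · simpa using (hF5 x).mpr hx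
      · have h3' : (c :: M ++ [d]).getLast? = some c := by simpa using hF3
        rw [List.getLast?_append] at h3'
        simp at h3'
        subst h3'
        simp at hF1
  have h1 := key a b hab D
  have h2 := key b a hab.symm (Disk.rotate (A := [a]) (B := [b]) D)
  have hr := D.conn.2 a (D.mem_verts (by simp)) x hx
  unfold Reachable at hr
  induction hr with
  | refl => exact Or.inl rfl
  | @tail y z _ hyz ih =>
    rcases ih (G.mem_of_adj _ _ hyz).1 with rfl | rfl
    · exact Or.inr (h1 _ hyz)
    · exact Or.inl (h2 _ hyz)

lemma exists_nx_decomp {α : Type*} {L : List α} (h3 : 3 ≤ L.length) {v : α} (hv : v ∈ L) :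
    ∃ A B q R p, L = A ++ B ∧ B ++ A = v :: q :: (R ++ [p]) ∧ R.length + 3 = L.length := by
  obtain ⟨A, B, rfl⟩ := List.append_of_mem hv
  have h2 : 2 ≤ (B ++ A).length := by simp at h3 ⊢; omega
  match h : B ++ A with
  | [] => simp [h] at h2
  | [x] => simp [h] at h2
  | q :: b :: C =>
    rcases List.eq_nil_or_concat (b :: C) with h' | ⟨R, p, h'⟩
    · simp at h'
    · refine ⟨A, v :: B, q, R, p, rfl, ?_, ?_⟩
      · simp [h, h']
      · have h1 := congrArg List.length h
        have h2 := congrArg List.length h'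
        simp at h1 h2 ⊢
        omega

lemma Disk.reachable_nbrs {G : PlaneGraph} {σ : ℝ} {L : List (ℝ × ℝ)} (D : Disk G σ L)
    (h3 : 3 ≤ L.length) {v a b : ℝ × ℝ} (ha : G.Adj v a) (hb : G.Adj v b) :
    (G.deleteVerts {v}).Reachable a b := by
  by_cases hv : v ∈ L
  · obtain ⟨A, B, q, R, p, rfl, hBA, -⟩ := exists_nx_decomp h3 hv
    have D' := D.rotate
    rw [hBA] at D'
    obtain ⟨M, hF⟩ := D'.exists_fan'
    refine reflTransGen_of_adjc (G.deleteVerts {v}).symm (fun x y h => ?_)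
      ((hF.mem_iff a).mpr ha) ((hF.mem_iff b).mpr hb)
    have hf := (hF.adjc_iff _ _).mp h
    exact ⟨G.symm _ _ hf.2.1, by simpa using Adj_ne hf.2.2.1, by simpa using (Adj_ne hf.1).symm⟩
  · have key : ∀ x, G.Adj v x → ∃ y, Face G σ v x y := fun x hx =>
      (D.face_iff v x hx).mpr fun h => hv h.mem.2
    have key' : ∀ x, G.Adj v x → ∃ y, Face G σ v y x := fun x hx => by
      obtain ⟨y, hy⟩ := (D.face_iff x v (G.symm _ _ hx)).mpr fun h => hv h.mem.1
      exact ⟨y, hy.rot⟩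
    have hst : ∀ x y, G.Adj x y → G.Adj v x → G.Adj v y → (G.deleteVerts {v}).Adj x y :=
      fun x y h hx hy => ⟨h, by simpa using (Adj_ne hx).symm, by simpa using (Adj_ne hy).symm⟩
    refine (mem_of_closed_link (σ := σ) D.emb (v := v)
      (K := {x | G.Adj v x ∧ (G.deleteVerts {v}).Reachable a x}) ⟨a, ha, .refl⟩ ?_ ?_ hb).2
    · rintro x ⟨hx, hr⟩
      obtain ⟨y, hy⟩ := key x hx
      have hy' := G.symm _ _ hy.2.2.1
      exact ⟨y, ⟨hy', hr.tail (hst _ _ hy.2.1 hx hy')⟩, hy⟩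
    · rintro x ⟨hx, hr⟩
      obtain ⟨y, hy⟩ := key' x hx
      exact ⟨y, ⟨hy.1, hr.tail (hst _ _ (G.symm _ _ hy.2.1) hx hy.1)⟩, hy⟩

lemma Disk.length_le_card {G : PlaneGraph} {σ : ℝ} {L : List (ℝ × ℝ)} (D : Disk G σ L) :
    L.length ≤ G.verts.card := by
  rw [← List.toFinset_card_of_nodup D.nodup]
  exact Finset.card_le_card fun x hx => D.mem_verts (List.mem_toFinset.mp hx)

lemma Disk.biconnected {G : PlaneGraph} {σ : ℝ} {L : List (ℝ × ℝ)} (D : Disk G σ L)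
    (h3 : 3 ≤ L.length) : G.Biconnected := by
  have hc := D.length_le_card
  refine ⟨by omega, D.conn, fun v _ => connected_deleteVerts D.conn ?_
    fun a b ha hb => D.reachable_nbrs h3 ha hb⟩
  exact Finset.exists_mem_ne (by omega) v

lemma Disk.isNearTriangulation {G : PlaneGraph} {σ : ℝ} {L : List (ℝ × ℝ)} (D : Disk G σ L)
    (h3 : 3 ≤ L.length) : G.IsNearTriangulation :=
  ⟨D.emb, D.biconnected h3, D.inner⟩

/-! ### Winding numbers of polygons -/

/-- The point `p` as a complex number. -/
def toC (p : ℝ × ℝ) : ℂ := ⟨p.1, p.2⟩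

lemma toC_eq : toC = fun p : ℝ × ℝ => Complex.equivRealProdCLM.symm p := by
  funext p; apply Complex.ext <;> simp [toC]

lemma continuous_toC : Continuous toC := by
  rw [toC_eq]; exact ContinuousLinearEquiv.continuous _

lemma toC_injective : Function.Injective toC := by
  intro p q h
  simp only [toC, Complex.mk.injEq] at h
  exact Prod.ext h.1 h.2

/-- The quotient of `b` by `a`, seen from `z`. -/
def quot (a b z : ℝ × ℝ) : ℂ := (toC b - toC z) / (toC a - toC z)

lemma quot_im (a b z : ℝ × ℝ) :
    (quot a b z).im = cr 1 a b z / Complex.normSq (toC a - toC z) := by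
  simp only [quot, Complex.div_im, toC, Complex.sub_im, Complex.sub_re, cr]
  rw [← sub_div]; congr 1; ring

lemma toC_sub_ne {a z : ℝ × ℝ} (h : z ≠ a) : toC a - toC z ≠ 0 := by
  rw [sub_ne_zero]; exact fun h' => h (toC_injective h').symm

lemma normSq_toC_sub_pos {a z : ℝ × ℝ} (h : z ≠ a) : 0 < Complex.normSq (toC a - toC z) :=
  Complex.normSq_pos.mpr (toC_sub_ne h)

lemma continuousAt_quot {a b z : ℝ × ℝ} (h : z ≠ a) : ContinuousAt (quot a b) z := by
  have := continuous_toC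
  unfold quot
  exact ContinuousAt.div (by fun_prop) (by fun_prop) (toC_sub_ne h)

lemma quot_mem_slitPlane {a b z : ℝ × ℝ} (h : z ∉ segment ℝ a b) :
    quot a b z ∈ Complex.slitPlane := by
  have hza : z ≠ a := by rintro rfl; exact h (left_mem_segment _ _ _)
  rw [Complex.mem_slitPlane_iff]
  by_contra hcon
  push Not at hcon
  obtain ⟨hre, him⟩ := hcon
  set t : ℝ := -(quot a b z).re with ht
  have hq : quot a b z = ((-t : ℝ) : ℂ) := by apply Complex.ext <;> simp [ht, him]
  have hm := toC_sub_ne hza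
  rw [quot, div_eq_iff hm] at hq
  have h1 := congrArg Complex.re hq
  have h2 := congrArg Complex.im hq
  simp [toC] at h1 h2
  have ht0 : 0 ≤ t := by linarith
  refine h ⟨t / (1 + t), 1 / (1 + t), by positivity, by positivity, by field_simp; ring, ?_⟩
  ext
  · simp; field_simp; linarith
  · simp; field_simp; linarith

/-- The angle under which the segment from `a` to `b` is seen from `z`. -/
def ang (a b z : ℝ × ℝ) : ℝ := (quot a b z).arg

lemma continuousAt_ang {a b z : ℝ × ℝ} (h : z ∉ segment ℝ a b) : ContinuousAt (ang a b) z := by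
  have hza : z ≠ a := by rintro rfl; exact h (left_mem_segment _ _ _)
  exact ContinuousAt.comp (f := quot a b) (Complex.continuousAt_arg (quot_mem_slitPlane h))
    (continuousAt_quot hza)

/-- The total angle swept, seen from `z`, along the polygonal path with vertices `l`. -/
def windL : List (ℝ × ℝ) → ℝ × ℝ → ℝ
  | a :: b :: l, z => ang a b z + windL (b :: l) z
  | _, _ => 0

@[simp] lemma windL_nil (z : ℝ × ℝ) : windL [] z = 0 := rfl

@[simp] lemma windL_singleton (a z : ℝ × ℝ) : windL [a] z = 0 := rfl

lemma windL_cons_cons (a b : ℝ × ℝ) (l : List (ℝ × ℝ)) (z : ℝ × ℝ) :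
    windL (a :: b :: l) z = ang a b z + windL (b :: l) z := rfl

lemma windL_append_cons (A B : List (ℝ × ℝ)) (c z : ℝ × ℝ) :
    windL (A ++ c :: B) z = windL (A ++ [c]) z + windL (c :: B) z := by
  induction A with
  | nil => simp
  | cons a A ih =>
    cases A with
    | nil => simp [windL_cons_cons]
    | cons b A =>
      simp only [List.cons_append, windL_cons_cons] at ih ⊢
      rw [ih]; ring

lemma continuousAt_windL {l : List (ℝ × ℝ)} {z : ℝ × ℝ}
    (h : ∀ a b, Adjc l a b → z ∉ segment ℝ a b) : ContinuousAt (windL l) z := by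
  induction l with
  | nil => exact continuousAt_const
  | cons a l ih =>
    cases l with
    | nil => exact continuousAt_const
    | cons b l =>
      exact (continuousAt_ang (h a b (by simp))).add
        (ih fun x y hxy => h x y (by simp [hxy]))

lemma coe_windL {l : List (ℝ × ℝ)} {a b z : ℝ × ℝ} (ha : l.head? = some a)
    (hb : l.getLast? = some b) (hz : z ∉ l) :
    (windL l z : Real.Angle) = (toC b - toC z).arg - (toC a - toC z).arg := by
  induction l generalizing a with
  | nil => simp at ha
  | cons c l ih =>
    obtain rfl : c = a := by simpa using ha
    cases l with
    | nil =>
      obtain rfl : c = b := by simpa using hb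
      simp
    | cons d l =>
      simp only [List.mem_cons, not_or] at hz
      have := ih (a := d) rfl (by simpa using hb) (by simp [hz])
      rw [windL_cons_cons, Real.Angle.coe_add, this, ang, quot,
        Complex.arg_div_coe_angle (toC_sub_ne hz.2.1) (toC_sub_ne hz.1)]
      abel

lemma exists_windL_eq {l : List (ℝ × ℝ)} {a z : ℝ × ℝ} (hz : z ∉ a :: (l ++ [a])) :
    ∃ n : ℤ, windL (a :: (l ++ [a])) z = 2 * Real.pi * n := by
  have h := coe_windL (a := a) (b := a) (z := z) (l := a :: (l ++ [a])) rfl (by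
    rw [← List.cons_append, List.getLast?_concat]) hz
  rw [sub_self, ← Real.Angle.coe_zero, Real.Angle.angle_eq_iff_two_pi_dvd_sub] at h
  simpa using h

lemma mem_exists_adjc {l : List (ℝ × ℝ)} {a z : ℝ × ℝ} (hz : z ∈ a :: (l ++ [a])) :
    ∃ x y, Adjc (a :: (l ++ [a])) x y ∧ z ∈ segment ℝ x y := by
  obtain ⟨p, hp⟩ := exists_nx_left (L := a :: l) (v := z) (by simp at hz ⊢; tauto)
  exact ⟨p, z, hp, right_mem_segment _ _ _⟩

lemma windL_eq_of_isPreconnected {l : List (ℝ × ℝ)} {a : ℝ × ℝ} {S : Set (ℝ × ℝ)}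
    (hS : IsPreconnected S)
    (h : ∀ z ∈ S, ∀ x y, Adjc (a :: (l ++ [a])) x y → z ∉ segment ℝ x y) {z w : ℝ × ℝ}
    (hz : z ∈ S) (hw : w ∈ S) : windL (a :: (l ++ [a])) z = windL (a :: (l ++ [a])) w := by
  have hnot : ∀ z ∈ S, z ∉ a :: (l ++ [a]) := fun z hz hm => by
    obtain ⟨x, y, hxy, hm⟩ := mem_exists_adjc hm
    exact h z hz x y hxy hm
  have hc : ContinuousOn (windL (a :: (l ++ [a]))) S := fun z hz =>
    (continuousAt_windL (h z hz)).continuousWithinAt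
  have key : ∀ z ∈ S, ∀ w ∈ S,
      ¬ windL (a :: (l ++ [a])) z < windL (a :: (l ++ [a])) w := by
    intro z hz w hw hlt
    obtain ⟨k, hk⟩ := exists_windL_eq (hnot z hz)
    obtain ⟨n, hn⟩ := exists_windL_eq (hnot w hw)
    have hpi := Real.pi_pos
    rw [hk, hn] at hlt
    have hkn : k < n := by
      have : (k : ℝ) < n := by nlinarith
      exact_mod_cast this
    have hkn' : (k : ℝ) + 1 ≤ n := by exact_mod_cast hkn
    obtain ⟨y, hy, hyv⟩ := hS.intermediate_value hz hw hc
      (show 2 * Real.pi * k + Real.pi ∈ Set.Icc _ _ by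
        rw [hk, hn]; constructor <;> nlinarith)
    obtain ⟨j, hj⟩ := exists_windL_eq (hnot y hy)
    rw [hj] at hyv
    have : (2 * (j : ℝ)) = 2 * k + 1 := by
      apply mul_left_cancel₀ hpi.ne'; linarith
    have : 2 * j = 2 * k + 1 := by exact_mod_cast this
    omega
  exact le_antisymm (not_lt.mp (key w hw z hz)) (not_lt.mp (key z hz w hw))

lemma tendsto_ang (a b : ℝ × ℝ) :
    Filter.Tendsto (ang a b) (Bornology.cobounded (ℝ × ℝ)) (nhds 0) := by
  have h0 : Filter.Tendsto (fun z => toC a - toC z) (Bornology.cobounded (ℝ × ℝ))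
      (Bornology.cobounded ℂ) := by
    have h1 : Filter.Tendsto toC (Bornology.cobounded (ℝ × ℝ)) (Bornology.cobounded ℂ) := by
      rw [toC_eq]
      exact (Complex.equivRealProdCLM.symm.antilipschitz).tendsto_cobounded
    have h2 : Filter.Tendsto (fun w : ℂ => toC a - w) (Bornology.cobounded ℂ)
        (Bornology.cobounded ℂ) :=
      (IsometryEquiv.subLeft (toC a)).isometry.antilipschitz.tendsto_cobounded
    exact h2.comp h1
  have h1 : Filter.Tendsto (quot a b) (Bornology.cobounded (ℝ × ℝ)) (nhds 1) := by
    have h2 : Filter.Tendsto (fun z => 1 + (toC b - toC a) * (toC a - toC z)⁻¹)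
        (Bornology.cobounded (ℝ × ℝ)) (nhds (1 + (toC b - toC a) * 0)) :=
      tendsto_const_nhds.add (tendsto_const_nhds.mul
        (Filter.tendsto_inv₀_cobounded.comp h0))
    rw [mul_zero, add_zero] at h2
    refine h2.congr' ?_
    have h3 : ∀ᶠ z in Bornology.cobounded (ℝ × ℝ), z ≠ a :=
      Bornology.isBounded_singleton (x := a)
    filter_upwards [h3] with z hz
    have := toC_sub_ne hz
    rw [quot]; field_simp; ring
  have := (Complex.continuousAt_arg (x := 1) (by simp)).tendsto.comp h1
  rwa [Complex.arg_one] at this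

lemma tendsto_windL (l : List (ℝ × ℝ)) :
    Filter.Tendsto (windL l) (Bornology.cobounded (ℝ × ℝ)) (nhds 0) := by
  induction l with
  | nil => exact tendsto_const_nhds
  | cons a l ih =>
    cases l with
    | nil => exact tendsto_const_nhds
    | cons b l =>
      have := (tendsto_ang a b).add ih
      rwa [add_zero] at this

lemma windL_eq_zero_of_unbounded {l : List (ℝ × ℝ)} {a : ℝ × ℝ} {S : Set (ℝ × ℝ)}
    (hS : IsPreconnected S) (hb : ¬ Bornology.IsBounded S)
    (h : ∀ z ∈ S, ∀ x y, Adjc (a :: (l ++ [a])) x y → z ∉ segment ℝ x y) {z : ℝ × ℝ}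
    (hz : z ∈ S) : windL (a :: (l ++ [a])) z = 0 := by
  by_contra hne
  have h1 := (tendsto_windL (a :: (l ++ [a]))).eventually
    (isOpen_compl_singleton.mem_nhds (Ne.symm hne : (0 : ℝ) ∈ {_}ᶜ))
  apply hb
  have h2 : {w | windL (a :: (l ++ [a])) w ∈ ({windL (a :: (l ++ [a])) z}ᶜ : Set ℝ)} ∈
      Bornology.cobounded (ℝ × ℝ) := h1
  rw [← Bornology.isCobounded_def, ← Bornology.isBounded_compl_iff] at h2
  refine h2.subset fun w hw => ?_
  rw [Set.mem_compl_iff]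
  exact fun hc => hc (windL_eq_of_isPreconnected hS h hw hz)

lemma exists_quot_eq {a b m : ℝ × ℝ} (hab : a ≠ b) (hm : m ∈ openSegment ℝ a b) :
    (quot a b m).re < 0 ∧ (quot a b m).im = 0 := by
  obtain ⟨s, t, hs, ht, h1, rfl⟩ := hm
  obtain rfl : s = 1 - t := by linarith
  have hne : (toC b - toC a) ≠ 0 := toC_sub_ne hab
  have htc : (t : ℂ) ≠ 0 := by exact_mod_cast ht.ne'
  have he : toC ((1 - t) • a + t • b) = (1 - t : ℝ) * toC a + t * toC b := by
    apply Complex.ext <;> simp [toC]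
  have : quot a b ((1 - t) • a + t • b) = ((-((1 - t) / t) : ℝ) : ℂ) := by
    rw [quot, he]
    have e1 : toC b - ((1 - t : ℝ) * toC a + t * toC b) = (1 - t : ℝ) * (toC b - toC a) := by
      push_cast; ring
    have e2 : toC a - ((1 - t : ℝ) * toC a + t * toC b) = -t * (toC b - toC a) := by
      push_cast; ring
    rw [e1, e2]; push_cast; field_simp
  rw [this]
  refine ⟨?_, Complex.ofReal_im _⟩
  rw [Complex.ofReal_re]
  have := div_pos hs ht
  linarith

/-- Crossing a segment changes the angle under which it is seen by a full turn. -/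
lemma ang_jump {σ : ℝ} (hσ : σ ≠ 0) {a b m : ℝ × ℝ} (hab : a ≠ b) (hm : m ∈ openSegment ℝ a b)
    {g : ℝ × ℝ → ℝ} (hg : ContinuousAt g m) {δ c : ℝ} (hδ : 0 < δ)
    (h1 : ∀ z ∈ halfBall σ a b m δ, ang a b z + g z = c)
    (h2 : ∀ z ∈ halfBall σ b a m δ, ang a b z + g z = c) : False := by
  obtain ⟨hre, him⟩ := exists_quot_eq hab hm
  have hma := (ne_of_mem_openSegment hab hm).1
  have hq := (continuousAt_quot (b := b) hma).tendsto
  have hcr : ∀ σ, cr σ a b m = 0 := fun σ =>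
    cr_eq_zero_of_mem_segment (openSegment_subset_segment _ _ _ hm)
  -- the two one-sided limits
  have side : ∀ σ : ℝ, σ ≠ 0 → ∀ T : Set ℂ, (∀ z, 0 < cr σ a b z → quot a b z ∈ T) → ∀ θ,
      Filter.Tendsto Complex.arg (nhdsWithin (quot a b m) T) (nhds θ) →
      (∀ z ∈ halfBall σ a b m δ, ang a b z + g z = c) → θ + g m = c := by
    intro σ hσ T hT θ hθ hc
    have hne : (nhdsWithin m (halfBall σ a b m δ)).NeBot :=
      mem_closure_iff_nhdsWithin_neBot.mp (mem_closure_halfBall hσ hab (hcr σ) hδ)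
    have t1 : Filter.Tendsto (quot a b) (nhdsWithin m (halfBall σ a b m δ))
        (nhdsWithin (quot a b m) T) :=
      tendsto_nhdsWithin_iff.mpr ⟨hq.mono_left nhdsWithin_le_nhds,
        Filter.eventually_of_mem self_mem_nhdsWithin fun z hz => hT z hz.2⟩
    have t2 := (hθ.comp t1).add (hg.tendsto.mono_left nhdsWithin_le_nhds)
    refine tendsto_nhds_unique t2 (tendsto_const_nhds.congr' ?_)
    filter_upwards [self_mem_nhdsWithin] with z hz
    exact (hc z hz).symm
  have hpos := Complex.tendsto_arg_nhdsWithin_im_nonneg_of_re_neg_of_im_zero hre him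
  have hneg := Complex.tendsto_arg_nhdsWithin_im_neg_of_re_neg_of_im_zero hre him
  have him1 : ∀ z, 0 < cr 1 a b z → quot a b z ∈ {z : ℂ | 0 ≤ z.im} := fun z hz => by
    show 0 ≤ (quot a b z).im
    rw [quot_im]; exact div_nonneg hz.le (Complex.normSq_nonneg _)
  have him2 : ∀ z, 0 < cr (-1) a b z → quot a b z ∈ {z : ℂ | z.im < 0} := fun z hz => by
    rw [cr_neg, cr_swap] at hz
    have hza : z ≠ a := by rintro rfl; simp at hz
    show (quot a b z).im < 0
    rw [quot_im]; exact div_neg_of_neg_of_pos (by linarith) (normSq_toC_sub_pos hza)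
  have hscale : ∀ τ : ℝ, 0 < τ → ∀ x y : ℝ × ℝ,
      (∀ z, 0 < cr τ x y z ↔ 0 < cr 1 x y z) := by
    intro τ hτ x y z
    have : cr τ x y z = τ * cr 1 x y z := by unfold cr; ring
    rw [this]; exact mul_pos_iff_of_pos_left hτ
  have hall : (∀ z ∈ halfBall 1 a b m δ, ang a b z + g z = c) ∧
      (∀ z ∈ halfBall (-1) a b m δ, ang a b z + g z = c) := by
    rcases lt_or_gt_of_ne hσ with hs | hs
    · refine ⟨fun z hz => h2 z ⟨hz.1, ?_⟩, fun z hz => h1 z ⟨hz.1, ?_⟩⟩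
      · rw [← neg_neg σ, cr_neg, hscale _ (by linarith)]; exact hz.2
      · have := hz.2
        rw [cr_neg] at this
        rw [← neg_neg σ, cr_neg, hscale _ (by linarith)]; exact this
    · refine ⟨fun z hz => h1 z ⟨hz.1, ?_⟩, fun z hz => h2 z ⟨hz.1, ?_⟩⟩
      · rw [hscale _ hs]; exact hz.2
      · have := hz.2
        rw [cr_neg] at this
        rw [hscale _ hs]; exact this
  have e1 := side 1 (by norm_num) _ him1 _ hpos hall.1
  have e2 := side (-1) (by norm_num) _ him2 _ hneg hall.2
  have := Real.pi_pos
  linarith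

lemma exists_ball_avoiding {G : PlaneGraph} (hG : G.IsEmbedded) {a b m : ℝ × ℝ}
    (h : G.Adj a b) (hm : m ∈ openSegment ℝ a b) :
    ∃ δ > 0, ∀ z ∈ Metric.ball m δ, ∀ x y, G.Adj x y → ({x, y} : Set (ℝ × ℝ)) ≠ {a, b} →
      z ∉ segment ℝ x y := by
  obtain ⟨h1, h2⟩ := ne_of_mem_openSegment (Adj_ne h) hm
  have hmem : m ∈ (G.deleteEdge a b).drawingᶜ := by
    rintro ⟨p, q, ⟨hpq, hne⟩, hx⟩
    rcases hG.1 a b p q h hpq m (openSegment_subset_segment _ _ _ hm) hx with h' | ⟨h', -⟩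
    · rcases pair_eq_cases h' with h' | h' <;> exact hne (by tauto)
    · rcases h' with h' | h'
      · exact h1 h'
      · exact h2 h'
  obtain ⟨δ, hδ, hs⟩ := Metric.isOpen_iff.mp (isOpen_compl_drawing _) m hmem
  refine ⟨δ, hδ, fun z hz x y hxy hne hzs => hs hz ⟨x, y, ⟨hxy, ?_⟩, hzs⟩⟩
  rintro (⟨rfl, rfl⟩ | ⟨rfl, rfl⟩)
  · exact hne rfl
  · exact hne (Set.pair_comm _ _)

/-- The angle swept along `Z` as seen from the barycentre of the triangle `p q c`. -/
def faceWind (Z : List (ℝ × ℝ)) (p q c : ℝ × ℝ) : ℝ := windL Z ((1 / 3 : ℝ) • (p + q + c))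

lemma faceWind_rot (Z : List (ℝ × ℝ)) (p q c : ℝ × ℝ) : faceWind Z q c p = faceWind Z p q c := by
  unfold faceWind; congr 2; abel

lemma barycenter_mem_tri {σ : ℝ} {p q c : ℝ × ℝ} (h : 0 < cr σ p q c) :
    (1 / 3 : ℝ) • (p + q + c) ∈ tri σ p q c := by
  have h1 : cr σ p q ((1 / 3 : ℝ) • (p + q + c)) = 1 / 3 * cr σ p q c := by
    simp [cr]; ring
  have h2 : cr σ q c ((1 / 3 : ℝ) • (p + q + c)) = 1 / 3 * cr σ p q c := by
    simp [cr]; ring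
  have h3 : cr σ c p ((1 / 3 : ℝ) • (p + q + c)) = 1 / 3 * cr σ p q c := by
    simp [cr]; ring
  exact ⟨by rw [h1]; linarith, by rw [h2]; linarith, by rw [h3]; linarith⟩

section Wind

variable {G : PlaneGraph} {σ : ℝ} {a : ℝ × ℝ} {l : List (ℝ × ℝ)}

lemma Face.windL_eq (hZ : ∀ x y, Adjc (a :: (l ++ [a])) x y → G.Adj x y) {p q c z : ℝ × ℝ}
    (h : Face G σ p q c) (hz : z ∈ tri σ p q c) :
    windL (a :: (l ++ [a])) z = faceWind (a :: (l ++ [a])) p q c :=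
  windL_eq_of_isPreconnected (convex_tri σ p q c).isPreconnected
    (fun z hz x y hxy hzs => h.2.2.2.2 z hz ⟨x, y, hZ x y hxy, hzs⟩) hz
    (barycenter_mem_tri h.2.2.2.1)

lemma Face.exists_halfBall (hZ : ∀ x y, Adjc (a :: (l ++ [a])) x y → G.Adj x y)
    {p q c m : ℝ × ℝ} (h : Face G σ p q c) (hm : m ∈ openSegment ℝ p q) :
    ∃ δ > 0, ∀ z ∈ halfBall σ p q m δ,
      windL (a :: (l ++ [a])) z = faceWind (a :: (l ++ [a])) p q c := by
  obtain ⟨δ, hδ, hs⟩ := halfBall_subset_tri h.2.2.2.1 hm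
  exact ⟨δ, hδ, fun z hz => h.windL_eq hZ (hs hz)⟩

lemma exists_halfBall_windL_zero (hσ : σ ≠ 0) (hG : G.IsEmbedded) (hI : G.InnerFacesTriangles)
    (hZ : ∀ x y, Adjc (a :: (l ++ [a])) x y → G.Adj x y) {p q m : ℝ × ℝ} (hpq : G.Adj p q)
    (h : ¬ ∃ c, Face G σ p q c) (hm : m ∈ openSegment ℝ p q) :
    ∃ δ > 0, ∀ z ∈ halfBall σ p q m δ, windL (a :: (l ++ [a])) z = 0 := by
  rcases face_or_halfBall_outer hG hI hσ hpq hm with h' | ⟨δ, hδ, hs⟩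
  · exact absurd h' h
  · refine ⟨δ, hδ, fun z hz => ?_⟩
    obtain ⟨h1, h2⟩ := hs hz
    exact windL_eq_zero_of_unbounded isPreconnected_connectedComponentIn h2
      (fun w hw x y hxy hws => connectedComponentIn_subset _ _ hw ⟨x, y, hZ x y hxy, hws⟩)
      (mem_connectedComponentIn h1)

/-- The swept angle does not change across an edge which is not on the polygon. -/
lemma windL_cross (hσ : σ ≠ 0) (hG : G.IsEmbedded)
    (hZ : ∀ x y, Adjc (a :: (l ++ [a])) x y → G.Adj x y) {p q m : ℝ × ℝ}
    (hpq : G.Adj p q) (hm : m ∈ openSegment ℝ p q)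
    (hne : ∀ x y, Adjc (a :: (l ++ [a])) x y → ({x, y} : Set (ℝ × ℝ)) ≠ {p, q})
    {δ₁ δ₂ c d : ℝ} (hδ₁ : 0 < δ₁) (hδ₂ : 0 < δ₂)
    (h1 : ∀ z ∈ halfBall σ p q m δ₁, windL (a :: (l ++ [a])) z = c)
    (h2 : ∀ z ∈ halfBall σ q p m δ₂, windL (a :: (l ++ [a])) z = d) : c = d := by
  obtain ⟨δ, hδ, hs⟩ := exists_ball_avoiding hG hpq hm
  have hcr : cr σ p q m = 0 := cr_eq_zero_of_mem_segment (openSegment_subset_segment _ _ _ hm)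
  have get : ∀ p q, p ≠ q → cr σ p q m = 0 → ∀ δ' > 0, ∃ z ∈ halfBall σ p q m δ',
      z ∈ Metric.ball m δ := by
    intro p q hpq h0 δ' hδ'
    have := mem_closure_halfBall hσ hpq h0 (lt_min hδ hδ')
    obtain ⟨z, hz⟩ := closure_nonempty_iff.mp ⟨m, this⟩
    exact ⟨z, ⟨Metric.ball_subset_ball (min_le_right _ _) hz.1, hz.2⟩,
      Metric.ball_subset_ball (min_le_left _ _) hz.1⟩
  obtain ⟨z, hz, hz'⟩ := get p q (Adj_ne hpq) hcr δ₁ hδ₁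
  obtain ⟨w, hw, hw'⟩ := get q p (Adj_ne hpq).symm (by rw [cr_swap, hcr, neg_zero]) δ₂ hδ₂
  rw [← h1 z hz, ← h2 w hw]
  exact windL_eq_of_isPreconnected (convex_ball m δ).isPreconnected
    (fun z hz x y hxy => hs z hz x y (hZ x y hxy) (hne x y hxy)) hz' hw'

lemma exists_mem_openSegment (p q : ℝ × ℝ) : ∃ m, m ∈ openSegment ℝ p q :=
  ⟨_, 1 / 2, 1 / 2, by norm_num, by norm_num, by norm_num, rfl⟩

lemma Face.wind_cross (hσ : σ ≠ 0) (hG : G.IsEmbedded)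
    (hZ : ∀ x y, Adjc (a :: (l ++ [a])) x y → G.Adj x y) {p q c d : ℝ × ℝ}
    (h1 : Face G σ p q c) (h2 : Face G σ q p d)
    (hne : ∀ x y, Adjc (a :: (l ++ [a])) x y → ({x, y} : Set (ℝ × ℝ)) ≠ {p, q}) :
    faceWind (a :: (l ++ [a])) p q c = faceWind (a :: (l ++ [a])) q p d := by
  obtain ⟨m, hm⟩ := exists_mem_openSegment p q
  obtain ⟨δ₁, hδ₁, h1'⟩ := h1.exists_halfBall hZ hm
  obtain ⟨δ₂, hδ₂, h2'⟩ := h2.exists_halfBall hZ (by rwa [openSegment_symm])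
  exact windL_cross hσ hG hZ h1.1 hm hne hδ₁ hδ₂ h1' h2'

lemma Face.wind_zero (hσ : σ ≠ 0) (hG : G.IsEmbedded) (hI : G.InnerFacesTriangles)
    (hZ : ∀ x y, Adjc (a :: (l ++ [a])) x y → G.Adj x y) {p q c : ℝ × ℝ}
    (h1 : Face G σ p q c) (h2 : ¬ ∃ d, Face G σ q p d)
    (hne : ∀ x y, Adjc (a :: (l ++ [a])) x y → ({x, y} : Set (ℝ × ℝ)) ≠ {p, q}) :
    faceWind (a :: (l ++ [a])) p q c = 0 := by
  obtain ⟨m, hm⟩ := exists_mem_openSegment p q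
  obtain ⟨δ₁, hδ₁, h1'⟩ := h1.exists_halfBall hZ hm
  obtain ⟨δ₂, hδ₂, h2'⟩ := exists_halfBall_windL_zero hσ hG hI hZ (G.symm _ _ h1.1) h2
    (by rwa [openSegment_symm])
  exact windL_cross hσ hG hZ h1.1 hm hne hδ₁ hδ₂ h1' h2'

lemma Face.wind_ne_zero (hσ : σ ≠ 0) (hG : G.IsEmbedded) (hI : G.InnerFacesTriangles)
    (hZ : ∀ x y, Adjc (a :: (l ++ [a])) x y → G.Adj x y) {p q c : ℝ × ℝ}
    {A E : List (ℝ × ℝ)} (hl : a :: (l ++ [a]) = A ++ p :: q :: E)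
    (hA : ∀ x y, Adjc (A ++ [p]) x y → ({x, y} : Set (ℝ × ℝ)) ≠ {p, q})
    (hE : ∀ x y, Adjc (q :: E) x y → ({x, y} : Set (ℝ × ℝ)) ≠ {p, q})
    (h1 : Face G σ p q c) (h2 : ¬ ∃ d, Face G σ q p d) :
    faceWind (a :: (l ++ [a])) p q c ≠ 0 := by
  intro h0
  obtain ⟨m, hm⟩ := exists_mem_openSegment p q
  obtain ⟨δ₁, hδ₁, h1'⟩ := h1.exists_halfBall hZ hm
  obtain ⟨δ₂, hδ₂, h2'⟩ := exists_halfBall_windL_zero hσ hG hI hZ (G.symm _ _ h1.1) h2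
    (by rwa [openSegment_symm])
  obtain ⟨δ, hδ, hs⟩ := exists_ball_avoiding hG h1.1 hm
  rw [h0] at h1'
  have hw : ∀ z, windL (a :: (l ++ [a])) z =
      ang p q z + (windL (A ++ [p]) z + windL (q :: E) z) := by
    intro z
    rw [hl, windL_append_cons, windL_cons_cons]; ring
  have hZ' : ∀ x y, Adjc (A ++ [p]) x y ∨ Adjc (q :: E) x y → G.Adj x y := by
    intro x y h
    apply hZ
    rw [hl, adjc_append_cons, adjc_cons_cons]; tauto
  have hg : ContinuousAt (fun z => windL (A ++ [p]) z + windL (q :: E) z) m :=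
    (continuousAt_windL fun x y h => hs m (Metric.mem_ball_self hδ) x y (hZ' x y (.inl h))
      (hA x y h)).add
    (continuousAt_windL fun x y h => hs m (Metric.mem_ball_self hδ) x y (hZ' x y (.inr h))
      (hE x y h))
  refine ang_jump hσ (Adj_ne h1.1) hm hg (lt_min hδ₁ hδ₂) (c := 0) ?_ ?_
  · intro z hz
    rw [← hw]
    exact h1' z ⟨Metric.ball_subset_ball (min_le_left _ _) hz.1, hz.2⟩
  · intro z hz
    rw [← hw]
    exact h2' z ⟨Metric.ball_subset_ball (min_le_right _ _) hz.1, hz.2⟩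

end Wind

lemma adjc_induction {α : Type*} {Q : α → α → Prop} {l : List α} {p : α}
    (h0 : ∀ t, Adjc (p :: l) p t → Q p t)
    (hs : ∀ s t t', Adjc (p :: l) s t → Adjc (p :: l) t t' → Q s t → Q t t') :
    ∀ s t, Adjc (p :: l) s t → Q s t := by
  induction l generalizing p with
  | nil => simp
  | cons r l ih =>
    intro s t h
    have hpr := h0 r (by simp)
    rcases h with ⟨rfl, rfl⟩ | h
    · exact hpr
    · exact ih (fun t ht => hs p r t (by simp) (by simp [ht]) hpr)
        (fun s t t' h1 h2 => hs s t t' (by simp [h1]) (by simp [h2])) s t h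

lemma nx_unique {α : Type*} {L : List α} (hL : L.Nodup) {p p' v : α} (h : Nx L p v)
    (h' : Nx L p' v) : p = p' := by
  obtain ⟨A, B, rfl⟩ := List.append_of_mem h.mem.2
  rw [nx_append_comm] at h h'
  have hnd := List.nodup_append_comm.mp hL
  rw [List.cons_append] at h h' hnd
  rcases List.eq_nil_or_concat (B ++ A) with hE | ⟨C, r, hE⟩
  · rw [hE] at h h'
    simp [nx_cons] at h h'
    rw [h, h']
  · rw [hE, List.concat_eq_append] at h h' hnd
    have hv := (List.nodup_cons.mp hnd).1
    rw [eq_of_nx_head hv h, eq_of_nx_head hv h']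

/-- A property of the swept angle that holds for the first face at a boundary vertex holds for
all faces there, if no inner edge at this vertex is on the polygon. -/
lemma Disk.fan_induction {G : PlaneGraph} {σ : ℝ} (hσ : σ ≠ 0) {L : List (ℝ × ℝ)}
    (D : Disk G σ L) (h3 : 3 ≤ L.length) {v : ℝ × ℝ} (hv : v ∈ L) {a : ℝ × ℝ}
    {l : List (ℝ × ℝ)} (hZ : ∀ x y, Adjc (a :: (l ++ [a])) x y → G.Adj x y)
    (hvZ : ∀ s, Adjc (a :: (l ++ [a])) v s ∨ Adjc (a :: (l ++ [a])) s v → Nx L v s ∨ Nx L s v)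
    (Q : ℝ → Prop) (h0 : ∀ p t, Nx L p v → Face G σ p v t → Q (faceWind (a :: (l ++ [a])) p v t))
    {s t : ℝ × ℝ} (hst : Face G σ v t s) : Q (faceWind (a :: (l ++ [a])) v t s) := by
  obtain ⟨A, B, q, R, p, rfl, hBA, -⟩ := exists_nx_decomp h3 hv
  have D' := D.rotate
  have hnx : ∀ x y, Nx (A ++ B) x y ↔ Nx (v :: q :: (R ++ [p])) x y := fun x y => by
    rw [nx_append_comm, hBA]
  rw [hBA] at D'
  obtain ⟨M, hF⟩ := D'.exists_fan'
  have hpv : Nx (A ++ B) p v := by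
    rw [hnx, nx_cons]
    have : v :: (q :: (R ++ [p]) ++ [v]) = (v :: q :: R) ++ p :: [v] := by simp
    rw [this, adjc_append_cons]; simp
  refine adjc_induction (Q := fun s t => Q (faceWind (a :: (l ++ [a])) v t s)) ?_ ?_ s t
    ((hF.adjc_iff s t).mpr hst)
  · intro t ht
    have := (hF.adjc_iff _ _).mp ht
    rw [← faceWind_rot, ← faceWind_rot]
    exact h0 p t hpv this.rot.rot
  · intro s t t' h1 h2 hQ
    have f1 := (hF.adjc_iff _ _).mp h1
    have f2 := (hF.adjc_iff _ _).mp h2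
    have n1 := (D.face_iff _ _ f1.1).mp ⟨_, f1⟩
    have n2 := (D.face_iff _ _ f2.rot.rot.1).mp ⟨_, f2.rot.rot⟩
    have := f1.wind_cross hσ D.emb hZ f2.rot.rot (fun x y hxy hpair => by
      rcases pair_eq_cases hpair with ⟨rfl, rfl⟩ | ⟨rfl, rfl⟩
      · rcases hvZ _ (.inl hxy) with h | h <;> tauto
      · rcases hvZ _ (.inr hxy) with h | h <;> tauto)
    rw [this, ← faceWind_rot] at hQ
    exact hQ

lemma nx_append_cons {α : Type*} (a b : α) (X Y : List α) (x y : α) :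
    Nx (a :: X ++ b :: Y) x y ↔ Adjc (a :: X ++ [b]) x y ∨ Adjc (b :: (Y ++ [a])) x y := by
  rw [List.cons_append, nx_cons, ← adjc_append_cons]; simp

/-- Two chords of a disk do not cross. -/
lemma Disk.not_adj_of_chord {G : PlaneGraph} {σ : ℝ} (hσ : σ ≠ 0) {a b x y : ℝ × ℝ}
    {X Y : List (ℝ × ℝ)} (D : Disk G σ (a :: X ++ b :: Y)) (hab : G.Adj b a) (hx : x ∈ X)
    (hy : y ∈ Y) : ¬ G.Adj x y := by
  intro hxy
  have hnd := D.nodup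
  obtain ⟨X1, X2, rfl⟩ := List.append_of_mem hx
  have h3 : 3 ≤ (a :: (X1 ++ x :: X2) ++ b :: Y).length := by simp; omega
  set L := a :: (X1 ++ x :: X2) ++ b :: Y with hL
  rw [hL] at hnd
  simp only [List.cons_append, List.nodup_cons, List.nodup_append, List.mem_append, List.mem_cons,
    not_or, List.append_assoc] at hnd
  have hxa : x ≠ a := by grind
  have hxb : x ≠ b := by grind
  have hxY : x ∉ Y := by grind
  have hxX1 : x ∉ X1 := by grind
  have hxX2 : x ∉ X2 := by grind
  have hyZ : y ∉ a :: (X1 ++ x :: X2) ++ [b] := by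
    simp only [List.cons_append, List.mem_append, List.mem_cons, List.append_assoc]
    grind
  have hZ' : ∀ r s, Adjc (a :: ((X1 ++ x :: X2 ++ [b]) ++ [a])) r s ↔
      Adjc (a :: (X1 ++ x :: X2) ++ [b]) r s ∨ (r = b ∧ s = a) := by
    intro r s
    have : a :: ((X1 ++ x :: X2 ++ [b]) ++ [a]) = (a :: (X1 ++ x :: X2)) ++ b :: [a] := by simp
    rw [this, adjc_append_cons]; simp
  have hyZ' : y ∉ a :: ((X1 ++ x :: X2 ++ [b]) ++ [a]) := by
    simp at hyZ ⊢; tauto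
  have hnx : ∀ r s, Nx L r s ↔ _ := nx_append_cons a b (X1 ++ x :: X2) Y
  have hZ : ∀ r s, Adjc (a :: ((X1 ++ x :: X2 ++ [b]) ++ [a])) r s → G.Adj r s := by
    intro r s h
    rcases (hZ' r s).mp h with h | ⟨rfl, rfl⟩
    · exact D.adj _ _ ((hnx r s).mpr (.inl h))
    · exact hab
  have n1 : ¬ Nx L y x := by
    rw [hnx]
    rintro (h | h)
    · exact hyZ h.mem.1
    · have := h.mem_right; simp [hxa, hxb, hxY] at this
  obtain ⟨c, hc⟩ := (D.face_iff x y hxy).mpr n1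
  have hwx : faceWind (a :: ((X1 ++ x :: X2 ++ [b]) ++ [a])) x y c ≠ 0 := by
    refine D.fan_induction hσ h3 (by simp [hL]) hZ ?_ (· ≠ 0) ?_ hc
    · intro s h
      rw [hZ', hZ'] at h
      rw [hnx, hnx]; tauto
    · intro p t hp hf
      obtain ⟨A, p', hA⟩ : ∃ A p', a :: X1 = A ++ [p'] := by
        rcases List.eq_nil_or_concat (a :: X1) with h | ⟨A, p', h⟩
        · simp at h
        · exact ⟨A, p', by simpa using h⟩
      have hp' : Nx L p' x := by
        rw [hnx]
        left
        have : a :: (X1 ++ x :: X2) ++ [b] = A ++ p' :: (x :: (X2 ++ [b])) := by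
          rw [← List.cons_append, hA]; simp
        rw [this, adjc_append_cons]; simp
      obtain rfl := nx_unique D.nodup hp hp'
      have hxA : x ∉ A ++ [p] := by rw [← hA]; simp [hxa, hxX1]
      have hxE : x ∉ X2 ++ [b] ++ [a] := by simp [hxa, hxb, hxX2]
      refine hf.wind_ne_zero hσ D.emb D.inner hZ (A := A) (E := X2 ++ [b] ++ [a])
        (by have : a :: (X1 ++ x :: X2 ++ [b] ++ [a]) = (a :: X1) ++ x :: (X2 ++ [b] ++ [a]) := by
              simp
            rw [this, hA]; simp) ?_ ?_
        (by rw [D.face_iff _ _ (G.symm _ _ (D.adj _ _ hp))]; simpa using hp)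
      · intro r s h hpair
        rcases pair_eq_cases hpair with ⟨rfl, rfl⟩ | ⟨rfl, rfl⟩
        · exact hxA h.mem_right
        · exact hxA h.mem.1
      · intro r s h hpair
        rcases pair_eq_cases hpair with ⟨rfl, rfl⟩ | ⟨rfl, rfl⟩
        · exact hxE h.mem.2
        · have hpX : s ∈ a :: X1 := by rw [hA]; simp
          have key : ∀ q A', X2 ++ [b] = q :: A' → False := by
            intro q A' he
            have hq : q ∈ X2 ++ [b] := by rw [he]; simp
            rw [he, List.cons_append] at h hxE
            have hsq : s = q := eq_of_nx_head' hxE (by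
              rw [nx_cons]
              have : r :: (q :: (A' ++ [a]) ++ [r]) = (r :: q :: A') ++ a :: [r] := by simp
              rw [this, adjc_append_cons]
              left; simpa using h)
            subst hsq
            simp at hpX hq
            grind
          cases hX : X2 ++ [b] with
          | nil => simp at hX
          | cons q A' => exact key q A' hX
  have hwy : faceWind (a :: ((X1 ++ x :: X2 ++ [b]) ++ [a])) y c x = 0 := by
    refine D.fan_induction hσ h3 (by simp [hL, hy]) hZ ?_ (· = 0) ?_ hc.rot
    · rintro s (h | h)
      · exact absurd h.mem.1 hyZ'
      · exact absurd h.mem_right hyZ'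
    · intro p t hp hf
      refine hf.wind_zero hσ D.emb D.inner hZ
        (by rw [D.face_iff _ _ (G.symm _ _ (D.adj _ _ hp))]; simpa using hp) ?_
      intro r s h hpair
      rcases pair_eq_cases hpair with ⟨rfl, rfl⟩ | ⟨rfl, rfl⟩
      · exact hyZ' h.mem_right
      · exact hyZ' h.mem.1
  rw [faceWind_rot] at hwy
  exact hwx hwy

/-- A chord (or boundary edge) `a b` cuts off a boundary path on which some vertex is not on any
chord. -/
lemma Disk.exists_chordless {G : PlaneGraph} {σ : ℝ} (hσ : σ ≠ 0) {a b : ℝ × ℝ}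
    {N Y : List (ℝ × ℝ)} (D : Disk G σ (a :: N ++ b :: Y)) (hab : G.Adj b a) (hN : N ≠ []) :
    ∃ x ∈ N, ∀ y ∈ a :: N ++ b :: Y, G.Adj x y →
      Nx (a :: N ++ b :: Y) x y ∨ Nx (a :: N ++ b :: Y) y x := by
  induction hn : N.length using Nat.strong_induction_on generalizing N Y a b with
  | _ n ih =>
    obtain ⟨x, N', rfl⟩ := List.exists_cons_of_ne_nil hN
    by_cases hx : ∀ y ∈ a :: (x :: N') ++ b :: Y, G.Adj x y →
        Nx (a :: (x :: N') ++ b :: Y) x y ∨ Nx (a :: (x :: N') ++ b :: Y) y x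
    · exact ⟨x, by simp, hx⟩
    push Not at hx
    obtain ⟨y, hy, hxy, h1, h2⟩ := hx
    have hya : y ≠ a := by
      rintro rfl; apply h2; rw [nx_append_cons]; simp
    have hyx : y ≠ x := (Adj_ne hxy).symm
    have hyY : y ∉ Y := fun h => D.not_adj_of_chord hσ hab (by simp) h hxy
    have hyN : y ∈ N' ++ [b] := by simp at hy ⊢; tauto
    obtain ⟨Z1, Z2, hZ⟩ := List.append_of_mem hyN
    have hZ1 : Z1 ≠ [] := by
      rintro rfl
      apply h1
      rw [nx_append_cons]
      left
      rw [List.cons_append, List.cons_append, hZ]; simp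
    have hL : a :: (x :: N') ++ b :: Y = [a] ++ (x :: Z1 ++ y :: (Z2 ++ Y)) := by
      have : N' ++ b :: Y = (N' ++ [b]) ++ Y := by simp
      simp only [List.cons_append]
      rw [this, hZ]; simp
    have hsub : ∀ z ∈ Z1, z ∈ N' := by
      rcases List.eq_nil_or_concat Z2 with rfl | ⟨Z2', b', rfl⟩
      · have := List.append_inj_left' hZ (by simp)
        subst this; simp
      · rw [List.concat_eq_append, ← List.cons_append, ← List.append_assoc] at hZ
        have := List.append_inj_left' hZ (by simp)
        subst this; simp; tauto
    have hlen : Z1.length < n := by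
      have := congrArg List.length hZ
      simp at this hn; omega
    have D' := D
    rw [hL] at D'
    have D' := D'.rotate
    rw [List.append_assoc, List.cons_append] at D'
    obtain ⟨x', hx', h⟩ := ih _ hlen D' (G.symm _ _ hxy) hZ1 rfl
    refine ⟨x', by simp [hsub x' hx'], fun w hw haw => ?_⟩
    have := h w (by
      rw [hL] at hw
      simp at hw ⊢; tauto) haw
    rw [hL, nx_append_comm, nx_append_comm [a]]
    simpa using this

/-! ### Convex polygons -/

/-- The points `P x`, for `x` on the list `L`, are the vertices of a strictly convex polygon, in
counterclockwise order. -/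
def ConvPos (P : ℝ × ℝ → ℝ × ℝ) (L : List (ℝ × ℝ)) : Prop :=
  L.Triplewise fun a b c => 0 < cr 1 (P a) (P b) (P c)

lemma ConvPos.rotate {P : ℝ × ℝ → ℝ × ℝ} {A B : List (ℝ × ℝ)} (h : ConvPos P (A ++ B)) :
    ConvPos P (B ++ A) := by
  unfold ConvPos at h ⊢
  rw [List.triplewise_append] at h ⊢
  obtain ⟨h1, h2, h3, h4⟩ := h
  refine ⟨h2, h1, fun b hb => (h4 b hb).imp fun {x y} hxy => ?_, fun a ha =>
    (h3 a ha).imp fun {x y} hxy => ?_⟩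
  · rwa [← cr_rot]
  · rwa [cr_rot]

lemma exists_rotation_of_nx {α : Type*} {L : List α} (hL : L.Nodup) {a b : α} (h : Nx L a b) :
    ∃ A B E, L = A ++ B ∧ B ++ A = a :: E ∧ (a ≠ b → ∃ E', E = b :: E') := by
  obtain ⟨A, B, rfl⟩ := List.append_of_mem h.mem.1
  refine ⟨A, a :: B, B ++ A, rfl, rfl, fun hab => ?_⟩
  rw [nx_append_comm] at h
  have hnd := List.nodup_append_comm.mp hL
  rw [List.cons_append] at h hnd
  cases hE : B ++ A with
  | nil => rw [hE] at h; simp [nx_cons] at h; exact absurd h.symm hab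
  | cons q C =>
    rw [hE] at h hnd
    exact ⟨C, by rw [eq_of_nx_head' (List.nodup_cons.mp hnd).1 h]⟩

lemma ConvPos.nonneg {P : ℝ × ℝ → ℝ × ℝ} {L : List (ℝ × ℝ)} (h : ConvPos P L) (hL : L.Nodup)
    {a b c : ℝ × ℝ} (hab : Nx L a b) (hc : c ∈ L) : 0 ≤ cr 1 (P a) (P b) (P c) := by
  by_cases hne : a = b
  · simp [hne]
  obtain ⟨A, B, E, rfl, hE, hE'⟩ := exists_rotation_of_nx hL hab
  obtain ⟨E', rfl⟩ := hE' hne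
  have h := h.rotate
  have hc : c ∈ B ++ A := by simp at hc ⊢; tauto
  rw [hE] at h hc
  simp only [List.mem_cons] at hc
  rcases hc with rfl | rfl | hc
  · simp
  · simp
  · have := (List.triplewise_cons.mp h).1
    exact ((List.pairwise_cons.mp this).1 c hc).le

lemma ConvPos.nonneg_of_mem {P : ℝ × ℝ → ℝ × ℝ} {L : List (ℝ × ℝ)} (h : ConvPos P L)
    (hL : L.Nodup) {a b z : ℝ × ℝ} (hab : Nx L a b) (hz : z ∈ convexHull ℝ (P '' {x | x ∈ L})) :
    0 ≤ cr 1 (P a) (P b) z := by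
  have : convexHull ℝ (P '' {x | x ∈ L}) ⊆ {z | 0 ≤ cr 1 (P a) (P b) z} := by
    refine convexHull_min ?_ (convex_cr_nonneg _ _ _)
    rintro _ ⟨c, hc, rfl⟩
    exact h.nonneg hL hab hc
  exact this hz

lemma exists_convPos {L : List (ℝ × ℝ)} (hL : L.Nodup) : ∃ P, ConvPos P L := by
  refine ⟨fun x => ((L.idxOf x : ℝ), (L.idxOf x : ℝ) ^ 2), ?_⟩
  unfold ConvPos
  rw [List.triplewise_iff_getElem]
  intro i j k hij hjk hk
  beta_reduce
  rw [hL.idxOf_getElem, hL.idxOf_getElem, hL.idxOf_getElem]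
  have h1 : (i : ℝ) < j := by exact_mod_cast hij
  have h2 : (j : ℝ) < k := by exact_mod_cast hjk
  have : cr 1 ((i : ℝ), (i : ℝ) ^ 2) ((j : ℝ), (j : ℝ) ^ 2) ((k : ℝ), (k : ℝ) ^ 2) =
      ((j : ℝ) - i) * (k - i) * (k - j) := by simp only [cr]; ring
  rw [this]
  have e1 : (0 : ℝ) < j - i := by linarith
  have e2 : (0 : ℝ) < k - i := by linarith
  have e3 : (0 : ℝ) < k - j := by linarith
  positivity

/-- The quadratic Bézier curve with control points `p`, `v`, `q`. -/
def bez (p v q : ℝ × ℝ) (s : ℝ) : ℝ × ℝ :=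
  (1 - s) ^ 2 • p + (2 * s * (1 - s)) • v + s ^ 2 • q

lemma cr_bez_two (p v q c : ℝ × ℝ) (s t : ℝ) :
    cr 1 (bez p v q s) (bez p v q t) c = (t - s) * (2 * (1 - s) * (1 - t) * cr 1 p v c +
      2 * s * t * cr 1 v q c + (s * (1 - t) + t * (1 - s)) * cr 1 p q c) := by
  simp only [cr, bez, Prod.fst_add, Prod.snd_add, Prod.smul_fst, Prod.smul_snd, smul_eq_mul]
  ring

lemma cr_bez_one (p v q c d : ℝ × ℝ) (s : ℝ) :
    cr 1 (bez p v q s) c d = (1 - s) ^ 2 * cr 1 p c d + 2 * s * (1 - s) * cr 1 v c d +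
      s ^ 2 * cr 1 q c d := by
  simp only [cr, bez, Prod.fst_add, Prod.snd_add, Prod.smul_fst, Prod.smul_snd, smul_eq_mul]
  ring

lemma cr_bez_three (p v q : ℝ × ℝ) (s t r : ℝ) :
    cr 1 (bez p v q s) (bez p v q t) (bez p v q r) =
      2 * (t - s) * (r - t) * (r - s) * cr 1 p v q := by
  simp only [cr, bez, Prod.fst_add, Prod.snd_add, Prod.smul_fst, Prod.smul_snd, smul_eq_mul]
  ring

lemma bez_mem_convexHull {S : Set (ℝ × ℝ)} {p v q : ℝ × ℝ} (hp : p ∈ S) (hv : v ∈ S) (hq : q ∈ S)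
    {s : ℝ} (h0 : 0 ≤ s) (h1 : s ≤ 1) : bez p v q s ∈ convexHull ℝ S := by
  have hc := convex_convexHull ℝ S
  have e : bez p v q s = (1 - s) • ((1 - s) • p + s • v) + s • ((1 - s) • v + s • q) := by
    ext <;> simp [bez] <;> ring
  have hs : 0 ≤ 1 - s := by linarith
  rw [e]
  exact hc (hc (subset_convexHull ℝ S hp) (subset_convexHull ℝ S hv) hs h0 (by ring))
    (hc (subset_convexHull ℝ S hv) (subset_convexHull ℝ S hq) hs h0 (by ring)) hs h0 (by ring)

lemma exists_param {α : Type*} {M : List α} {p q : α} (h : (p :: (M ++ [q])).Nodup) :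
    ∃ s : α → ℝ, s p = 0 ∧ s q = 1 ∧ (p :: (M ++ [q])).Pairwise (fun x y => s x < s y) := by
  have hlen : (p :: (M ++ [q])).length = M.length + 2 := by simp
  set F := p :: (M ++ [q]) with hF
  have hk : (0 : ℝ) < M.length + 1 := by positivity
  refine ⟨fun x => (F.idxOf x : ℝ) / (M.length + 1), ?_, ?_, ?_⟩
  · simp [hF]
  · have : F.idxOf q = M.length + 1 := by
      have e : F[M.length + 1]'(by omega) = q := by simp [hF]
      rw [← e, h.idxOf_getElem]
    simp only [this]; push_cast; field_simp
  · rw [List.pairwise_iff_getElem]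
    intro i j hi hj hij
    beta_reduce
    rw [h.idxOf_getElem, h.idxOf_getElem]
    have : (i : ℝ) < j := by exact_mod_cast hij
    gcongr

lemma Adjc.of_pairwise {α : Type*} {r : α → α → Prop} {l : List α} (h : l.Pairwise r) {a b : α}
    (hab : Adjc l a b) : r a b := by
  induction l with
  | nil => simp at hab
  | cons c l ih =>
    cases l with
    | nil => simp at hab
    | cons d l =>
      rw [adjc_cons_cons] at hab
      rw [List.pairwise_cons] at h
      rcases hab with ⟨rfl, rfl⟩ | hab
      · exact h.1 _ (by simp)
      · exact ih h.2 hab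

/-- Replace the corner `v` of a strictly convex polygon by a convex chain of prescribed length. -/
lemma ConvPos.exists_cut {P : ℝ × ℝ → ℝ × ℝ} {v p q : ℝ × ℝ} {R M : List (ℝ × ℝ)}
    (h : ConvPos P (v :: q :: (R ++ [p]))) (hF : (p :: (M ++ [q])).Nodup)
    (hM : ∀ x ∈ M, x ∉ R) (hR : (q :: (R ++ [p])).Nodup) :
    ∃ P' : ℝ × ℝ → ℝ × ℝ, (∀ x ∈ q :: (R ++ [p]), P' x = P x) ∧
      ConvPos P' (q :: (R ++ [p]) ++ M) ∧
      (∀ x ∈ M, P' x ∈ convexHull ℝ {P p, P v, P q}) ∧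
      (p :: (M ++ [q])).Pairwise (fun a b => 0 < cr 1 (P v) (P' b) (P' a)) := by
  obtain ⟨s, hs0, hs1, hs⟩ := exists_param hF
  set F := p :: (M ++ [q]) with hFd
  set P' : ℝ × ℝ → ℝ × ℝ := fun x => if x ∈ F then bez (P p) (P v) (P q) (s x) else P x with hP'
  have h01 : ∀ x ∈ F, 0 ≤ s x ∧ s x ≤ 1 := by
    intro x hx
    rw [hFd, List.pairwise_cons] at hs
    obtain ⟨h1, h2⟩ := hs
    rw [List.pairwise_append] at h2
    simp [hFd] at hx
    constructor
    · rcases hx with rfl | hx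
      · rw [hs0]
      · rw [← hs0]; exact (h1 x (by simpa using hx)).le
    · rcases hx with rfl | hx | rfl
      · rw [hs0]; norm_num
      · rw [← hs1]; exact (h2.2.2 x hx q (by simp)).le
      · rw [hs1]
  have hF' : ∀ x ∈ F, P' x = bez (P p) (P v) (P q) (s x) := fun x hx => if_pos hx
  have hPp : P' p = P p := by
    rw [hF' p (by simp [hFd]), hs0]; simp [bez]
  have hPq : P' q = P q := by
    rw [hF' q (by simp [hFd]), hs1]; simp [bez]
  have hPR : ∀ x ∈ R, P' x = P x := by
    intro x hx
    refine if_neg ?_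
    intro hxF
    simp only [hFd, List.mem_cons, List.mem_append] at hxF
    simp only [List.nodup_cons, List.nodup_append, List.mem_append, List.mem_cons] at hR
    grind
  unfold ConvPos at h
  rw [List.triplewise_cons, List.triplewise_cons, List.pairwise_cons, List.pairwise_append,
    List.pairwise_append, List.triplewise_append] at h
  obtain ⟨⟨hvq, hvR, -, hvRp⟩, ⟨hqR, -, hqRp⟩, hRR, -, -, hRp⟩ := h
  have hpvq : 0 < cr 1 (P p) (P v) (P q) := by
    rw [← cr_rot]; exact hvq p (by simp)
  refine ⟨P', ?_, ?_, ?_, ?_⟩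
  · intro x hx
    simp at hx
    rcases hx with rfl | hx | rfl
    · exact hPq
    · exact hPR x hx
    · exact hPp
  · have hrot : ConvPos P' (R ++ F) := by
      unfold ConvPos
      rw [List.triplewise_append]
      refine ⟨?_, ?_, ?_, ?_⟩
      · rw [List.triplewise_iff_getElem] at hRR ⊢
        intro i j k hij hjk hk
        rw [hPR _ (List.getElem_mem _), hPR _ (List.getElem_mem _), hPR _ (List.getElem_mem _)]
        exact hRR i j k hij hjk hk
      · rw [List.triplewise_iff_getElem]
        intro i j k hij hjk hk
        rw [hF' _ (List.getElem_mem _), hF' _ (List.getElem_mem _), hF' _ (List.getElem_mem _),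
          cr_bez_three]
        rw [List.pairwise_iff_getElem] at hs
        have e1 := sub_pos.mpr (hs i j (by omega) (by omega) hij)
        have e2 := sub_pos.mpr (hs j k (by omega) (by omega) hjk)
        have e3 := sub_pos.mpr (hs i k (by omega) (by omega) (by omega))
        positivity
      · intro c hc
        rw [List.pairwise_iff_getElem] at hs ⊢
        intro i j hi hj hij
        rw [cr_rot 1 _ _ _ |>.symm, hPR c hc, hF' _ (List.getElem_mem _),
          hF' _ (List.getElem_mem _), cr_bez_two]
        have e1 := sub_pos.mpr (hs i j hi hj hij)
        obtain ⟨a0, a1⟩ := h01 _ (List.getElem_mem hi)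
        obtain ⟨b0, b1⟩ := h01 _ (List.getElem_mem hj)
        have c1 : 0 < cr 1 (P p) (P v) (P c) := by
          rw [← cr_rot]; exact hvRp c hc p (by simp)
        have c2 : 0 < cr 1 (P v) (P q) (P c) := hvq c (by simp [hc])
        have c3 : 0 < cr 1 (P p) (P q) (P c) := by
          rw [← cr_rot]; exact hqRp c hc p (by simp)
        have d1 : 0 ≤ 1 - s F[i] := by linarith
        have d2 : 0 ≤ 1 - s F[j] := by linarith
        have d3 : 0 < s F[i] * (1 - s F[j]) + s F[j] * (1 - s F[i]) := by nlinarith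
        have t1 : 0 ≤ 2 * (1 - s F[i]) * (1 - s F[j]) * cr 1 (P p) (P v) (P c) := by positivity
        have t2 : 0 ≤ 2 * s F[i] * s F[j] * cr 1 (P v) (P q) (P c) := by positivity
        have t3 := mul_pos d3 c3
        exact mul_pos e1 (by linarith)
      · intro x hx
        rw [List.pairwise_iff_getElem]
        intro i j hi hj hij
        rw [hPR _ (List.getElem_mem _), hPR _ (List.getElem_mem _), ← cr_rot, ← cr_rot,
          hF' x hx, cr_bez_one]
        obtain ⟨a0, a1⟩ := h01 x hx
        have c1 : 0 < cr 1 (P p) (P R[i]) (P R[j]) := by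
          have := (List.pairwise_iff_getElem.mp (hRp p (by simp))) i j hi hj hij
          rwa [← cr_rot]
        have c2 := (List.pairwise_iff_getElem.mp hvR) i j hi hj hij
        have c3 := (List.pairwise_iff_getElem.mp hqR) i j hi hj hij
        have d1 : 0 ≤ 1 - s x := by linarith
        have t2 : 0 ≤ 2 * s x * (1 - s x) * cr 1 (P v) (P R[i]) (P R[j]) := by positivity
        rcases eq_or_lt_of_le a0 with h0 | h0
        · rw [← h0]; simpa using c1
        · have t3 : 0 < s x ^ 2 * cr 1 (P q) (P R[i]) (P R[j]) := by positivity
          have t1 : 0 ≤ (1 - s x) ^ 2 * cr 1 (P p) (P R[i]) (P R[j]) := by positivity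
          linarith
    have e : R ++ F = (R ++ [p] ++ M) ++ [q] := by simp [hFd]
    rw [e] at hrot
    simpa using hrot.rotate
  · intro x hx
    have hxF : x ∈ F := by simp [hFd, hx]
    rw [hF' x hxF]
    exact bez_mem_convexHull (by simp) (by simp) (by simp) (h01 x hxF).1 (h01 x hxF).2
  · rw [List.pairwise_iff_getElem] at hs ⊢
    intro i j hi hj hij
    rw [hF' _ (List.getElem_mem _), hF' _ (List.getElem_mem _), ← cr_rot, cr_swap, cr_bez_two]
    have e1 := sub_pos.mpr (hs i j hi hj hij)
    obtain ⟨a0, a1⟩ := h01 _ (List.getElem_mem hi)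
    obtain ⟨b0, b1⟩ := h01 _ (List.getElem_mem hj)
    have d3 : 0 < s F[i] * (1 - s F[j]) + s F[j] * (1 - s F[i]) := by nlinarith
    have e4 : cr 1 (P p) (P q) (P v) = - cr 1 (P p) (P v) (P q) := cr_swap' _ _ _ _
    rw [cr_self_right, cr_self_outer, e4]
    have := mul_pos (mul_pos e1 d3) hpvq
    linarith

/-! ### Redrawing a graph inside a convex polygon -/

/-- The point `z` lies on an edge of `G` when the vertices are placed by `f`. -/
def Drawn (G : PlaneGraph) (f : ℝ × ℝ → ℝ × ℝ) (z : ℝ × ℝ) : Prop :=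
  ∃ p q, G.Adj p q ∧ z ∈ segment ℝ (f p) (f q)

/-- Placing the vertices of `G` by `f` gives a straight-line embedding of `G` inside the convex
hull of the vertices on the list `L`. -/
structure Placement (G : PlaneGraph) (L : List (ℝ × ℝ)) (f : ℝ × ℝ → ℝ × ℝ) : Prop where
  inj : ∀ a ∈ G.verts, ∀ b ∈ G.verts, f a = f b → a = b
  edge : ∀ p q r s, G.Adj p q → G.Adj r s → ∀ x, x ∈ segment ℝ (f p) (f q) →
    x ∈ segment ℝ (f r) (f s) → ({p, q} : Set (ℝ × ℝ)) = {r, s} ∨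
      ((x = f p ∨ x = f q) ∧ (x = f r ∨ x = f s))
  vtx : ∀ p q v, G.Adj p q → v ∈ G.verts → f v ∈ segment ℝ (f p) (f q) → v = p ∨ v = q
  hull : ∀ v ∈ G.verts, f v ∈ convexHull ℝ (f '' {x | x ∈ L})

/-- The point `z` is outside the polygon `L`, on an edge of `G`, or in a triangular face of `G`,
when the vertices are placed by `f`. -/
def Covers (G : PlaneGraph) (L : List (ℝ × ℝ)) (f : ℝ × ℝ → ℝ × ℝ) (z : ℝ × ℝ) : Prop :=
  (∃ a b, Nx L a b ∧ cr 1 (f a) (f b) z < 0) ∨ G.Drawn f z ∨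
    ∃ a b c, G.Adj a b ∧ G.Adj b c ∧ G.Adj c a ∧ 0 < cr 1 (f a) (f b) (f c) ∧
      z ∈ tri 1 (f a) (f b) (f c) ∧ ∀ y ∈ tri 1 (f a) (f b) (f c), ¬ G.Drawn f y

lemma Placement.drawn_mem_hull {G : PlaneGraph} {L : List (ℝ × ℝ)} {f : ℝ × ℝ → ℝ × ℝ}
    (h : G.Placement L f) {z : ℝ × ℝ} (hz : G.Drawn f z) :
    z ∈ convexHull ℝ (f '' {x | x ∈ L}) := by
  obtain ⟨p, q, hpq, hz⟩ := hz
  exact (convex_convexHull ℝ _).segment_subset (h.hull p (G.mem_of_adj p q hpq).1)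
    (h.hull q (G.mem_of_adj p q hpq).2) hz

lemma Drawn.congr {G : PlaneGraph} {f g : ℝ × ℝ → ℝ × ℝ} (hfg : ∀ x ∈ G.verts, f x = g x)
    {z : ℝ × ℝ} (h : G.Drawn f z) : G.Drawn g z := by
  obtain ⟨p, q, hpq, hz⟩ := h
  have := G.mem_of_adj p q hpq
  exact ⟨p, q, hpq, by rwa [← hfg p this.1, ← hfg q this.2]⟩

lemma Placement.congr {G : PlaneGraph} {L : List (ℝ × ℝ)} {f g : ℝ × ℝ → ℝ × ℝ}
    (h : G.Placement L f) (hL : ∀ x ∈ L, x ∈ G.verts) (hfg : ∀ x ∈ G.verts, f x = g x) :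
    G.Placement L g where
  inj a ha b hb := by rw [← hfg a ha, ← hfg b hb]; exact h.inj a ha b hb
  edge p q r s hpq hrs := by
    have h1 := G.mem_of_adj p q hpq
    have h2 := G.mem_of_adj r s hrs
    rw [← hfg p h1.1, ← hfg q h1.2, ← hfg r h2.1, ← hfg s h2.2]
    exact h.edge p q r s hpq hrs
  vtx p q v hpq hv := by
    have h1 := G.mem_of_adj p q hpq
    rw [← hfg p h1.1, ← hfg q h1.2, ← hfg v hv]
    exact h.vtx p q v hpq hv
  hull v hv := by
    have : g '' {x | x ∈ L} = f '' {x | x ∈ L} :=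
      Set.image_congr fun x hx => (hfg x (hL x hx)).symm
    rw [this, ← hfg v hv]
    exact h.hull v hv

lemma Covers.congr {G : PlaneGraph} {L : List (ℝ × ℝ)} {f g : ℝ × ℝ → ℝ × ℝ} {z : ℝ × ℝ}
    (h : G.Covers L f z) (hL : ∀ x ∈ L, x ∈ G.verts) (hfg : ∀ x ∈ G.verts, f x = g x) :
    G.Covers L g z := by
  rcases h with ⟨a, b, hab, hz⟩ | h | ⟨a, b, c, hab, hbc, hca, hpos, hz, hd⟩
  · exact Or.inl ⟨a, b, hab, by rwa [← hfg a (hL a hab.mem.1), ← hfg b (hL b hab.mem.2)]⟩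
  · exact Or.inr (Or.inl (h.congr hfg))
  · refine Or.inr (Or.inr ⟨a, b, c, hab, hbc, hca, ?_⟩)
    rw [← hfg a (G.mem_of_adj a b hab).1, ← hfg b (G.mem_of_adj a b hab).2,
      ← hfg c (G.mem_of_adj b c hbc).2]
    exact ⟨hpos, hz, fun y hy hy' => hd y hy (hy'.congr fun x hx => (hfg x hx).symm)⟩

lemma Adjc.trichotomy {α : Type*} {r : α → α → Prop} {l : List α} (h : l.Pairwise r) {a b w : α}
    (hab : Adjc l a b) (hw : w ∈ l) : (w = a ∨ r w a) ∨ (w = b ∨ r b w) := by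
  induction l with
  | nil => simp at hab
  | cons c l ih =>
    cases l with
    | nil => simp at hab
    | cons d l =>
      rw [adjc_cons_cons] at hab
      rw [List.pairwise_cons] at h
      rcases hab with ⟨rfl, rfl⟩ | hab
      · rcases List.mem_cons.mp hw with rfl | hw
        · exact Or.inl (Or.inl rfl)
        · rcases List.mem_cons.mp hw with rfl | hw
          · exact Or.inr (Or.inl rfl)
          · exact Or.inr (Or.inr ((List.pairwise_cons.mp h.2).1 w hw))
      · rcases List.mem_cons.mp hw with rfl | hw
        · exact Or.inl (Or.inr (h.1 a hab.mem.1))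
        · exact ih h.2 hab hw

lemma exists_adjc_sign {α : Type*} {s : α → ℝ} {l : List α} {p q : α}
    (hp : s p ≤ 0) (hq : 0 ≤ s q) :
    ∃ a b, Adjc (p :: (l ++ [q])) a b ∧ s a ≤ 0 ∧ 0 ≤ s b := by
  induction l generalizing p with
  | nil => exact ⟨p, q, by simp, hp, hq⟩
  | cons c l ih =>
    rcases le_total (s c) 0 with hc | hc
    · obtain ⟨a, b, hab, h⟩ := ih hc
      exact ⟨a, b, Or.inr hab, h⟩
    · exact ⟨p, c, by simp, hp, hc⟩

lemma eq_of_mem_segments {V a b x : ℝ × ℝ} (h : 0 < cr 1 V a b) (ha : x ∈ segment ℝ V a)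
    (hb : x ∈ segment ℝ V b) : x = V := by
  obtain ⟨s, t, hs, ht, hst, rfl⟩ := ha
  have h1 := cr_eq_zero_of_mem_segment (σ := 1) hb
  rw [← cr_rot, ← cr_rot] at h1
  have e : cr 1 (s • V + t • a) V b = - (t * cr 1 V a b) := by
    have : s = 1 - t := by linarith
    subst this
    simp only [cr, Prod.fst_add, Prod.snd_add, Prod.smul_fst, Prod.smul_snd, smul_eq_mul]
    ring
  rw [e] at h1
  have : t = 0 := by
    rcases mul_eq_zero.mp (neg_eq_zero.mp h1) with h2 | h2
    · exact h2
    · linarith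
  subst this
  have : s = 1 := by linarith
  simp [this]

lemma cr_cone (X Y V a b z : ℝ × ℝ) :
    cr 1 V b a * cr 1 X Y z + cr 1 a b z * cr 1 X Y V =
      cr 1 V b z * cr 1 X Y a - cr 1 V a z * cr 1 X Y b := by
  simp only [cr]; ring

section Cone

variable {G G' : PlaneGraph} {v p q : ℝ × ℝ} {R M : List (ℝ × ℝ)} {f : ℝ × ℝ → ℝ × ℝ}

lemma nx_of_adjc_fan {a b : ℝ × ℝ} (h : Adjc (p :: (M ++ [q])) a b) :
    Nx (q :: (R ++ [p]) ++ M) a b := by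
  have : q :: (R ++ [p]) ++ M = (q :: R) ++ (p :: M) := by simp
  rw [this, nx_append_comm, nx_append_cons]
  exact Or.inl h

lemma adjc_or_nx_of_nx {a b : ℝ × ℝ} (h : Nx (q :: (R ++ [p]) ++ M) a b) :
    Adjc (p :: (M ++ [q])) a b ∨ Nx (v :: q :: (R ++ [p])) a b := by
  have : q :: (R ++ [p]) ++ M = (q :: R) ++ (p :: M) := by simp
  rw [this, nx_append_comm, nx_append_cons] at h
  refine h.imp id fun h => ?_
  rw [nx_cons]
  have e : v :: (q :: (R ++ [p]) ++ [v]) = v :: (q :: R) ++ p :: [v] := by simp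
  rw [e, adjc_append_cons]
  exact Or.inl (Or.inr (by simpa using h))

/-- Placing a new outer vertex `v` beyond a chain of consecutive boundary vertices. -/
lemma Placement.cone (hv : v ∉ G'.verts) (hverts : ∀ x, x ∈ G.verts ↔ x = v ∨ x ∈ G'.verts)
    (hadj : ∀ a b, G.Adj a b ↔ G'.Adj a b ∨ (a = v ∧ b ∈ p :: (M ++ [q])) ∨
      (b = v ∧ a ∈ p :: (M ++ [q])))
    (hnx : ∀ a b, Nx (q :: (R ++ [p]) ++ M) a b → G'.Adj a b)
    (hconv : ConvPos f (q :: (R ++ [p]) ++ M)) (hnd : (q :: (R ++ [p]) ++ M).Nodup)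
    (hMhull : ∀ x ∈ M, f x ∈ convexHull ℝ {f p, f v, f q})
    (hpw : (p :: (M ++ [q])).Pairwise (fun a b => 0 < cr 1 (f v) (f b) (f a)))
    (hf : G'.Placement (q :: (R ++ [p]) ++ M) f)
    (hcov : ∀ z, (∀ a b, Nx (v :: q :: (R ++ [p])) a b → 0 ≤ cr 1 (f a) (f b) z) →
      G'.Covers (q :: (R ++ [p]) ++ M) f z) :
    G.Placement (v :: q :: (R ++ [p])) f ∧ ∀ z, G.Covers (v :: q :: (R ++ [p])) f z := by
  set L' := q :: (R ++ [p]) ++ M with hL'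
  set L := v :: q :: (R ++ [p]) with hL
  set F := p :: (M ++ [q]) with hF
  have hneg : ∀ a b, Adjc F a b → cr 1 (f a) (f b) (f v) < 0 := by
    intro a b hab
    have := Adjc.of_pairwise hpw hab
    rw [← cr_rot, cr_swap] at this
    linarith
  have hnn : ∀ a b, Adjc F a b → ∀ z ∈ convexHull ℝ (f '' {x | x ∈ L'}),
      0 ≤ cr 1 (f a) (f b) z := fun a b hab z hz =>
    hconv.nonneg_of_mem hnd (nx_of_adjc_fan hab) hz
  have hFnd : F.Nodup := by
    simp only [hL', hF, List.nodup_cons, List.nodup_append, List.mem_append, List.mem_cons,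
      List.cons_append] at hnd ⊢
    grind
  have hFadj : ∀ w ∈ F, ∃ a b, Adjc F a b ∧ (w = a ∨ w = b) := by
    intro w hw
    rcases List.mem_cons.mp hw with rfl | hw'
    · obtain ⟨a, ha⟩ := exists_adjc_right (l := F) (x := w) hw (by
        cases M <;> simp [hF] at hFnd ⊢ <;> grind)
      exact ⟨w, a, ha, Or.inl rfl⟩
    · obtain ⟨a, ha⟩ := exists_adjc_left (l := F) (x := w) hw (by
        simp only [hF, List.nodup_cons] at hFnd
        simp only [hF, List.head?_cons]
        grind)
      exact ⟨a, w, ha, Or.inr rfl⟩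
  have hcone : ∀ w ∈ F, ∀ z ∈ segment ℝ (f v) (f w),
      z ∈ convexHull ℝ (f '' {x | x ∈ L'}) → z = f w := by
    intro w hw z hz hzh
    obtain ⟨a, b, hab, hwab⟩ := hFadj w hw
    have h1 := hnn a b hab z hzh
    have h2 := hneg a b hab
    obtain ⟨s, t, hs, ht, hst, rfl⟩ := hz
    rw [cr_comb _ _ _ _ _ _ _ hst] at h1
    have h3 : cr 1 (f a) (f b) (f w) = 0 := by rcases hwab with rfl | rfl <;> simp
    rw [h3] at h1
    have : s = 0 := by nlinarith
    subst this
    have : t = 1 := by linarith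
    simp [this]
  have hFv : ∀ w ∈ F, w ∈ G'.verts := by
    intro w hw
    obtain ⟨a, b, hab, hwab⟩ := hFadj w hw
    have := G'.mem_of_adj a b (hnx a b (nx_of_adjc_fan hab))
    rcases hwab with rfl | rfl
    exacts [this.1, this.2]
  have hvhull : f v ∉ convexHull ℝ (f '' {x | x ∈ L'}) := by
    intro h
    have := hcone p (by simp [hF]) (f v) (left_mem_segment _ _ _) h
    obtain ⟨a, b, hab, hw⟩ := hFadj p (by simp [hF])
    have h1 := hneg a b hab
    rw [this] at h1
    rcases hw with rfl | rfl <;> simp at h1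
  have hdrawn : ∀ z, G.Drawn f z ↔ G'.Drawn f z ∨ ∃ w ∈ F, z ∈ segment ℝ (f v) (f w) := by
    intro z
    constructor
    · rintro ⟨a, b, hab, hz⟩
      rcases (hadj a b).mp hab with h | ⟨rfl, h⟩ | ⟨rfl, h⟩
      · exact Or.inl ⟨a, b, h, hz⟩
      · exact Or.inr ⟨b, h, hz⟩
      · exact Or.inr ⟨a, h, by rwa [segment_symm]⟩
    · rintro (⟨a, b, hab, hz⟩ | ⟨w, hw, hz⟩)
      · exact ⟨a, b, (hadj a b).mpr (Or.inl hab), hz⟩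
      · exact ⟨v, w, (hadj v w).mpr (Or.inr (Or.inl ⟨rfl, hw⟩)), hz⟩
  -- a new edge meets an old one only at its end
  have hmix : ∀ r s w, G'.Adj r s → w ∈ F → ∀ x, x ∈ segment ℝ (f r) (f s) →
      x ∈ segment ℝ (f v) (f w) → x = f w ∧ (x = f r ∨ x = f s) := by
    intro r s w hrs hw x hx hx'
    have e := hcone w hw x hx' (hf.drawn_mem_hull ⟨r, s, hrs, hx⟩)
    subst e
    refine ⟨rfl, ?_⟩
    rcases hf.vtx r s w hrs (hFv w hw) hx with rfl | rfl <;> simp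
  have hstar : ∀ w ∈ F, ∀ w' ∈ F, ∀ x, x ∈ segment ℝ (f v) (f w) → x ∈ segment ℝ (f v) (f w') →
      w = w' ∨ x = f v := by
    intro w hw w' hw' x hx hx'
    by_cases e : w = w'
    · exact Or.inl e
    · right
      have hs : ∀ a ∈ F, ∀ b ∈ F, a ≠ b → 0 < cr 1 (f v) (f b) (f a) ∨ 0 < cr 1 (f v) (f a) (f b) :=
        have : Std.Symm fun a b => 0 < cr 1 (f v) (f b) (f a) ∨ 0 < cr 1 (f v) (f a) (f b) :=
          ⟨fun _ _ h => h.symm⟩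
        fun a ha b hb hne => List.Pairwise.forall
          (R := fun a b => 0 < cr 1 (f v) (f b) (f a) ∨ 0 < cr 1 (f v) (f a) (f b))
          (hpw.imp fun h => Or.inl h) ha hb hne
      rcases hs w hw w' hw' e with h | h
      · exact eq_of_mem_segments h hx' hx
      · exact eq_of_mem_segments h hx hx'
  refine ⟨⟨?_, ?_, ?_, ?_⟩, ?_⟩
  · intro a ha b hb hab
    rcases (hverts a).mp ha with rfl | ha' <;> rcases (hverts b).mp hb with rfl | hb'
    · rfl
    · exact absurd (hab ▸ hf.hull b hb') hvhull
    · exact absurd (hab ▸ hf.hull a ha') hvhull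
    · exact hf.inj a ha' b hb' hab
  · intro a b c d hab hcd x hx hx'
    rcases (hadj a b).mp hab with h | ⟨rfl, h⟩ | ⟨rfl, h⟩ <;>
      rcases (hadj c d).mp hcd with h' | ⟨e, h'⟩ | ⟨e, h'⟩
    · exact hf.edge a b c d h h' x hx hx'
    · subst e
      have := hmix a b d h h' x hx hx'
      tauto
    · subst e
      have := hmix a b c h h' x hx (by rwa [segment_symm])
      tauto
    · have := hmix c d b h' h x hx' hx
      tauto
    · subst e
      rcases hstar b h d h' x hx hx' with rfl | e
      · exact Or.inl rfl
      · exact Or.inr ⟨Or.inl e, Or.inl e⟩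
    · subst e
      rcases hstar b h c h' x hx (by rwa [segment_symm]) with rfl | e
      · exact Or.inl (Set.pair_comm _ _)
      · exact Or.inr ⟨Or.inl e, Or.inr e⟩
    · have := hmix c d a h' h x hx' (by rwa [segment_symm])
      tauto
    · subst e
      rcases hstar a h d h' x (by rwa [segment_symm]) hx' with rfl | e
      · exact Or.inl (Set.pair_comm _ _)
      · exact Or.inr ⟨Or.inr e, Or.inl e⟩
    · subst e
      rcases hstar a h c h' x (by rwa [segment_symm]) (by rwa [segment_symm]) with rfl | e
      · exact Or.inl rfl
      · exact Or.inr ⟨Or.inr e, Or.inr e⟩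
  · intro a b w hab hw hx
    rcases (hadj a b).mp hab with h | ⟨rfl, h⟩ | ⟨rfl, h⟩ <;>
      rcases (hverts w).mp hw with e | hw'
    · subst e
      exact absurd (hf.drawn_mem_hull ⟨a, b, h, hx⟩) hvhull
    · exact hf.vtx a b w h hw' hx
    · exact Or.inl e
    · exact Or.inr (hf.inj w hw' b (hFv b h) (hcone b h _ hx (hf.hull w hw')))
    · exact Or.inr e
    · exact Or.inl (hf.inj w hw' a (hFv a h)
        (hcone a h _ (by rwa [segment_symm]) (hf.hull w hw')))
  · have hsub : convexHull ℝ (f '' {x | x ∈ L'}) ⊆ convexHull ℝ (f '' {x | x ∈ L}) := by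
      refine convexHull_min ?_ (convex_convexHull ℝ _)
      rintro _ ⟨x, hx, rfl⟩
      by_cases hxL : x ∈ L
      · exact subset_convexHull ℝ _ ⟨x, hxL, rfl⟩
      · have hxM : x ∈ M := by
          simp only [Set.mem_ofPred_eq, hL', hL, List.mem_append, List.mem_cons] at hx hxL
          tauto
        refine convexHull_mono ?_ (hMhull x hxM)
        rintro _ (rfl | rfl | rfl)
        · exact ⟨p, by simp [hL], rfl⟩
        · exact ⟨v, by simp [hL], rfl⟩
        · exact ⟨q, by simp [hL], rfl⟩
    intro w hw
    rcases (hverts w).mp hw with rfl | hw'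
    · exact subset_convexHull ℝ _ ⟨w, by simp [hL], rfl⟩
    · exact hsub (hf.hull w hw')
  · intro z
    by_cases hout : ∀ a b, Nx L a b → 0 ≤ cr 1 (f a) (f b) z
    swap
    · push Not at hout
      exact Or.inl hout
    rcases hcov z hout with ⟨c, d, hcd, hz⟩ | hz | ⟨a, b, c, hab, hbc, hca, hpos, hz, hd⟩
    · rcases adjc_or_nx_of_nx (v := v) hcd with hcd | hcd
      swap
      · exact absurd (hout c d hcd) (not_le.mpr hz)
      have hsp : cr 1 (f v) (f p) z ≤ 0 := by
        have := hout p v (by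
          rw [hL, nx_cons]
          have e : v :: (q :: (R ++ [p]) ++ [v]) = v :: (q :: R) ++ p :: [v] := by simp
          rw [e, adjc_append_cons]
          simp)
        rw [cr_swap] at this
        linarith
      have hsq : 0 ≤ cr 1 (f v) (f q) z := hout v q (by rw [hL, nx_cons]; simp)
      obtain ⟨a, b, hab, hsa, hsb⟩ := exists_adjc_sign (s := fun w => cr 1 (f v) (f w) z)
        (l := M) hsp hsq
      have hpos := Adjc.of_pairwise hpw hab
      have hGab := hnx a b (nx_of_adjc_fan hab)
      have haF := hab.mem.1
      have hbF := hab.mem_right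
      have hva : G.Adj v a := (hadj v a).mpr (Or.inr (Or.inl ⟨rfl, haF⟩))
      have hvb : G.Adj v b := (hadj v b).mpr (Or.inr (Or.inl ⟨rfl, hbF⟩))
      have hba : G.Adj b a := (hadj b a).mpr (Or.inl (G'.symm _ _ hGab))
      have hav : 0 ≤ cr 1 (f a) (f v) z := by rw [cr_swap]; linarith
      have hle : cr 1 (f a) (f b) z ≤ 0 := by
        by_contra! hlt
        have e := cr_cone (f c) (f d) (f v) (f a) (f b) z
        have hmem : ∀ w ∈ F, f w ∈ convexHull ℝ (f '' {x | x ∈ L'}) := fun w hw =>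
          hf.hull w (hFv w hw)
        have h1 := hnn c d hcd _ (hmem a haF)
        have h2 := hnn c d hcd _ (hmem b hbF)
        have h3 := hneg c d hcd
        have t1 := mul_pos hpos (neg_pos.mpr hz)
        have t2 := mul_pos hlt (neg_pos.mpr h3)
        have t3 := mul_nonneg hsb h1
        have t4 := mul_nonneg (neg_nonneg.mpr hsa) h2
        linarith
      have hba' : 0 ≤ cr 1 (f b) (f a) z := by rw [cr_swap]; linarith
      refine Or.inr ?_
      rcases hba'.eq_or_lt with e | hba'
      · exact Or.inl ⟨b, a, hba, mem_segment_of_cr (by rwa [cr_rot]) e.symm hav hsb⟩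
      rcases hav.eq_or_lt with e | hav
      · exact Or.inl ⟨a, v, G.symm _ _ hva,
          mem_segment_of_cr (by rwa [← cr_rot]) e.symm hsb hba'.le⟩
      rcases hsb.eq_or_lt with e | hsb
      · exact Or.inl ⟨v, b, hvb, mem_segment_of_cr hpos e.symm hba'.le hav.le⟩
      refine Or.inr ⟨v, b, a, hvb, hba, G.symm _ _ hva, hpos, ⟨hsb, hba', hav⟩, ?_⟩
      rintro y ⟨hy1, hy2, hy3⟩ hy
      rcases (hdrawn y).mp hy with hy | ⟨w, hw, hy⟩
      · have := hnn a b hab y (hf.drawn_mem_hull hy)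
        rw [cr_swap] at hy2
        linarith
      · obtain ⟨s, t, hs, ht, hst, rfl⟩ := hy
        rw [cr_comb _ _ _ _ _ _ _ hst] at hy1 hy3
        simp only [cr_self_outer, cr_self_right, mul_zero, zero_add] at hy1 hy3
        have h1 := pos_of_mul_pos_right hy1 ht
        have h3 := pos_of_mul_pos_right hy3 ht
        rcases Adjc.trichotomy hpw hab hw with (rfl | h) | (rfl | h)
        · simp at h3
        · rw [cr_swap] at h3; linarith
        · simp at h1
        · rw [cr_swap'] at h1; linarith
    · exact Or.inr (Or.inl ((hdrawn z).mpr (Or.inl hz)))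
    · refine Or.inr (Or.inr ⟨a, b, c, (hadj _ _).mpr (Or.inl hab), (hadj _ _).mpr (Or.inl hbc),
        (hadj _ _).mpr (Or.inl hca), hpos, hz, ?_⟩)
      intro y hy hy'
      rcases (hdrawn y).mp hy' with hy' | ⟨w, hw, hyw⟩
      · exact hd y hy hy'
      · have hyh : y ∈ convexHull ℝ (f '' {x | x ∈ L'}) := by
          have hc : convexHull ℝ {f a, f b, f c} ⊆ convexHull ℝ (f '' {x | x ∈ L'}) := by
            refine convexHull_min ?_ (convex_convexHull ℝ _)
            rintro _ (rfl | rfl | rfl)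
            · exact hf.hull _ (G'.mem_of_adj _ _ hab).1
            · exact hf.hull _ (G'.mem_of_adj _ _ hab).2
            · exact hf.hull _ (G'.mem_of_adj _ _ hca).1
          exact hc (mem_convexHull_of_cr hpos hy.1.le hy.2.1.le hy.2.2.le)
        have e := hcone w hw y hyw hyh
        subst e
        obtain ⟨c', d', hcd, hw'⟩ := hFadj w hw
        refine hd _ hy ⟨c', d', hnx _ _ (nx_of_adjc_fan hcd), ?_⟩
        rcases hw' with rfl | rfl
        exacts [left_mem_segment _ _ _, right_mem_segment _ _ _]

end Cone

/-- The graph `G` with its vertices moved by an injective map. -/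
def moved (G : PlaneGraph) (f : ℝ × ℝ → ℝ × ℝ)
    (hf : ∀ a ∈ G.verts, ∀ b ∈ G.verts, f a = f b → a = b) : PlaneGraph where
  verts := G.verts.image f
  Adj x y := ∃ a b, G.Adj a b ∧ f a = x ∧ f b = y
  symm := fun _ _ ⟨a, b, hab, ha, hb⟩ => ⟨b, a, G.symm a b hab, hb, ha⟩
  loopless := by
    rintro x ⟨a, b, hab, ha, hb⟩
    have h := G.mem_of_adj a b hab
    have := hf a h.1 b h.2 (ha.trans hb.symm)
    subst this
    exact G.loopless a hab
  mem_of_adj := by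
    rintro _ _ ⟨a, b, hab, rfl, rfl⟩
    have h := G.mem_of_adj a b hab
    exact ⟨Finset.mem_image_of_mem f h.1, Finset.mem_image_of_mem f h.2⟩

lemma moved_isIsoTo (G : PlaneGraph) (f : ℝ × ℝ → ℝ × ℝ)
    (hf : ∀ a ∈ G.verts, ∀ b ∈ G.verts, f a = f b → a = b) : G.IsIsoTo (G.moved f hf) := by
  refine ⟨f, ⟨fun a ha => Finset.mem_image_of_mem f ha, fun a ha b hb => hf a ha b hb, ?_⟩, ?_⟩
  · intro x hx
    obtain ⟨a, ha, rfl⟩ := Finset.mem_image.mp hx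
    exact ⟨a, ha, rfl⟩
  · refine fun p hp q hq => ⟨fun h => ⟨p, q, h, rfl, rfl⟩, ?_⟩
    rintro ⟨a, b, hab, ha, hb⟩
    have h := G.mem_of_adj a b hab
    rwa [← hf a h.1 p hp ha, ← hf b h.2 q hq hb]

lemma moved_biconnected {G : PlaneGraph} {f : ℝ × ℝ → ℝ × ℝ}
    (hf : ∀ a ∈ G.verts, ∀ b ∈ G.verts, f a = f b → a = b) (h : G.Biconnected) :
    (G.moved f hf).Biconnected := by
  obtain ⟨h3, hc, hd⟩ := h
  refine ⟨?_, ?_, ?_⟩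
  · have : (G.moved f hf).verts.card = G.verts.card :=
      Finset.card_image_of_injOn fun a ha b hb => hf a ha b hb
    rwa [this]
  · refine ⟨hc.1.image f, fun x hx y hy => ?_⟩
    obtain ⟨a, ha, rfl⟩ := Finset.mem_image.mp hx
    obtain ⟨b, hb, rfl⟩ := Finset.mem_image.mp hy
    exact (hc.2 a ha b hb).lift f fun c d hcd => ⟨c, d, hcd, rfl, rfl⟩
  · intro x hx
    obtain ⟨v, hv, rfl⟩ := Finset.mem_image.mp hx
    have hmem : ∀ y ∈ ((G.moved f hf).deleteVerts {f v}).verts,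
        ∃ a ∈ (G.deleteVerts {v}).verts, f a = y := by
      intro y hy
      obtain ⟨hy1, hy2⟩ := Finset.mem_sdiff.mp hy
      obtain ⟨a, ha, rfl⟩ := Finset.mem_image.mp hy1
      refine ⟨a, Finset.mem_sdiff.mpr ⟨ha, ?_⟩, rfl⟩
      rw [Finset.mem_singleton] at hy2 ⊢
      rintro rfl
      exact hy2 rfl
    have hne : ∀ a ∈ G.verts, a ∉ ({v} : Finset (ℝ × ℝ)) → f a ∉ ({f v} : Finset (ℝ × ℝ)) := by
      intro a ha hav
      rw [Finset.mem_singleton] at hav ⊢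
      exact fun e => hav (hf a ha v hv e)
    have hd := hd v hv
    refine ⟨?_, fun x hx y hy => ?_⟩
    · obtain ⟨a, ha⟩ := hd.1
      obtain ⟨ha1, ha2⟩ := Finset.mem_sdiff.mp ha
      exact ⟨f a, Finset.mem_sdiff.mpr ⟨Finset.mem_image_of_mem f ha1, hne a ha1 ha2⟩⟩
    · obtain ⟨a, ha, rfl⟩ := hmem x hx
      obtain ⟨b, hb, rfl⟩ := hmem y hy
      refine (hd.2 a ha b hb).lift f fun c d hcd => ?_
      have h := G.mem_of_adj c d hcd.1
      exact ⟨⟨c, d, hcd.1, rfl, rfl⟩, hne c h.1 hcd.2.1, hne d h.2 hcd.2.2⟩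

lemma not_bounded_halfPlane {a b z : ℝ × ℝ} (hz : cr 1 a b z < 0) :
    ¬ Bornology.IsBounded {y | cr 1 a b y < 0} := by
  intro hb
  obtain ⟨C, hC⟩ := hb.exists_norm_le
  have hd : b - a ≠ 0 := by
    intro e
    rw [sub_eq_zero.mp e] at hz
    simp at hz
  have hd := norm_pos_iff.mpr hd
  have hmem : ∀ t : ℝ, z + t • (b - a) ∈ {y | cr 1 a b y < 0} := by
    intro t
    have : cr 1 a b (z + t • (b - a)) = cr 1 a b z := by
      simp only [cr, Prod.fst_add, Prod.snd_add, Prod.smul_fst, Prod.smul_snd, smul_eq_mul,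
        Prod.fst_sub, Prod.snd_sub]
      ring
    simpa [this] using hz
  have h0 := hC _ (hmem 0)
  rw [zero_smul, add_zero] at h0
  have hC0 := (norm_nonneg z).trans h0
  have h1 := hC _ (hmem ((2 * C + 1) / ‖b - a‖))
  have h2 : ‖((2 * C + 1) / ‖b - a‖) • (b - a)‖ = 2 * C + 1 := by
    rw [norm_smul, Real.norm_of_nonneg (by positivity), div_mul_cancel₀ _ hd.ne']
  have h3 := norm_sub_le (z + ((2 * C + 1) / ‖b - a‖) • (b - a)) z
  rw [add_sub_cancel_left, h2] at h3
  linarith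

lemma Placement.exists_nearTriangulation {G : PlaneGraph} {L : List (ℝ × ℝ)}
    {f : ℝ × ℝ → ℝ × ℝ} (h : G.Placement L f) (hcov : ∀ z, G.Covers L f z) (hconv : ConvPos f L)
    (hL : L.Nodup) (hb : G.Biconnected) :
    ∃ H : PlaneGraph, H.IsNearTriangulation ∧ G.IsIsoTo H := by
  have hdr : ∀ z, z ∈ (G.moved f h.inj).drawing ↔ G.Drawn f z := by
    intro z
    constructor
    · rintro ⟨_, _, ⟨a, b, hab, rfl, rfl⟩, hz⟩
      exact ⟨a, b, hab, hz⟩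
    · rintro ⟨a, b, hab, hz⟩
      exact ⟨_, _, ⟨a, b, hab, rfl, rfl⟩, hz⟩
  have hadj : ∀ {a b}, G.Adj a b → (G.moved f h.inj).Adj (f a) (f b) :=
    fun {a b} hab => ⟨a, b, hab, rfl, rfl⟩
  refine ⟨G.moved f h.inj, ⟨⟨?_, ?_⟩, moved_biconnected h.inj hb, ?_⟩, moved_isIsoTo G f h.inj⟩
  · rintro _ _ _ _ ⟨p, q, hpq, rfl, rfl⟩ ⟨r, s, hrs, rfl, rfl⟩ x hx hx'
    rcases h.edge p q r s hpq hrs x hx hx' with e | e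
    · left
      rw [← Set.image_pair, ← Set.image_pair, e]
    · exact Or.inr e
  · rintro _ _ x ⟨p, q, hpq, rfl, rfl⟩ hx hxs
    obtain ⟨v, hv, rfl⟩ := Finset.mem_image.mp hx
    rcases h.vtx p q v hpq hv hxs with rfl | rfl <;> simp
  · rintro F ⟨x, hx, rfl⟩ hbd
    rcases hcov x with ⟨a, b, hab, hz⟩ | hd | ⟨a, b, c, hab, hbc, hca, hpos, hz, hd⟩
    · exfalso
      have hconvex : Convex ℝ {y | cr 1 (f a) (f b) y < 0} := by
        have := convex_cr_pos 1 (f b) (f a)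
        simpa only [cr_swap 1 (f a) (f b), neg_pos] using this
      have hsub : {y | cr 1 (f a) (f b) y < 0} ⊆ (G.moved f h.inj).drawingᶜ := by
        intro y hy hyd
        have := hconv.nonneg_of_mem hL hab (h.drawn_mem_hull ((hdr y).mp hyd))
        exact absurd hy (not_lt.mpr this)
      exact not_bounded_halfPlane hz
        (hbd.subset (hconvex.isPreconnected.subset_connectedComponentIn hz hsub))
    · exact absurd ((hdr x).mpr hd) hx
    · have hF : Face (G.moved f h.inj) 1 (f a) (f b) (f c) :=
        ⟨hadj hab, hadj hbc, hadj hca, hpos, fun y hy hyd => hd y hy ((hdr y).mp hyd)⟩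
      have hm := (G.moved f h.inj).mem_of_adj _ _ (hadj hab)
      refine ⟨f a, hm.1, f b, hm.2, f c, ((G.moved f h.inj).mem_of_adj _ _ (hadj hbc)).2,
        hadj hab, hadj hbc, hadj (G.symm _ _ hca), ?_⟩
      rw [openTriangle_eq_tri one_ne_zero hpos]
      exact hF.component_eq hz

/-- Every strictly convex polygon is the outer boundary of a drawing of `G`. -/
def Drawable (G : PlaneGraph) (L : List (ℝ × ℝ)) : Prop :=
  ∀ P, ConvPos P L → ∃ f, (∀ x ∈ L, f x = P x) ∧ G.Placement L f ∧ ∀ z, G.Covers L f z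

lemma Drawable.rotate {G : PlaneGraph} {A B : List (ℝ × ℝ)} (h : G.Drawable (A ++ B)) :
    G.Drawable (B ++ A) := by
  intro P hP
  obtain ⟨f, hf, hp, hc⟩ := h P hP.rotate
  have hmem : ∀ x, x ∈ A ++ B ↔ x ∈ B ++ A := fun x => by simp [or_comm]
  refine ⟨f, fun x hx => hf x ((hmem x).mpr hx), ⟨hp.inj, hp.edge, hp.vtx, ?_⟩, fun z => ?_⟩
  · simpa only [hmem] using hp.hull
  · simpa only [Covers, nx_append_comm A B] using hc z

lemma ConvPos.congr {P Q : ℝ × ℝ → ℝ × ℝ} {L : List (ℝ × ℝ)} (h : ConvPos P L)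
    (hPQ : ∀ x ∈ L, Q x = P x) : ConvPos Q L := by
  unfold ConvPos at h ⊢
  rw [List.triplewise_iff_getElem] at h ⊢
  intro i j k hij hjk hk
  rw [hPQ _ (List.getElem_mem _), hPQ _ (List.getElem_mem _), hPQ _ (List.getElem_mem _)]
  exact h i j k hij hjk hk

lemma drawable_cone {G G' : PlaneGraph} {v p q : ℝ × ℝ} {R M : List (ℝ × ℝ)}
    (hv : v ∉ G'.verts) (hverts : ∀ x, x ∈ G.verts ↔ x = v ∨ x ∈ G'.verts)
    (hadj : ∀ a b, G.Adj a b ↔ G'.Adj a b ∨ (a = v ∧ b ∈ p :: (M ++ [q])) ∨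
      (b = v ∧ a ∈ p :: (M ++ [q])))
    (hnx : ∀ a b, Nx (q :: (R ++ [p]) ++ M) a b → G'.Adj a b)
    (hmem : ∀ x ∈ q :: (R ++ [p]) ++ M, x ∈ G'.verts) (hnd : (q :: (R ++ [p]) ++ M).Nodup)
    (h : G'.Drawable (q :: (R ++ [p]) ++ M) ∨
      (q :: (R ++ [p]) ++ M).length = 2 ∧ ∀ x ∈ G'.verts, x ∈ q :: (R ++ [p]) ++ M) :
    G.Drawable (v :: q :: (R ++ [p])) := by
  intro P hP
  have hnd' := hnd
  simp only [List.cons_append, List.nodup_cons, List.nodup_append, List.mem_append, List.mem_cons,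
    not_or, List.append_assoc] at hnd'
  obtain ⟨P', hP1, hP2, hP3, hP4⟩ := hP.exists_cut (M := M)
    (by simp only [List.nodup_cons, List.nodup_append, List.mem_append, List.mem_cons]
        grind) (by grind)
    (by simp only [List.nodup_cons, List.nodup_append, List.mem_append, List.mem_cons]
        grind)
  have hpre : ∃ f, (∀ x ∈ q :: (R ++ [p]) ++ M, f x = P' x) ∧
      G'.Placement (q :: (R ++ [p]) ++ M) f ∧
      ∀ z, (∀ a b, Nx (v :: q :: (R ++ [p])) a b → 0 ≤ cr 1 (P a) (P b) z) →
        G'.Covers (q :: (R ++ [p]) ++ M) f z := by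
    rcases h with h | ⟨h2, hV⟩
    · obtain ⟨f, hf, hp, hc⟩ := h P' hP2
      exact ⟨f, hf, hp, fun z _ => hc z⟩
    · have hR : R = [] := List.eq_nil_of_length_eq_zero (by simp at h2; omega)
      have hM : M = [] := List.eq_nil_of_length_eq_zero (by simp at h2; omega)
      subst hR hM
      have hpos : 0 < cr 1 (P v) (P q) (P p) := by
        simpa [ConvPos, List.triplewise_cons] using hP
      have hV : ∀ x ∈ G'.verts, x = q ∨ x = p := by simpa using hV
      have hpq : G'.Adj q p := hnx q p (by simp [nx_cons])
      have hP'q : P' q = P q := hP1 q (by simp)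
      have hP'p : P' p = P p := hP1 p (by simp)
      have hne : P' q ≠ P' p := by
        rw [hP'q, hP'p]
        exact (cr_ne hpos).2.1
      have hpair : ∀ a b, G'.Adj a b → ({a, b} : Set (ℝ × ℝ)) = {q, p} := by
        intro a b hab
        have h1 := G'.mem_of_adj a b hab
        rcases hV a h1.1 with rfl | rfl <;> rcases hV b h1.2 with rfl | rfl
        · exact (G'.loopless _ hab).elim
        · rfl
        · exact Set.pair_comm _ _
        · exact (G'.loopless _ hab).elim
      refine ⟨P', fun _ _ => rfl, ⟨?_, ?_, ?_, ?_⟩, ?_⟩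
      · intro a ha b hb hab
        rcases hV a ha with rfl | rfl <;> rcases hV b hb with rfl | rfl
        · rfl
        · exact absurd hab hne
        · exact absurd hab.symm hne
        · rfl
      · intro a b c d hab hcd _ _ _
        exact Or.inl ((hpair a b hab).trans (hpair c d hcd).symm)
      · intro a b w hab hw _
        have : w ∈ ({a, b} : Set (ℝ × ℝ)) := by
          rw [hpair a b hab]
          exact hV w hw
        exact this
      · intro w hw
        refine subset_convexHull ℝ _ ⟨w, ?_, rfl⟩
        rcases hV w hw with rfl | rfl <;> simp
      · intro z hz
        have h1 := hz v q (by simp [nx_cons])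
        have h2 := hz p v (by simp [nx_cons])
        rcases lt_trichotomy (cr 1 (P q) (P p) z) 0 with h3 | h3 | h3
        · exact Or.inl ⟨q, p, by simp [nx_cons], by rwa [hP'q, hP'p]⟩
        · exact Or.inr (Or.inl ⟨q, p, hpq, by
            rw [hP'q, hP'p]
            exact mem_segment_of_cr (by rwa [cr_rot]) h3 h2 h1⟩)
        · exact Or.inl ⟨p, q, by simp [nx_cons], by rw [hP'q, hP'p, cr_swap]; linarith⟩
  obtain ⟨f, hf, hp, hc⟩ := hpre
  set g := Function.update f v (P v) with hg
  have hgv : g v = P v := by simp [hg]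
  have hgf : ∀ x ∈ G'.verts, f x = g x := by
    intro x hx
    rw [hg, Function.update_of_ne]
    rintro rfl
    exact hv hx
  have hgP' : ∀ x ∈ q :: (R ++ [p]) ++ M, g x = P' x := fun x hx => by
    rw [← hgf x (hmem x hx), hf x hx]
  have hgP : ∀ x ∈ q :: (R ++ [p]), g x = P x := fun x hx => by
    rw [hgP' x (List.mem_append_left _ hx), hP1 x hx]
  have hgL : ∀ x ∈ v :: q :: (R ++ [p]), g x = P x := by
    intro x hx
    rcases List.mem_cons.mp hx with rfl | hx
    · exact hgv
    · exact hgP x hx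
  have hFm : ∀ x ∈ p :: (M ++ [q]), x ∈ q :: (R ++ [p]) ++ M := by
    intro x hx
    simp only [List.mem_cons, List.mem_append] at hx ⊢
    tauto
  have := Placement.cone (f := g) hv hverts hadj hnx (hP2.congr hgP') hnd
    (fun x hx => by
      rw [hgP' x (by simp [hx]), hgP p (by simp), hgP q (by simp), hgv]
      exact hP3 x hx)
    (hP4.imp_of_mem fun {a b} ha hb hab => by
      rwa [hgv, hgP' a (hFm a ha), hgP' b (hFm b hb)])
    (hp.congr hmem hgf)
    (fun z hz => (hc z fun a b hab => by
      rw [← hgL a hab.mem.1, ← hgL b hab.mem.2]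
      exact hz a b hab).congr hmem hgf)
  exact ⟨g, hgL, this⟩

lemma Fan.disjoint {G : PlaneGraph} {σ : ℝ} {v p q : ℝ × ℝ} {R M : List (ℝ × ℝ)}
    (hF : Fan G σ v (p :: (M ++ [q]))) (hnd : (v :: q :: (R ++ [p])).Nodup)
    (hc : ∀ y ∈ v :: q :: (R ++ [p]), G.Adj v y →
      Nx (v :: q :: (R ++ [p])) v y ∨ Nx (v :: q :: (R ++ [p])) y v) :
    ∀ x ∈ M, x ∉ q :: (R ++ [p]) := by
  intro x hxM hx
  have hv := (List.nodup_cons.mp hnd).1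
  have hF' := hF.nodup
  simp only [List.nodup_cons, List.nodup_append, List.mem_append, List.mem_cons] at hF'
  have hadj : G.Adj v x := (hF.mem_iff x).mp (by simp [hxM])
  rcases hc x (List.mem_cons_of_mem _ hx) hadj with h | h
  · have := eq_of_nx_head' hv h
    grind
  · rw [← List.cons_append] at h hv
    have := eq_of_nx_head hv h
    grind

/-- A boundary vertex on no chord can be removed. -/
lemma Disk.exists_remove {G : PlaneGraph} {σ : ℝ} (hσ : σ ≠ 0) {L : List (ℝ × ℝ)}
    (D : Disk G σ L) (h3 : 3 ≤ L.length) {v : ℝ × ℝ} (hv : v ∈ L)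
    (hc : ∀ y ∈ L, G.Adj v y → Nx L v y ∨ Nx L y v) :
    ∃ A B q R p M, L = A ++ B ∧ B ++ A = v :: q :: (R ++ [p]) ∧
      Fan G σ v (p :: (M ++ [q])) ∧ Disk (G.deleteVerts {v}) σ (q :: (R ++ [p]) ++ M) ∧
      R.length + 3 = L.length := by
  obtain ⟨A, B, q, R, p, rfl, hBA, hR⟩ := exists_nx_decomp h3 hv
  have D' := D.rotate
  rw [hBA] at D'
  obtain ⟨M, hF⟩ := D'.exists_fan'
  refine ⟨A, B, q, R, p, M, rfl, hBA, hF, D'.remove hσ hF (hF.disjoint D'.nodup ?_), hR⟩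
  intro y hy hvy
  rw [← hBA] at hy ⊢
  rw [nx_append_comm, nx_append_comm B A]
  exact hc y (by simp at hy ⊢; tauto) hvy

lemma Disk.drawable_or {G : PlaneGraph} {σ : ℝ} {L : List (ℝ × ℝ)} (D : Disk G σ L)
    (h : 3 ≤ L.length → G.Drawable L) :
    G.Drawable L ∨ L.length = 2 ∧ ∀ x ∈ G.verts, x ∈ L := by
  rcases D.two_le.eq_or_lt with e | e
  · right
    obtain ⟨a, b, rfl⟩ := List.length_eq_two.mp e.symm
    exact ⟨rfl, fun x hx => by simpa using D.verts_of_two hx⟩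
  · exact Or.inl (h e)

lemma Fan.adj_iff {G : PlaneGraph} {σ : ℝ} {v : ℝ × ℝ} {F : List (ℝ × ℝ)} (hF : Fan G σ v F)
    (a b : ℝ × ℝ) : G.Adj a b ↔
      (G.deleteVerts {v}).Adj a b ∨ (a = v ∧ b ∈ F) ∨ (b = v ∧ a ∈ F) := by
  rw [hF.mem_iff, hF.mem_iff]
  simp only [deleteVerts, Finset.mem_singleton]
  constructor
  · intro h
    by_cases ha : a = v
    · subst ha; exact Or.inr (Or.inl ⟨rfl, h⟩)
    · by_cases hb : b = v
      · subst hb; exact Or.inr (Or.inr ⟨rfl, G.symm _ _ h⟩)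
      · exact Or.inl ⟨h, ha, hb⟩
  · rintro (h | ⟨rfl, h⟩ | ⟨rfl, h⟩)
    exacts [h.1, h, G.symm _ _ h]

lemma mem_verts_iff_deleteVerts {G : PlaneGraph} {v : ℝ × ℝ} (hv : v ∈ G.verts) (x : ℝ × ℝ) :
    x ∈ G.verts ↔ x = v ∨ x ∈ (G.deleteVerts {v}).verts := by
  simp only [deleteVerts, Finset.mem_sdiff, Finset.mem_singleton]
  by_cases h : x = v
  · simp [h, hv]
  · simp [h]

/-- A triangulated disk can be drawn inside any strictly convex polygon. -/
lemma Disk.drawable {G : PlaneGraph} {σ : ℝ} (hσ : σ ≠ 0) {L : List (ℝ × ℝ)} (D : Disk G σ L)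
    (h3 : 3 ≤ L.length) : G.Drawable L := by
  induction hn : G.verts.card using Nat.strong_induction_on generalizing G L with
  | _ n ih =>
    subst hn
    obtain ⟨a, N, b, rfl, hN⟩ : ∃ a N b, L = a :: N ++ b :: [] ∧ N ≠ [] := by
      match L, h3 with
      | a :: c :: L, h3 =>
        rcases List.eq_nil_or_concat (c :: L) with h | ⟨N, b, h⟩
        · simp at h
        · rw [List.concat_eq_append] at h
          rw [h]
          refine ⟨a, N, b, rfl, ?_⟩
          rintro rfl
          simp at h
          simp [h] at h3
    have hba : G.Adj b a := D.adj b a (by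
      rw [nx_append_cons]
      right
      simp)
    obtain ⟨x, hxN, hx⟩ := D.exists_chordless hσ hba hN
    obtain ⟨A, B, q, R, p, M, hAB, hBA, hF, D', -⟩ :=
      D.exists_remove hσ h3 (v := x) (by simp [hxN]) hx
    rw [hAB]
    apply Drawable.rotate
    rw [hBA]
    have hxv : x ∈ G.verts := D.mem_verts (by simp [hxN])
    refine drawable_cone (G' := G.deleteVerts {x}) (by simp [deleteVerts])
      (mem_verts_iff_deleteVerts hxv) hF.adj_iff D'.adj (fun y hy => D'.mem_verts hy) D'.nodup
      (D'.drawable_or fun h => ih _ ?_ D' h rfl)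
    refine Finset.card_lt_card
      (Finset.ssubset_iff_of_subset Finset.sdiff_subset |>.mpr ⟨x, hxv, ?_⟩)
    simp

lemma Drawable.exists_nearTriangulation {G : PlaneGraph} {L : List (ℝ × ℝ)} (h : G.Drawable L)
    (hL : L.Nodup) (hb : G.Biconnected) :
    ∃ H : PlaneGraph, H.IsNearTriangulation ∧ G.IsIsoTo H := by
  obtain ⟨P, hP⟩ := exists_convPos hL
  obtain ⟨f, hf, hp, hc⟩ := h P hP
  exact hp.exists_nearTriangulation hc (hP.congr hf) hL hb

/-! ### The disk of a near-triangulation -/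

/-- The left-hand side of the dart from `a` to `b` is not a triangular face. -/
def OpenDart (G : PlaneGraph) (a b : ℝ × ℝ) : Prop := ¬ ∃ c, Face G 1 a b c

lemma card_openDart (G : PlaneGraph) (hG : G.IsEmbedded) (v : ℝ × ℝ) :
    ((G.verts.filter (G.Adj v)).filter fun a => G.OpenDart v a).card =
      ((G.verts.filter (G.Adj v)).filter fun a => G.OpenDart a v).card := by
  set N := G.verts.filter (G.Adj v) with hN
  have hmem : ∀ a, a ∈ N ↔ G.Adj v a := by
    intro a
    rw [hN, Finset.mem_filter]
    exact ⟨fun h => h.2, fun h => ⟨(G.mem_of_adj _ _ h).2, h⟩⟩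
  have key : (N.filter fun a => ∃ c, Face G 1 v a c).card =
      (N.filter fun a => ∃ c, Face G 1 a v c).card := by
    refine Finset.card_bij (fun a ha => (Finset.mem_filter.mp ha).2.choose) ?_ ?_ ?_
    · intro a ha
      have h := (Finset.mem_filter.mp ha).2.choose_spec
      exact Finset.mem_filter.mpr ⟨(hmem _).mpr (G.symm _ _ h.2.2.1), a, h.rot.rot⟩
    · intro a ha b hb hab
      have h := (Finset.mem_filter.mp ha).2.choose_spec
      have h' := (Finset.mem_filter.mp hb).2.choose_spec
      rw [← hab] at h'
      exact Face.unique' hG h h'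
    · intro c hc
      obtain ⟨hcN, a, ha⟩ := Finset.mem_filter.mp hc
      have haF : a ∈ N.filter fun a => ∃ c, Face G 1 v a c :=
        Finset.mem_filter.mpr ⟨(hmem a).mpr ha.2.1, c, ha.rot⟩
      exact ⟨a, haF, Face.unique hG (Finset.mem_filter.mp haF).2.choose_spec ha.rot⟩
  have h1 := Finset.card_filter_add_card_filter_not (s := N) fun a => ∃ c, Face G 1 v a c
  have h2 := Finset.card_filter_add_card_filter_not (s := N) fun a => ∃ c, Face G 1 a v c
  have h1' : (N.filter fun a => G.OpenDart v a).card =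
      (N.filter fun a => ¬ ∃ c, Face G 1 v a c).card := by
    unfold OpenDart
    congr!
  have h2' : (N.filter fun a => G.OpenDart a v).card =
      (N.filter fun a => ¬ ∃ c, Face G 1 a v c).card := by
    unfold OpenDart
    congr!
  omega

/-- The excess of open left-hand sides over open right-hand sides of a dart. -/
def openSign (G : PlaneGraph) (a b : ℝ × ℝ) : ℤ :=
  (if G.OpenDart a b then 1 else 0) - (if G.OpenDart b a then 1 else 0)

lemma openSign_eq {G : PlaneGraph} (hG : G.IsEmbedded) {v s t : ℝ × ℝ} (hs : G.Adj v s)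
    (ht : G.Adj v t) (hst : s ≠ t)
    (h : ∀ a, G.Adj v a → G.OpenDart v a ∨ G.OpenDart a v → a = s ∨ a = t) :
    G.openSign t v = G.openSign v s := by
  have e := G.card_openDart hG v
  have key : ∀ (r : ℝ × ℝ → Prop), (∀ a, G.Adj v a → r a → a = s ∨ a = t) →
      (((G.verts.filter (G.Adj v)).filter r).card : ℤ) =
        (if r s then 1 else 0) + (if r t then 1 else 0) := by
    intro r hr
    have : (G.verts.filter (G.Adj v)).filter r = ({s, t} : Finset (ℝ × ℝ)).filter r := by
      ext a
      simp only [Finset.mem_filter, Finset.mem_insert, Finset.mem_singleton]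
      constructor
      · rintro ⟨⟨-, ha⟩, hra⟩
        exact ⟨hr a ha hra, hra⟩
      · rintro ⟨rfl | rfl, hra⟩
        · exact ⟨⟨(G.mem_of_adj _ _ hs).2, hs⟩, hra⟩
        · exact ⟨⟨(G.mem_of_adj _ _ ht).2, ht⟩, hra⟩
    rw [this, Finset.card_filter, Finset.sum_pair hst]
    push_cast
    rfl
  have e1 := key (fun a => G.OpenDart v a) fun a ha hra => h a ha (Or.inl hra)
  have e2 := key (fun a => G.OpenDart a v) fun a ha hra => h a ha (Or.inr hra)
  unfold openSign
  rw [← e] at e2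
  linarith

lemma eq_or_eq_of_openDarts {G : PlaneGraph} (hG : G.IsEmbedded) {v s t : ℝ × ℝ}
    (hs : G.Adj v s)
    (h : ∀ a, G.Adj v a → G.OpenDart v a ∨ G.OpenDart a v → a = s ∨ a = t)
    (hvs : G.OpenDart v s) (hsv : G.OpenDart s v) (hvt : G.OpenDart v t) (htv : G.OpenDart t v)
    {a : ℝ × ℝ} (ha : G.Adj v a) : a = s ∨ a = t := by
  by_contra hne
  have hK : ∀ a ∈ {a | G.Adj v a ∧ ¬ (a = s ∨ a = t)},
      ¬ G.OpenDart v a ∧ ¬ G.OpenDart a v := fun a ha =>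
    ⟨fun h' => ha.2 (h a ha.1 (Or.inl h')), fun h' => ha.2 (h a ha.1 (Or.inr h'))⟩
  have := mem_of_closed_link (σ := 1) (K := {a | G.Adj v a ∧ ¬ (a = s ∨ a = t)}) hG ⟨a, ha, hne⟩
    (fun a ha => ?_) (fun a ha => ?_) hs
  · exact this.2 (Or.inl rfl)
  · obtain ⟨c, hc⟩ := not_not.mp (hK a ha).1
    refine ⟨c, ⟨G.symm _ _ hc.2.2.1, ?_⟩, hc⟩
    rintro (rfl | rfl)
    exacts [hsv ⟨a, hc.rot.rot⟩, htv ⟨a, hc.rot.rot⟩]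
  · obtain ⟨c, hc⟩ := not_not.mp (hK a ha).2
    refine ⟨c, ⟨hc.2.1, ?_⟩, hc.rot⟩
    rintro (rfl | rfl)
    exacts [hvs ⟨a, hc.rot⟩, hvt ⟨a, hc.rot⟩]

section Boundary

variable {T : PlaneGraph} {h : ℕ} {u : ZMod h → ℝ × ℝ}

lemma openDart_boundary (hT : T.IsNearTriangulation) (hu : T.IsBoundaryCycle u)
    (hnd : T.HasNoDiagonals u) {a b : ℝ × ℝ} (hab : T.Adj a b) (ho : T.OpenDart a b) :
    ∃ j k, a = u j ∧ b = u k ∧ (k = j + 1 ∨ j = k + 1) := by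
  have hcl := segment_subset_closure_outerRegion hT.1 hT.2.2 one_ne_zero hab ho
  have hfr : ∀ x, x ∈ segment ℝ a b → x ∈ frontier T.outerRegion := by
    intro x hx
    rw [(isOpen_outerRegion T).frontier_eq]
    exact ⟨hcl hx, fun h => h.1 ⟨a, b, hab, hx⟩⟩
  obtain ⟨j, rfl⟩ := hu.2.2.2.2.2 a (T.mem_of_adj _ _ hab).1 (hfr a (left_mem_segment _ _ _))
  obtain ⟨k, rfl⟩ := hu.2.2.2.2.2 b (T.mem_of_adj _ _ hab).2 (hfr b (right_mem_segment _ _ _))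
  exact ⟨j, k, rfl, rfl, hnd j k hab⟩

lemma openDart_or (hT : T.IsNearTriangulation) (hu : T.IsBoundaryCycle u) (j : ZMod h) :
    T.OpenDart (u j) (u (j + 1)) ∨ T.OpenDart (u (j + 1)) (u j) := by
  by_contra! hcon
  simp only [OpenDart, not_not] at hcon
  obtain ⟨⟨c, hc⟩, d, hd⟩ := hcon
  obtain ⟨m, hm⟩ : (openSegment ℝ (u j) (u (j + 1))).Nonempty :=
    ⟨_, 1 / 2, 1 / 2, by norm_num, by norm_num, by norm_num, rfl⟩
  exact not_mem_closure_outerRegion one_ne_zero hc hd hm hT.1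
    (frontier_subset_closure (hu.2.2.2.2.1 j (openSegment_subset_segment _ _ _ hm)))

/-- The boundary cycle runs consistently around the outer region. -/
lemma exists_orientation (hT : T.IsNearTriangulation) (hu : T.IsBoundaryCycle u)
    (hnd : T.HasNoDiagonals u) (hint : ∃ v, T.IsInteriorVtx u v) :
    ∃ σ : ℝ, σ ≠ 0 ∧ ∀ a b, T.Adj a b →
      ((∃ c, Face T σ a b c) ↔ ¬ ∃ j, b = u j ∧ a = u (j + 1)) := by
  have h3 := hu.1
  have hinj := hu.2.1
  have : NeZero h := ⟨by omega⟩
  have hone : (1 : ZMod h) ≠ 0 := by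
    have : Fact (1 < h) := ⟨by omega⟩
    exact one_ne_zero
  have htwo : (1 : ZMod h) + 1 ≠ 0 := by
    intro e
    have : ((2 : ℕ) : ZMod h) = 0 := by push_cast; rw [← e]; norm_num
    rw [ZMod.natCast_eq_zero_iff] at this
    exact absurd (Nat.le_of_dvd (by norm_num) this) (by omega)
  have hnb : ∀ j a, T.Adj (u j) a → T.OpenDart (u j) a ∨ T.OpenDart a (u j) →
      a = u (j + 1) ∨ a = u (j - 1) := by
    intro j a ha ho
    have : ∃ k, a = u k ∧ (k = j + 1 ∨ j = k + 1) := by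
      rcases ho with ho | ho
      · obtain ⟨j', k, e, rfl, h'⟩ := openDart_boundary hT hu hnd ha ho
        obtain rfl := hinj e
        exact ⟨k, rfl, h'⟩
      · obtain ⟨k, j', rfl, e, h'⟩ := openDart_boundary hT hu hnd (T.symm _ _ ha) ho
        obtain rfl := hinj e
        exact ⟨k, rfl, h'.symm⟩
    obtain ⟨k, rfl, rfl | rfl⟩ := this
    · exact Or.inl rfl
    · right; congr 1; ring
  have hprev : ∀ j, T.Adj (u j) (u (j - 1)) := by
    intro j
    have := hu.2.2.2.1 (j - 1)
    rw [sub_add_cancel] at this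
    exact T.symm _ _ this
  have hstep : ∀ j, T.openSign (u (j - 1)) (u j) = T.openSign (u j) (u (j + 1)) := by
    intro j
    refine openSign_eq hT.1 (hu.2.2.2.1 j) (hprev j) (fun e => htwo ?_) (hnb j)
    have := hinj e
    linear_combination this
  have hconst : ∀ j, T.openSign (u j) (u (j + 1)) = T.openSign (u 0) (u 1) := by
    have : ∀ n : ℕ, T.openSign (u n) (u (n + 1)) = T.openSign (u 0) (u 1) := by
      intro n
      induction n with
      | zero => simp
      | succ n ih =>
        have := hstep ((n + 1 : ℕ) : ZMod h)
        rw [← this, ← ih]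
        push_cast
        rw [add_sub_cancel_right]
    intro j
    simpa using this j.val
  by_cases hpos : T.OpenDart (u 0) (u 1) <;> by_cases hneg : T.OpenDart (u 1) (u 0)
  · exfalso
    have hboth : ∀ j, T.OpenDart (u j) (u (j + 1)) ∧ T.OpenDart (u (j + 1)) (u j) := by
      intro j
      have e := hconst j
      have e' := openDart_or hT hu j
      unfold openSign at e
      simp only [hpos, hneg, if_true] at e
      by_cases h1 : T.OpenDart (u j) (u (j + 1)) <;>
        by_cases h2 : T.OpenDart (u (j + 1)) (u j) <;> simp [h1, h2] at e e' ⊢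
    obtain ⟨w, hw, hwu⟩ := hint
    have hreach : ∀ x, T.Reachable (u 0) x → x ∈ Set.range u := by
      intro x hx
      induction hx with
      | refl => exact ⟨0, rfl⟩
      | tail _ hbc ih =>
        obtain ⟨j, rfl⟩ := ih
        have hb := hboth (j - 1)
        rw [sub_add_cancel] at hb
        rcases eq_or_eq_of_openDarts hT.1 (hu.2.2.2.1 j) (hnb j) (hboth j).1 (hboth j).2
          hb.2 hb.1 hbc with rfl | rfl
        exacts [⟨_, rfl⟩, ⟨_, rfl⟩]
    exact hwu (hreach w (hT.2.1.2.1.2 _ (hu.2.2.1 0) w hw))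
  · refine ⟨-1, by norm_num, fun a b hab => ?_⟩
    have hall : ∀ j, T.OpenDart (u j) (u (j + 1)) ∧ ¬ T.OpenDart (u (j + 1)) (u j) := by
      intro j
      have e := hconst j
      unfold openSign at e
      simp only [hpos, hneg, if_true, if_false] at e
      by_cases h1 : T.OpenDart (u j) (u (j + 1)) <;>
        by_cases h2 : T.OpenDart (u (j + 1)) (u j) <;> simp [h1, h2] at e ⊢
    simp only [face_neg]
    rw [← not_iff_not, not_not]
    change T.OpenDart b a ↔ _
    constructor
    · intro ho
      obtain ⟨j, k, rfl, rfl, rfl | rfl⟩ := openDart_boundary hT hu hnd (T.symm _ _ hab) ho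
      · exact ⟨_, rfl, rfl⟩
      · exact absurd ho (hall _).2
    · rintro ⟨j, rfl, rfl⟩
      exact (hall j).1
  · refine ⟨1, by norm_num, fun a b hab => ?_⟩
    have hall : ∀ j, T.OpenDart (u (j + 1)) (u j) ∧ ¬ T.OpenDart (u j) (u (j + 1)) := by
      intro j
      have e := hconst j
      unfold openSign at e
      simp only [hpos, hneg, if_true, if_false] at e
      by_cases h1 : T.OpenDart (u j) (u (j + 1)) <;>
        by_cases h2 : T.OpenDart (u (j + 1)) (u j) <;> simp [h1, h2] at e ⊢
    rw [← not_iff_not, not_not]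
    change T.OpenDart a b ↔ _
    constructor
    · intro ho
      obtain ⟨j, k, rfl, rfl, rfl | rfl⟩ := openDart_boundary hT hu hnd hab ho
      · exact absurd ho (hall _).2
      · exact ⟨_, rfl, rfl⟩
    · rintro ⟨j, rfl, rfl⟩
      exact (hall j).1
  · have := openDart_or hT hu 0
    rw [zero_add] at this
    tauto

lemma adjc_map_range {α : Type*} (g : ℕ → α) (n : ℕ) (x y : α) :
    Adjc ((List.range (n + 1)).map g) x y ↔ ∃ k < n, x = g k ∧ y = g (k + 1) := by
  induction n with
  | zero => simp
  | succ n ih =>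
    rw [List.range_succ, List.range_succ, List.map_append, List.map_append, List.append_assoc]
    simp only [List.map_cons, List.map_nil, List.cons_append, List.nil_append]
    rw [adjc_append_cons]
    rw [List.range_succ, List.map_append] at ih
    simp only [List.map_cons, List.map_nil] at ih
    rw [ih]
    simp only [adjc_cons_cons, adjc_singleton, or_false]
    constructor
    · rintro (⟨k, hk, h⟩ | h)
      exacts [⟨k, by omega, h⟩, ⟨n, by omega, h⟩]
    · rintro ⟨k, hk, h⟩
      rcases Nat.lt_succ_iff_lt_or_eq.mp hk with hk | rfl
      exacts [Or.inl ⟨k, hk, h⟩, Or.inr h]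

/-- A near-triangulation without diagonals is a triangulated disk whose boundary has no
chords. -/
lemma exists_disk (hT : T.IsNearTriangulation) (hu : T.IsBoundaryCycle u)
    (hnd : T.HasNoDiagonals u) (hint : ∃ v, T.IsInteriorVtx u v) (i : ZMod h) :
    ∃ σ : ℝ, σ ≠ 0 ∧ ∃ R, Disk T σ (u i :: u (i + 1) :: (R ++ [u (i - 1)])) ∧
      (∀ x, x ∈ u i :: u (i + 1) :: (R ++ [u (i - 1)]) ↔ x ∈ Set.range u) ∧
      ∀ j k, T.Adj (u j) (u k) → Nx (u i :: u (i + 1) :: (R ++ [u (i - 1)])) (u j) (u k) ∨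
        Nx (u i :: u (i + 1) :: (R ++ [u (i - 1)])) (u k) (u j) := by
  obtain ⟨σ, hσ, hface⟩ := exists_orientation hT hu hnd hint
  have h3 := hu.1
  have : NeZero h := ⟨by omega⟩
  set g : ℕ → ℝ × ℝ := fun k => u (i + k) with hg
  obtain ⟨m, rfl⟩ : ∃ m, h = m + 3 := ⟨h - 3, by omega⟩
  have hz : (m : ZMod (m + 3)) + 3 = 0 := by
    have := ZMod.natCast_self (m + 3)
    push_cast at this
    exact this
  have hlast : g (m + 2) = u (i - 1) := by
    simp only [hg]
    congr 1
    push_cast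
    linear_combination hz
  have hL : (List.range (m + 3)).map g =
      u i :: u (i + 1) :: (((List.range m).map fun k => g (k + 2)) ++ [u (i - 1)]) := by
    rw [List.range_succ_eq_map, List.range_succ_eq_map, List.range_succ]
    simp [Function.comp_def, hlast]
    simp [hg]
  have hL' : u i :: u (i + 1) :: (((List.range m).map fun k => g (k + 2)) ++ [u (i - 1)]) ++
      [u i] = (List.range (m + 3 + 1)).map g := by
    rw [← hL, List.range_succ (n := m + 3), List.map_append]
    have : g (m + 3) = u i := by
      simp only [hg]
      congr 1
      push_cast
      linear_combination hz
    simp [this]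
  have hsurj : ∀ j, ∃ k < m + 3, i + (k : ZMod (m + 3)) = j := by
    intro j
    refine ⟨(j - i).val, ZMod.val_lt _, ?_⟩
    rw [ZMod.natCast_zmod_val]
    ring
  have hnx : ∀ x y, Nx (u i :: u (i + 1) :: (((List.range m).map fun k => g (k + 2)) ++
      [u (i - 1)])) x y ↔ ∃ j, x = u j ∧ y = u (j + 1) := by
    intro x y
    have : Nx (u i :: u (i + 1) :: (((List.range m).map fun k => g (k + 2)) ++
      [u (i - 1)])) x y ↔ Adjc (u i :: u (i + 1) :: (((List.range m).map fun k => g (k + 2)) ++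
      [u (i - 1)]) ++ [u i]) x y := Iff.rfl
    rw [this, hL', adjc_map_range]
    constructor
    · rintro ⟨k, hk, rfl, rfl⟩
      refine ⟨i + k, rfl, ?_⟩
      simp only [hg]
      congr 1
      push_cast
      ring
    · rintro ⟨j, rfl, rfl⟩
      obtain ⟨k, hk, rfl⟩ := hsurj j
      refine ⟨k, hk, rfl, ?_⟩
      simp only [hg]
      congr 1
      push_cast
      ring
  refine ⟨σ, hσ, (List.range m).map fun k => g (k + 2),
    ⟨hT.1, hT.2.2, hT.2.1.2.1, ?_, by simp, ?_, ?_⟩, ?_, ?_⟩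
  · rw [← hL, List.nodup_map_iff_inj_on List.nodup_range]
    intro a ha b hb hab
    have e := add_left_cancel (hu.2.1 hab)
    rw [List.mem_range] at ha hb
    rw [ZMod.natCast_eq_natCast_iff'] at e
    rwa [Nat.mod_eq_of_lt ha, Nat.mod_eq_of_lt hb] at e
  · intro a b hab
    obtain ⟨j, rfl, rfl⟩ := (hnx a b).mp hab
    exact hu.2.2.2.1 j
  · intro a b hab
    rw [hface a b hab, hnx]
  · intro x
    rw [← hL, List.mem_map]
    constructor
    · rintro ⟨k, -, rfl⟩
      exact ⟨_, rfl⟩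
    · rintro ⟨j, rfl⟩
      obtain ⟨k, hk, rfl⟩ := hsurj j
      exact ⟨k, List.mem_range.mpr hk, rfl⟩
  · intro j k hjk
    rw [hnx, hnx]
    rcases hnd j k hjk with rfl | rfl
    exacts [Or.inl ⟨_, rfl, rfl⟩, Or.inr ⟨_, rfl, rfl⟩]

end Boundary

/-! ### Contracting or deleting -/

lemma Connected.of_le {G K : PlaneGraph} (hG : G.Connected) {p : ℝ × ℝ}
    (hverts : ∀ x, x ∈ K.verts → x = p ∨ x ∈ G.verts) (hle : ∀ a b, G.Adj a b → K.Adj a b)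
    (hsub : ∀ x ∈ G.verts, x ∈ K.verts) (hp : p ∈ K.verts → ∃ y ∈ G.verts, K.Adj p y) :
    K.Connected := by
  obtain ⟨⟨z, hz⟩, hc⟩ := hG
  have hz' : ∀ x ∈ K.verts, K.Reachable z x := by
    have hmono : ∀ x ∈ G.verts, K.Reachable z x := fun x hx =>
      Relation.ReflTransGen.mono hle _ _ (hc z hz x hx)
    intro x hx
    rcases hverts x hx with rfl | h
    · obtain ⟨y, hy, hxy⟩ := hp hx
      exact (hmono y hy).tail (K.symm _ _ hxy)
    · exact hmono x h
  exact ⟨⟨z, hsub z hz⟩, fun x hx y hy => (reachable_symm (hz' x hx)).trans (hz' y hy)⟩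

/-- Adding a vertex with two neighbours preserves biconnectivity. -/
lemma Biconnected.cone {G K : PlaneGraph} (hG : G.Biconnected) {p s t : ℝ × ℝ}
    (hverts : ∀ x, x ∈ K.verts ↔ x = p ∨ x ∈ G.verts) (hle : ∀ a b, G.Adj a b → K.Adj a b)
    (hs : s ∈ G.verts) (ht : t ∈ G.verts) (hst : s ≠ t) (hps : K.Adj p s) (hpt : K.Adj p t) :
    K.Biconnected := by
  have hsub : ∀ x ∈ G.verts, x ∈ K.verts := fun x hx => (hverts x).mpr (Or.inr hx)
  refine ⟨hG.1.trans (Finset.card_le_card hsub),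
    hG.2.1.of_le (fun x hx => (hverts x).mp hx) hle hsub fun _ => ⟨s, hs, hps⟩, fun w hw => ?_⟩
  have key : ∀ y ∈ G.verts, y ≠ w → y ∈ (G.deleteVerts {w}).verts := fun y hy hyw => by
    simp [deleteVerts, hy, hyw]
  by_cases hwG : w ∈ G.verts
  · refine (hG.2.2 w hwG).of_le (p := p) ?_ ?_ ?_ ?_
    · intro x hx
      simp only [deleteVerts, Finset.mem_sdiff, Finset.mem_singleton, hverts] at hx ⊢
      tauto
    · exact fun a b h => ⟨hle _ _ h.1, h.2⟩
    · intro x hx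
      simp only [deleteVerts, Finset.mem_sdiff, Finset.mem_singleton, hverts] at hx ⊢
      tauto
    · intro hp
      have hpw : p ∉ ({w} : Finset (ℝ × ℝ)) := (Finset.mem_sdiff.mp hp).2
      by_cases hsw : s = w
      · exact ⟨t, key t ht (hsw ▸ hst.symm), hpt, hpw, by simpa using (hsw ▸ hst.symm)⟩
      · exact ⟨s, key s hs hsw, hps, hpw, by simpa using hsw⟩
  · have hwp : w = p := ((hverts w).mp hw).resolve_right hwG
    subst hwp
    refine hG.2.1.of_le (p := w) ?_ ?_ ?_ ?_
    · intro x hx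
      simp only [deleteVerts, Finset.mem_sdiff, Finset.mem_singleton, hverts] at hx ⊢
      tauto
    · intro a b h
      have := G.mem_of_adj _ _ h
      refine ⟨hle _ _ h, ?_, ?_⟩ <;> rw [Finset.mem_singleton] <;> rintro rfl
      exacts [hwG this.1, hwG this.2]
    · intro x hx
      simp only [deleteVerts, Finset.mem_sdiff, Finset.mem_singleton, hverts]
      exact ⟨Or.inr hx, fun h => hwG (h ▸ hx)⟩
    · intro hp
      simp [deleteVerts] at hp

lemma deleteVerts_pair (G : PlaneGraph) (v x : ℝ × ℝ) :
    (G.deleteVerts {v}).deleteVerts {x} = G.deleteVerts {v, x} := by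
  simp only [deleteVerts, PlaneGraph.mk.injEq]
  constructor
  · ext y
    simp only [Finset.mem_sdiff, Finset.mem_singleton, Finset.mem_insert]
    tauto
  · funext a b
    simp only [Finset.mem_singleton, Finset.mem_insert]
    rw [eq_iff_iff]
    tauto

lemma IsContractible.of_isNearTriangulation_deleteVerts {G : PlaneGraph} {p v : ℝ × ℝ}
    (hpv : G.Adj p v) (hG : (G.deleteVerts {v}).IsNearTriangulation)
    (h : ∀ x, G.Adj v x → x ≠ p → G.Adj p x) : G.IsContractible p v := by
  refine ⟨hpv, G.deleteVerts {v}, hG, id, ?_, fun a ha b hb => ?_⟩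
  · have : (G.contractEdge p v).verts = (G.deleteVerts {v}).verts := by
      ext x
      simp only [contractEdge, deleteVerts, Finset.mem_erase, Finset.mem_sdiff,
        Finset.mem_singleton]
      tauto
    rw [this]
    exact Set.bijOn_id _
  · have ha' := Finset.mem_erase.mp ha
    have hb' := Finset.mem_erase.mp hb
    simp only [contractEdge, deleteVerts, id, Finset.mem_singleton]
    constructor
    · rintro ⟨hab, -, -, h1 | ⟨rfl, h1⟩ | ⟨rfl, h1⟩⟩
      · exact ⟨h1, ha'.1, hb'.1⟩
      · exact ⟨h b h1 (Ne.symm hab), ha'.1, hb'.1⟩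
      · exact ⟨G.symm _ _ (h a h1 hab), ha'.1, hb'.1⟩
    · rintro ⟨h1, -, -⟩
      exact ⟨fun e => G.loopless a (by rw [← e] at h1; exact h1), ha, hb, Or.inl h1⟩

/-- The boundary edge from `p` to `v` can be contracted if `p` is on no chord of the disk obtained
by removing `v`. -/
lemma Disk.isContractible {G : PlaneGraph} {σ : ℝ} (hσ : σ ≠ 0) {v q s p m : ℝ × ℝ}
    {R M : List (ℝ × ℝ)} (D : Disk G σ (v :: q :: (R ++ [s] ++ [p])))
    (hF : Fan G σ v (p :: (m :: M ++ [q])))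
    (D' : Disk (G.deleteVerts {v}) σ (q :: (R ++ [s] ++ [p]) ++ m :: M))
    (hc : ∀ y ∈ q :: (R ++ [s] ++ [p]) ++ m :: M, G.Adj p y → y = s ∨ y = m) :
    G.IsContractible p v := by
  have hpv : G.Adj p v := D.adj _ _ (by
    rw [nx_cons]
    have : v :: (q :: (R ++ [s] ++ [p]) ++ [v]) = (v :: q :: (R ++ [s])) ++ p :: [v] := by simp
    rw [this, adjc_append_cons]; simp)
  have D1 : Disk (G.deleteVerts {v}) σ (p :: m :: ((M ++ q :: R) ++ [s])) := by
    have e : q :: (R ++ [s] ++ [p]) ++ m :: M = (q :: (R ++ [s])) ++ (p :: m :: M) := by simp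
    rw [e] at D'
    simpa using D'.rotate
  obtain ⟨M', hF'⟩ := D1.exists_fan'
  have hmemv : ∀ y, y ∈ p :: m :: ((M ++ q :: R) ++ [s]) ↔
      y ∈ q :: (R ++ [s] ++ [p]) ++ m :: M := by
    intro y; simp; tauto
  have hM' : ∀ x ∈ M', x ∉ m :: ((M ++ q :: R) ++ [s]) := by
    refine hF'.disjoint D1.nodup fun y hy hpy => ?_
    rcases hc y ((hmemv y).mp hy) hpy.1 with rfl | rfl
    · right
      rw [nx_cons]
      have : p :: (m :: ((M ++ q :: R) ++ [y]) ++ [p]) =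
        (p :: m :: (M ++ q :: R)) ++ y :: [p] := by simp
      rw [this, adjc_append_cons]; simp
    · left
      rw [nx_cons]; simp
  have D2 : Disk ((G.deleteVerts {v}).deleteVerts {p}) σ
      (q :: (R ++ [s]) ++ (M' ++ m :: M)) := by
    have := D1.remove hσ hF' hM'
    have e : m :: ((M ++ q :: R) ++ [s]) ++ M' = (m :: M) ++ (q :: (R ++ [s]) ++ M') := by simp
    rw [e] at this
    simpa using this.rotate
  set G2 := (G.deleteVerts {v}).deleteVerts {p} with hG2
  have h3 : 3 ≤ (q :: (R ++ [s]) ++ (M' ++ m :: M)).length := by simp; omega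
  have hvp : v ≠ p := fun e => G.loopless p (by rw [e] at hpv; exact hpv)
  have hGv := (G.mem_of_adj _ _ hpv).2
  have hGp := (G.mem_of_adj _ _ hpv).1
  have hverts : ∀ x, x ∈ (G.contractEdge p v).verts ↔ x = p ∨ x ∈ G2.verts := by
    intro x
    simp only [contractEdge, hG2, deleteVerts, Finset.mem_erase, Finset.mem_sdiff,
      Finset.mem_singleton]
    by_cases hx : x = p
    · subst hx; simp [hGp, hvp.symm]
    · simp [hx]; tauto
  have hadj2 : ∀ a b, G2.Adj a b ↔ G.Adj a b ∧ a ≠ v ∧ b ≠ v ∧ a ≠ p ∧ b ≠ p := by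
    intro a b
    simp only [hG2, deleteVerts, Finset.mem_singleton]
    tauto
  have hpF : ∀ x, x ≠ v → (G.Adj p x ↔ x ∈ s :: (M' ++ [m])) := by
    intro x hx
    rw [hF'.mem_iff]
    simp [deleteVerts, hx, hvp.symm]
  have hpn : p ∉ s :: ((M' ++ m :: M) ++ [q]) := by
    have h1 := D1.nodup
    have h2 := hF'.mem_iff p
    have h3 := (G.deleteVerts {v}).loopless p
    simp at h1 h2 ⊢
    tauto
  have hvn : v ∉ s :: ((M' ++ m :: M) ++ [q]) := by
    intro hv
    have : v ∈ G2.verts := D2.mem_verts (by simp at hv ⊢; tauto)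
    simp [hG2, deleteVerts] at this
  have hnb : ∀ x, x ≠ p → x ≠ v →
      (x ∈ s :: ((M' ++ m :: M) ++ [q]) ↔ G.Adj p x ∨ G.Adj v x) := by
    intro x hxp hxv
    rw [hpF x hxv, ← hF.mem_iff]
    simp
    tauto
  have hadj : ∀ a b, (G.contractEdge p v).Adj a b ↔ G2.Adj a b ∨
      (a = p ∧ b ∈ s :: ((M' ++ m :: M) ++ [q])) ∨
      (b = p ∧ a ∈ s :: ((M' ++ m :: M) ++ [q])) := by
    have hmemG : ∀ x, G.Adj p x ∨ G.Adj v x → x ∈ G.verts := fun x hx =>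
      hx.elim (fun h => (G.mem_of_adj _ _ h).2) fun h => (G.mem_of_adj _ _ h).2
    intro a b
    rw [hadj2]
    simp only [contractEdge, Finset.mem_erase]
    constructor
    · rintro ⟨hab, ⟨hav, -⟩, ⟨hbv, -⟩, h⟩
      by_cases hap : a = p
      · subst hap
        rw [hnb b (Ne.symm hab) hbv]
        right; left
        refine ⟨rfl, ?_⟩
        rcases h with h | h | h
        exacts [Or.inl h, Or.inr h.2, absurd h.1.symm hab]
      · by_cases hbp : b = p
        · subst hbp
          rw [hnb a hab hav]
          right; right
          refine ⟨rfl, ?_⟩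
          rcases h with h | h | h
          exacts [Or.inl (G.symm _ _ h), absurd h.1 hab, Or.inr h.2]
        · left
          exact ⟨h.resolve_right (by tauto), hav, hbv, hap, hbp⟩
    · rintro (⟨h, h1, h2, -, -⟩ | ⟨rfl, h⟩ | ⟨rfl, h⟩)
      · have := G.mem_of_adj _ _ h
        exact ⟨fun e => G.loopless a (by rw [← e] at h; exact h), ⟨h1, this.1⟩, ⟨h2, this.2⟩,
          Or.inl h⟩
      · have h1 : b ≠ a := fun e => hpn (e ▸ h)
        have h2 : b ≠ v := fun e => hvn (e ▸ h)
        rw [hnb b h1 h2] at h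
        exact ⟨h1.symm, ⟨hvp.symm, hGp⟩, ⟨h2, hmemG b h⟩, by tauto⟩
      · have h1 : a ≠ b := fun e => hpn (e ▸ h)
        have h2 : a ≠ v := fun e => hvn (e ▸ h)
        rw [hnb a h1 h2] at h
        exact ⟨h1, ⟨h2, hmemG a h⟩, ⟨hvp.symm, hGp⟩, h.elim
          (fun h => Or.inl (G.symm _ _ h)) fun h => Or.inr (Or.inr ⟨rfl, h⟩)⟩
  have hdraw : (G.contractEdge p v).Drawable (p :: q :: (R ++ [s])) :=
    drawable_cone (by simp [hG2, deleteVerts]) hverts hadj D2.adj (fun x hx => D2.mem_verts hx)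
      D2.nodup (Or.inl (D2.drawable hσ h3))
  have hqs : q ≠ s := by
    have := D2.nodup
    simp at this
    tauto
  refine ⟨hpv, hdraw.exists_nearTriangulation ?_ ((D2.biconnected h3).cone (s := s) (t := q)
    hverts (fun a b h => (hadj a b).mpr (Or.inl h)) (D2.mem_verts (by simp))
    (D2.mem_verts (by simp)) hqs.symm ?_ ?_)⟩
  · refine List.nodup_cons.mpr ⟨?_, D2.nodup.sublist (List.sublist_append_left _ _)⟩
    have := D1.nodup
    simp at this ⊢
    tauto
  · rw [hadj]; right; left; simp
  · rw [hadj]; right; left; simp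

/-- In a triangulated disk whose boundary has no chords, either the boundary edge from `p` to `v`
can be contracted, or `v` and one of its inner neighbours can be deleted. -/
lemma Disk.exists_deleteVerts_pair {G : PlaneGraph} {σ : ℝ} (hσ : σ ≠ 0) {v p q : ℝ × ℝ}
    {R : List (ℝ × ℝ)} (D : Disk G σ (v :: q :: (R ++ [p])))
    (hc : ∀ a ∈ v :: q :: (R ++ [p]), ∀ b ∈ v :: q :: (R ++ [p]), G.Adj a b →
      Nx (v :: q :: (R ++ [p])) a b ∨ Nx (v :: q :: (R ++ [p])) b a)
    (hint : ∃ w ∈ G.verts, w ∉ v :: q :: (R ++ [p])) (hnc : ¬ G.IsContractible p v) :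
    ∃ x ∈ G.verts, x ∉ v :: q :: (R ++ [p]) ∧ G.Adj v x ∧
      (G.deleteVerts {v, x}).IsNearTriangulation := by
  have hnd := D.nodup
  have hnxp : Nx (v :: q :: (R ++ [p])) p v := by
    rw [nx_cons]
    have : v :: (q :: (R ++ [p]) ++ [v]) = (v :: q :: R) ++ p :: [v] := by simp
    rw [this, adjc_append_cons]; simp
  have hpv : G.Adj p v := D.adj _ _ hnxp
  obtain ⟨M, hF⟩ := D.exists_fan'
  have hM := hF.disjoint hnd (hc v (by simp))
  have D1 := D.remove hσ hF hM
  have hR : R = [] → G.Adj q p := by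
    rintro rfl
    refine (D1.adj q p ?_).1
    simp [nx_cons]
  have hR' : G.Adj p q → R = [] := by
    intro hpq
    rcases List.eq_nil_or_concat R with h | ⟨R, s, rfl⟩
    · exact h
    · exfalso
      rw [List.concat_eq_append] at *
      have hs : Nx (v :: q :: (R ++ [s] ++ [p])) s p := by
        rw [nx_cons]
        have : v :: (q :: (R ++ [s] ++ [p]) ++ [v]) = (v :: q :: R) ++ s :: [p, v] := by simp
        rw [this, adjc_append_cons]; simp
      rcases hc p (by simp) q (by simp) hpq with h | h
      · have := nx_unique hnd h (p' := v) (by simp [nx_cons])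
        simp [this] at hnd
      · have := nx_unique hnd h hs
        simp [this] at hnd
  have hMne : M ≠ [] := by
    rintro rfl
    have hqp : G.Adj p q := G.symm _ _ ((hF.adjc_iff p q).mp (by simp)).2.1
    have := hR' hqp
    subst this
    obtain ⟨w, hw, hwL⟩ := hint
    simp only [List.nil_append, List.mem_cons, List.not_mem_nil, or_false, not_or] at hwL
    rcases D1.verts_of_two (x := w) (by simp [deleteVerts, hw, hwL.1]) with h | h
    exacts [hwL.2.1 h, hwL.2.2 h]
  by_cases hch : ∃ A a N b B, p :: (M ++ [q]) = A ++ a :: N ++ b :: B ∧ N ≠ [] ∧ G.Adj a b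
  · obtain ⟨A, a, N, b, B, e, hN, hab⟩ := hch
    have D1' : Disk (G.deleteVerts {v}) σ (a :: N ++ b :: (B ++ R ++ A)) := by
      have e1 : q :: (R ++ [p]) ++ M = (q :: R) ++ (p :: M) := by simp
      have e2 : p :: M ++ q :: R = A ++ (a :: N ++ b :: B ++ R) := by
        have : p :: M ++ q :: R = (p :: (M ++ [q])) ++ R := by simp
        rw [this, e]; simp
      rw [e1] at D1
      have := D1.rotate
      rw [e2] at this
      simpa using this.rotate
    have hFv : ∀ y ∈ p :: (M ++ [q]), y ≠ v := by
      intro y hy hyv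
      subst hyv
      exact G.loopless y ((hF.mem_iff y).mp hy)
    have ha := hFv a (by rw [e]; simp)
    have hb := hFv b (by rw [e]; simp)
    obtain ⟨x, hx, hxc⟩ := D1'.exists_chordless hσ ⟨G.symm _ _ hab, by simpa using hb,
      by simpa using ha⟩ hN
    have hxM : x ∈ M := by
      have h1 := hF.nodup
      have h2 : x ∈ p :: (M ++ [q]) := by rw [e]; simp [hx]
      have hxp : x ≠ p := by
        rintro rfl
        cases A with
        | nil =>
          simp only [List.nil_append, List.cons_append, List.cons.injEq] at e
          rw [e.2] at h1
          simp [hx] at h1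
        | cons c A =>
          simp only [List.cons_append, List.cons.injEq] at e
          rw [e.2] at h1
          simp [hx] at h1
      have hxq : x ≠ q := by
        rintro rfl
        rcases List.eq_nil_or_concat B with rfl | ⟨B, c, rfl⟩
        · have e' : (p :: M) ++ [x] = (A ++ a :: N) ++ [b] := by simpa using e
          have := (List.append_inj' e' rfl).1
          have h3 : (p :: M ++ [x]).Nodup := h1
          rw [this] at h3
          exact (List.nodup_append.mp h3).2.2 x (by simp [hx]) x (by simp) rfl
        · rw [List.concat_eq_append] at e
          have e' : (p :: M) ++ [x] = (A ++ a :: N ++ b :: B) ++ [c] := by simpa using e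
          have := (List.append_inj' e' rfl).1
          have h3 : (p :: M ++ [x]).Nodup := h1
          rw [this] at h3
          exact (List.nodup_append.mp h3).2.2 x (by simp [hx]) x (by simp) rfl
      simp at h2
      tauto
    have hvx : G.Adj v x := (hF.mem_iff x).mp (by simp [hxM])
    obtain ⟨A', B', q', R', p', M', -, -, -, D2, hl⟩ := D1'.exists_remove hσ
      (by have := List.length_pos_iff.mpr hN; simp; omega) (v := x) (by simp [hx]) hxc
    by_cases h3 : 3 ≤ (q' :: (R' ++ [p']) ++ M').length
    · refine ⟨x, (G.mem_of_adj _ _ hvx).2, ?_, hvx, ?_⟩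
      · have := hM x hxM
        have hxv : x ≠ v := hFv x (by simp [hxM])
        simp at this ⊢
        tauto
      · rw [← deleteVerts_pair]
        exact D2.isNearTriangulation h3
    · exfalso
      have hlen := congrArg List.length e
      have hM0 := List.length_pos_iff.mpr hMne
      have hN0 := List.length_pos_iff.mpr hN
      simp at h3 hl hlen
      have hR0 : R = [] := List.length_eq_zero_iff.mp (by omega)
      obtain ⟨y, rfl⟩ : ∃ y, M = [y] := List.length_eq_one_iff.mp (by omega)
      subst hR0
      refine hnc (.of_isNearTriangulation_deleteVerts hpv (D1.isNearTriangulation (by simp)) ?_)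
      intro z hz hzp
      have hz' := (hF.mem_iff z).mpr hz
      simp [hzp] at hz'
      rcases hz' with rfl | rfl
      · exact (D1.adj p z (by simp [nx_cons])).1
      · exact G.symm _ _ (hR rfl)
  · exfalso
    push Not at hch
    have hRne : R ≠ [] := fun h => hch [] p M q [] (by simp) hMne (G.symm _ _ (hR h))
    rcases List.eq_nil_or_concat R with rfl | ⟨R, s, rfl⟩
    · exact hRne rfl
    rw [List.concat_eq_append] at *
    obtain ⟨m, M, rfl⟩ := List.exists_cons_of_ne_nil hMne
    refine hnc (D.isContractible hσ hF D1 fun y hy hpy => ?_)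
    have hs : Nx (v :: q :: (R ++ [s] ++ [p])) s p := by
      rw [nx_cons]
      have : v :: (q :: (R ++ [s] ++ [p]) ++ [v]) = (v :: q :: R) ++ s :: [p, v] := by simp
      rw [this, adjc_append_cons]; simp
    rcases List.mem_append.mp hy with hy | hy
    · have hyv : y ≠ v := by
        rintro rfl
        exact (List.nodup_cons.mp hnd).1 hy
      rcases hc p (by simp) y (List.mem_cons_of_mem _ hy) hpy with h | h
      · have D' : Disk G σ (p :: v :: (q :: (R ++ [s]))) := by
          have e : v :: q :: (R ++ [s] ++ [p]) = (v :: q :: (R ++ [s])) ++ [p] := by simp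
          rw [e] at D
          exact D.rotate
        refine absurd (eq_of_nx_head' (v := p) (q := v) (A := q :: (R ++ [s]))
          (List.nodup_cons.mp D'.nodup).1 ?_) hyv
        have e : v :: q :: (R ++ [s] ++ [p]) = (v :: q :: (R ++ [s])) ++ [p] := by simp
        rw [e, nx_append_comm] at h
        exact h
      · exact Or.inl (nx_unique hnd h hs)
    · right
      rcases List.mem_cons.mp hy with rfl | hy
      · rfl
      · obtain ⟨X, Y, rfl⟩ := List.append_of_mem hy
        exact absurd hpy (hch [] p (m :: X) y (Y ++ [q]) (by simp) (by simp))

end PlaneGraph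

/-- Let `T` be a near-triangulation with boundary cycle
`C = (u_1, …, u_h, u_1)` that has no diagonals and contains at least one interior vertex, and
let `u_i` be a boundary vertex.  If the boundary edge `(u_{i-1}, u_i)` is not contractible in
`T`, then there exists an interior vertex `v_i` adjacent to `u_i` such that `T − {u_i, v_i}`
is a near-triangulation. -/
theorem delete_vertex_pair_of_not_contractible (T : PlaneGraph) (h : ℕ)
    (u : ZMod h → ℝ × ℝ) (i : ZMod h)
    (hT : T.IsNearTriangulation) (hu : T.IsBoundaryCycle u)
    (hnd : T.HasNoDiagonals u) (hint : ∃ v, T.IsInteriorVtx u v)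
    (hnc : ¬ T.IsContractible (u (i - 1)) (u i)) :
    ∃ v : ℝ × ℝ, T.IsInteriorVtx u v ∧ T.Adj (u i) v ∧
      (T.deleteVerts {u i, v}).IsNearTriangulation := by
  obtain ⟨σ, hσ, R, D, hmem, hchord⟩ := PlaneGraph.exists_disk hT hu hnd hint i
  obtain ⟨x, hx, hxL, hvx, hx2⟩ := D.exists_deleteVerts_pair hσ (fun a ha b hb hab => by
    obtain ⟨j, rfl⟩ := (hmem a).mp ha
    obtain ⟨k, rfl⟩ := (hmem b).mp hb
    exact hchord j k hab) (hint.imp fun w hw => ⟨hw.1, by rw [hmem]; exact hw.2⟩) hnc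
  exact ⟨x, ⟨hx, by rwa [hmem] at hxL⟩, hvx, hx2⟩
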